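/- Let w ≥ 6 be an even integer and d_w = ⌊(w−2)/4⌋ ≥ 1. Then each of the two families of products of Eisenstein series (E^0_{2j+2} · E^{i∞}_{w−2j})_{j=1,…,d_w} and (E^0_{w−2j} · E^{i∞}_{2j+2})_{j=1,…,d_w} is a basis of S_{w+2}(Γ₀(2)): each product is a cusp form of weight w+2 on Γ₀(2), in each family the functions are linearly independent over ℂ, and for every cusp form f ∈ S_{w+2}(Γ₀(2)) there exist complex numbers c₁,…,c_{d_w} with f(z) = Σ_{j=1}^{d_w} c_j · (the j-th product)(z) for all z ∈ ℍ. -/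

import Mathlib

open MeasureTheory

noncomputable section

/-- The normalized Eisenstein series for the cusp `i∞`:
`E^{i∞}_k(z) = (1/2) Σ_{gcd(c,d)=1, c even} (cz+d)^{−k}`, viewed as a function on `ℂ`. -/
def Einf (k : ℕ) (z : ℂ) : ℂ :=
  (1 / 2 : ℂ) * ∑' p : {p : ℤ × ℤ // Int.gcd p.1 p.2 = 1 ∧ Even p.1},
    ((p.1.1 : ℂ) * z + (p.1.2 : ℂ)) ^ (-(k : ℤ))

/-- The normalized Eisenstein series for the cusp `0`:
`E^0_k(z) = (1/2) Σ_{gcd(c,d)=1, c odd} (cz+d)^{−k}`, viewed as a function on `ℂ`. -/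
def Ezero (k : ℕ) (z : ℂ) : ℂ :=
  (1 / 2 : ℂ) * ∑' p : {p : ℤ × ℤ // Int.gcd p.1 p.2 = 1 ∧ Odd p.1},
    ((p.1.1 : ℂ) * z + (p.1.2 : ℂ)) ^ (-(k : ℤ))

namespace EPB

open UpperHalfPlane ModularForm CongruenceSubgroup Matrix Matrix.SpecialLinearGroup Filter Topology
open scoped MatrixGroups Manifold

/-- Bundle a function with the right properties as a cusp form. -/
lemma mkCusp {k : ℤ} (f : ℍ → ℂ) (hinv : ∀ γ ∈ Gamma0 2, f ∣[k] γ = f) (hol : MDiff f)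
    (hz : ∀ δ : SL(2, ℤ), IsZeroAtImInfty (f ∣[k] δ)) :
    ∃ F : CuspForm (Gamma0 2) k, ⇑F = f := by
  refine ⟨⟨⟨f, ?_⟩, hol, ?_⟩, rfl⟩
  · rintro _ ⟨A, hA, rfl⟩
    exact hinv A hA
  · intro c hc
    have hc' : IsCusp c 𝒮ℒ := (Subgroup.IsArithmetic.isCusp_iff_isCusp_SL2Z _).mp hc
    rw [OnePoint.isZeroAt_iff_forall_SL2Z hc']
    intro γ _
    exact hz γ

lemma mkModular {k : ℤ} (f : ℍ → ℂ) (hinv : ∀ γ ∈ Gamma0 2, f ∣[k] γ = f) (hol : MDiff f)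
    (hz : ∀ δ : SL(2, ℤ), IsBoundedAtImInfty (f ∣[k] δ)) :
    ∃ F : ModularForm (Gamma0 2) k, ⇑F = f := by
  refine ⟨⟨⟨f, ?_⟩, hol, ?_⟩, rfl⟩
  · rintro _ ⟨A, hA, rfl⟩
    exact hinv A hA
  · intro c hc
    have hc' : IsCusp c 𝒮ℒ := (Subgroup.IsArithmetic.isCusp_iff_isCusp_SL2Z _).mp hc
    rw [OnePoint.isBoundedAt_iff_forall_SL2Z hc']
    intro γ _
    exact hz γ

lemma cusp_slash {k : ℤ} (F : CuspForm (Gamma0 2) k) {γ : SL(2, ℤ)} (hγ : γ ∈ Gamma0 2) :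
    (F : ℍ → ℂ) ∣[k] γ = F :=
  F.slash_action_eq' _ ⟨γ, hγ, rfl⟩

lemma cusp_zero {k : ℤ} (F : CuspForm (Gamma0 2) k) (δ : SL(2, ℤ)) :
    IsZeroAtImInfty ((F : ℍ → ℂ) ∣[k] δ) := by
  have hc : IsCusp (mapGL ℝ δ • OnePoint.infty) 𝒮ℒ := isCusp_SL2Z_iff'.mpr ⟨δ, rfl⟩
  have hc' : IsCusp (mapGL ℝ δ • OnePoint.infty) (Gamma0 2 : Subgroup (GL (Fin 2) ℝ)) :=
    (Subgroup.IsArithmetic.isCusp_iff_isCusp_SL2Z _).mpr hc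
  exact F.zero_at_cusps' hc' _ rfl

/-- sums of functions that vanish at infinity -/
lemma tsum_zeroAt {ι : Type*} (u : ι → ℍ → ℂ) (hu : ∀ i, IsZeroAtImInfty (u i)) (N : ℕ) (hN : 0 < N)
    (B : ι → ℝ) (hB : Summable B) (hb : ∀ i, ∀ z ∈ verticalStrip N 1, ‖u i z‖ ≤ B i)
    (hper : ∀ (z : ℍ) (n : ℤ), ∑' i, u i (ModularGroup.T ^ (N * n) • z) = ∑' i, u i z) :
    IsZeroAtImInfty (fun z => ∑' i, u i z) := by
  have h1 : Tendsto (fun z => ∑' i, u i z) (atImInfty ⊓ 𝓟 (verticalStrip N 1)) (𝓝 (∑' i : ι, 0)) := by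
    refine tendsto_tsum_of_dominated_convergence hB (fun i => (hu i).mono_left inf_le_left) ?_
    filter_upwards [mem_inf_of_right (mem_principal_self _)] with z hz i using hb i z hz
  rw [tsum_zero] at h1
  rw [UpperHalfPlane.isZeroAtImInfty_iff]
  intro ε hε
  have h2 := (Metric.tendsto_nhds.mp h1) ε hε
  rw [eventually_inf_principal] at h2
  obtain ⟨A, -, hA⟩ := UpperHalfPlane.atImInfty_basis.eventually_iff.mp h2
  refine ⟨max A 1, fun z hz => ?_⟩
  obtain ⟨n, hn⟩ := ModularGroup_T_zpow_mem_verticalStrip z hN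
  have him : (ModularGroup.T ^ (N * n) • z).im = z.im := by
    rw [UpperHalfPlane.modular_T_zpow_smul, UpperHalfPlane.vadd_im]
  have h3 := @hA (ModularGroup.T ^ (N * n) • z) (by
    simp only [Set.mem_preimage, Set.mem_Ici, him]; exact le_trans (le_max_left _ _) hz) ?_
  · rw [dist_zero_right] at h3
    rw [← hper z n]
    exact h3.le
  · refine verticalStrip_anti_right N (le_trans (le_max_right _ _) hz) hn

end EPB

namespace EPB
open UpperHalfPlane ModularForm CongruenceSubgroup Matrix Matrix.SpecialLinearGroup Filter Topology
open scoped MatrixGroups Manifold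

/-- linear form `v 0 * z + v 1` -/
def lf (v : Fin 2 → ℤ) (z : ℂ) : ℂ := (v 0 : ℂ) * z + v 1

lemma lf_ne {v : Fin 2 → ℤ} (hv : v ≠ 0) (z : ℍ) : lf v z ≠ 0 := by
  have h := EisensteinSeries.r_mul_max_le z hv
  have h2 : 0 < EisensteinSeries.r z * ‖v‖ := mul_pos (EisensteinSeries.r_pos z) (norm_pos_iff.mpr hv)
  exact norm_pos_iff.mp (lt_of_lt_of_le h2 h)

lemma lf_bound (A B : ℝ) (hB : 0 < B) (k : ℕ) : ∃ C : ℝ, 0 ≤ C ∧ ∀ z ∈ verticalStrip A B,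
    ∀ v : Fin 2 → ℤ, ‖lf v z ^ (-(k : ℤ))‖ ≤ C * ‖v‖ ^ (-(k : ℤ)) := by
  refine ⟨EisensteinSeries.r ⟨⟨A, B⟩, hB⟩ ^ (-(k : ℤ)), (zpow_pos (EisensteinSeries.r_pos _) _).le, fun z hz v => ?_⟩
  have := EisensteinSeries.summand_bound_of_mem_verticalStrip (k := (k : ℝ)) (by positivity) v hB hz
  rw [norm_zpow]
  exact_mod_cast this

lemma summable_norm_v {k : ℕ} (hk : 3 ≤ k) : Summable fun v : Fin 2 → ℤ => ‖v‖ ^ (-(k : ℤ)) := by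
  have : (2 : ℝ) < k := by exact_mod_cast hk
  exact_mod_cast EisensteinSeries.summable_one_div_norm_rpow this

lemma row_ne (g : SL(2, ℤ)) (i : Fin 2) : g i ≠ 0 := by
  intro h
  have := g.det_coe
  rw [Matrix.det_fin_two] at this
  have h0 := congrFun h 0
  have h1 := congrFun h 1
  fin_cases i <;> simp_all

lemma denom_eq_lf (g : SL(2, ℤ)) (z : ℍ) : denom g z = lf (g 1) z := by
  simp [denom, lf]

lemma smul_eq_lf (g : SL(2, ℤ)) (z : ℍ) : ((g • z : ℍ) : ℂ) = lf (g 0) z / lf (g 1) z := by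
  rw [UpperHalfPlane.specialLinearGroup_apply]; simp [lf]

/-- bound for the terms of a Poincaré series -/
lemma slash_bound {k l : ℕ} {C : ℝ} {φ : ℍ → ℂ} (hφ : ∀ τ : ℍ, ‖φ τ‖ ≤ C * ‖(τ : ℂ)‖ ^ (-(k : ℤ)))
    (g : SL(2, ℤ)) (z : ℍ) :
    ‖(φ ∣[((k + l : ℕ) : ℤ)] g) z‖ ≤ C * (‖lf (g 0) z ^ (-(k : ℤ))‖ * ‖lf (g 1) z ^ (-(l : ℤ))‖) := by
  rw [SL_slash_apply, denom_eq_lf, norm_mul]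
  have h1 := hφ (g • z)
  rw [smul_eq_lf] at h1
  have hne : ‖lf (g 1) z‖ ≠ 0 := norm_ne_zero_iff.mpr (lf_ne (row_ne g 1) z)
  calc _ ≤ C * ‖lf (g 0) z / lf (g 1) z‖ ^ (-(k : ℤ)) * ‖lf (g 1) z ^ (-((k + l : ℕ) : ℤ))‖ := by gcongr
    _ = _ := by
      rw [norm_div, norm_zpow, norm_zpow, norm_zpow, div_zpow]
      push_cast
      rw [show -((k : ℤ) + l) = -(k : ℤ) + -(l : ℤ) by ring, zpow_add₀ hne]
      field_simp

lemma rows_inj : Function.Injective (fun g : SL(2, ℤ) => (g 0, g 1)) := by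
  intro g h hgh
  simp only [Prod.mk.injEq] at hgh
  ext i j
  fin_cases i
  · exact congrFun hgh.1 j
  · exact congrFun hgh.2 j

/-- a summable bound for Poincaré terms on vertical strips -/
lemma poin_strip {k l : ℕ} (hk : 3 ≤ k) (hl : 3 ≤ l) {C : ℝ} {φ : ℍ → ℂ} 
    (hφ : ∀ τ : ℍ, ‖φ τ‖ ≤ C * ‖(τ : ℂ)‖ ^ (-(k : ℤ))) (A B : ℝ) (hB : 0 < B) :
    ∃ b : SL(2, ℤ) → ℝ, Summable b ∧ ∀ g, ∀ z ∈ verticalStrip A B,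
      ‖(φ ∣[((k + l : ℕ) : ℤ)] g) z‖ ≤ b g := by
  have hC : 0 ≤ C := by
    have h1 := (norm_nonneg _).trans (hφ UpperHalfPlane.I)
    simpa using h1
  obtain ⟨C1, hC1, h1⟩ := lf_bound A B hB k
  obtain ⟨C2, hC2, h2⟩ := lf_bound A B hB l
  refine ⟨fun g => C * ((C1 * ‖g 0‖ ^ (-(k : ℤ))) * (C2 * ‖g 1‖ ^ (-(l : ℤ)))), ?_, ?_⟩
  · apply Summable.mul_left
    have hs := ((summable_norm_v hk).mul_left C1).mul_of_nonneg ((summable_norm_v hl).mul_left C2)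
      (fun v => by positivity) (fun v => by positivity)
    exact (hs.comp_injective rows_inj).congr (fun g => rfl)
  · intro g z hz
    refine (slash_bound hφ g z).trans ?_
    exact mul_le_mul_of_nonneg_left (mul_le_mul (h1 z hz _) (h2 z hz _) (norm_nonneg _)
      (by positivity)) hC

lemma poin_summable {k l : ℕ} (hk : 3 ≤ k) (hl : 3 ≤ l) {C : ℝ} {φ : ℍ → ℂ} 
    (hφ : ∀ τ : ℍ, ‖φ τ‖ ≤ C * ‖(τ : ℂ)‖ ^ (-(k : ℤ))) (z : ℍ) :
    Summable fun g : SL(2, ℤ) => ‖(φ ∣[((k + l : ℕ) : ℤ)] g) z‖ := by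
  obtain ⟨b, hb, h⟩ := poin_strip hk hl hφ |z.re| z.im z.im_pos
  exact Summable.of_nonneg_of_le (fun _ => norm_nonneg _) (fun g => h g z ⟨le_rfl, le_rfl⟩) hb

lemma lf_inv_le (v : Fin 2 → ℤ) (hv : v ≠ 0) (z : ℍ) (hz : 1 ≤ z.im) : 1 ≤ ‖lf v z‖ ∧ (v 0 ≠ 0 → z.im ≤ ‖lf v z‖) := by
  have him : (lf v z).im = v 0 * z.im := by simp [lf]
  have key : v 0 ≠ 0 → z.im ≤ ‖lf v z‖ := by
    intro h
    have h1 : (1 : ℝ) ≤ |(v 0 : ℝ)| := by exact_mod_cast Int.one_le_abs h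
    calc z.im ≤ |(v 0 : ℝ)| * z.im := le_mul_of_one_le_left z.im_pos.le h1
      _ = |(lf v z).im| := by rw [him, abs_mul, abs_of_pos z.im_pos]
      _ ≤ _ := Complex.abs_im_le_norm _
  refine ⟨?_, key⟩
  by_cases h : v 0 = 0
  · have h1 : v 1 ≠ 0 := by
      intro h1; apply hv; ext i; fin_cases i <;> simp [h, h1]
    have : lf v z = ((v 1 : ℤ) : ℂ) := by simp [lf, h]
    rw [this, Complex.norm_intCast]
    exact_mod_cast Int.one_le_abs h1
  · exact hz.trans (key h)

/-- termwise vanishing -/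
lemma poin_term_zero {k l : ℕ} (hk : 1 ≤ k) (hl : 1 ≤ l) {C : ℝ} {φ : ℍ → ℂ} 
    (hφ : ∀ τ : ℍ, ‖φ τ‖ ≤ C * ‖(τ : ℂ)‖ ^ (-(k : ℤ))) (g : SL(2, ℤ)) :
    IsZeroAtImInfty (φ ∣[((k + l : ℕ) : ℤ)] g) := by
  have hC : 0 ≤ C := by
    have h1 := (norm_nonneg _).trans (hφ UpperHalfPlane.I)
    simpa using h1
  rw [UpperHalfPlane.isZeroAtImInfty_iff]
  intro ε hε
  refine ⟨max 1 (C / ε), fun z hz => ?_⟩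
  have hz1 : 1 ≤ z.im := (le_max_left _ _).trans hz
  have hz2 : C / ε ≤ z.im := (le_max_right _ _).trans hz
  obtain ⟨a0, b0⟩ := lf_inv_le (g 0) (row_ne g 0) z hz1
  obtain ⟨a1, b1⟩ := lf_inv_le (g 1) (row_ne g 1) z hz1
  have hpow : ∀ (x : ℝ) (n : ℕ), 1 ≤ x → 1 ≤ n → x ^ (-(n : ℤ)) ≤ x⁻¹ := by
    intro x n hx hn
    rw [← _root_.zpow_neg_one]
    exact zpow_le_zpow_right₀ hx (by omega)
  have hone : ∀ (x : ℝ), 1 ≤ x → x⁻¹ ≤ 1 := fun x hx => inv_le_one_of_one_le₀ hx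
  have hinv : ‖lf (g 0) z‖⁻¹ * ‖lf (g 1) z‖⁻¹ ≤ z.im⁻¹ := by
    by_cases h : g 0 0 = 0
    · have h' : g 1 0 ≠ 0 := by
        intro h'
        have := g.det_coe
        rw [Matrix.det_fin_two] at this
        simp [h, h'] at this
      calc _ ≤ 1 * z.im⁻¹ := by
            gcongr
            · exact hone _ a0
            · exact b1 h'
        _ = _ := one_mul _
    · calc _ ≤ z.im⁻¹ * 1 := by
            gcongr
            · exact b0 h
            · exact hone _ a1
        _ = _ := mul_one _
  calc _ ≤ C * (‖lf (g 0) z‖⁻¹ * ‖lf (g 1) z‖⁻¹) := by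
        refine (slash_bound hφ g z).trans ?_
        rw [norm_zpow, norm_zpow]
        gcongr
        · exact hpow _ _ a0 hk
        · exact hpow _ _ a1 hl
    _ ≤ C * z.im⁻¹ := by gcongr
    _ ≤ ε := by
      rw [← div_eq_mul_inv, div_le_iff₀ z.im_pos]
      rw [div_le_iff₀ hε] at hz2
      linarith

/-- holomorphy of sums with bounds on strips -/
lemma mdiff_tsum {ι : Type*} (u : ι → ℍ → ℂ) (hu : ∀ i, MDiff (u i))
    (hb : ∀ A B : ℝ, 0 < B → ∃ b : ι → ℝ, Summable b ∧ ∀ i, ∀ z ∈ verticalStrip A B, ‖u i z‖ ≤ b i) :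
    MDiff (fun z => ∑' i, u i z) := by
  rw [UpperHalfPlane.mdifferentiable_iff]
  intro z hz
  have hz' : 0 < z.im := hz
  apply DifferentiableAt.differentiableWithinAt
  obtain ⟨b, hbs, hb⟩ := hb (|z.re| + 1) (z.im / 2) (by positivity)
  set s : Set ℂ := {w | |w.re| < |z.re| + 1} ∩ {w | z.im / 2 < w.im} with hs
  have hso : IsOpen s := by
    apply IsOpen.inter
    · exact isOpen_lt (by fun_prop) (by fun_prop)
    · exact isOpen_lt (by fun_prop) (by fun_prop)
  have hzs : z ∈ s := ⟨by simp, by show z.im / 2 < z.im; linarith⟩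
  have := Complex.differentiableOn_tsum_of_summable_norm (F := fun i w => (u i ∘ ofComplex) w) (u := b) (U := s) hbs ?_ hso ?_
  · exact (this.differentiableAt (hso.mem_nhds hzs))
  · intro i
    have h1 := UpperHalfPlane.mdifferentiable_iff.mp (hu i)
    exact h1.mono fun w hw => lt_trans (half_pos hz') hw.2
  · intro i w hw
    have hw0 : 0 < w.im := lt_trans (half_pos hz') hw.2
    simp only [Function.comp_apply]
    rw [ofComplex_apply_of_im_pos hw0]
    apply hb i
    refine ⟨?_, ?_⟩
    · exact hw.1.le
    · exact hw.2.le

/-- Poincaré series -/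
def Poin (K : ℤ) (φ : ℍ → ℂ) (z : ℍ) : ℂ := ∑' γ : Gamma0 2, (φ ∣[K] (γ : SL(2, ℤ))) z

lemma Poin_slash (K : ℤ) (φ : ℍ → ℂ) (δ : SL(2, ℤ)) :
    Poin K φ ∣[K] δ = fun z => ∑' γ : Gamma0 2, (φ ∣[K] ((γ : SL(2, ℤ)) * δ)) z := by
  ext z
  rw [SL_slash_apply, Poin, ← tsum_mul_right]
  congr 1
  ext γ
  rw [SlashAction.slash_mul, SL_slash_apply (_ ∣[K] _)]

lemma Poin_inv (K : ℤ) (φ : ℍ → ℂ) {δ : SL(2, ℤ)} (hδ : δ ∈ Gamma0 2) :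
    Poin K φ ∣[K] δ = Poin K φ := by
  rw [Poin_slash]
  ext z
  exact (Equiv.mulRight (⟨δ, hδ⟩ : Gamma0 2)).tsum_eq (fun γ : Gamma0 2 => (φ ∣[K] (γ : SL(2, ℤ))) z)

lemma conj_T_mem (δ : SL(2, ℤ)) (n : ℤ) : δ * ModularGroup.T ^ (2 * n) * δ⁻¹ ∈ Gamma0 2 := by
  rw [CongruenceSubgroup.Gamma0_mem]
  rw [Matrix.SpecialLinearGroup.coe_mul, Matrix.SpecialLinearGroup.coe_mul,
    Matrix.SpecialLinearGroup.coe_inv, ModularGroup.coe_T_zpow, Matrix.adjugate_fin_two]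
  simp [Matrix.mul_apply, Fin.sum_univ_two]
  have h2 : (2 : ZMod 2) = 0 := rfl
  rw [h2]; ring_nf; rw [h2, mul_zero]

lemma Poin_cusp {k l : ℕ} (hk : 3 ≤ k) (hl : 3 ≤ l) {C : ℝ} {φ : ℍ → ℂ} (hol : MDiff φ)
    (hφ : ∀ τ : ℍ, ‖φ τ‖ ≤ C * ‖(τ : ℂ)‖ ^ (-(k : ℤ))) :
    ∃ F : CuspForm (Gamma0 2) ((k + l : ℕ) : ℤ), ⇑F = Poin ((k + l : ℕ) : ℤ) φ := by
  have hinj : ∀ δ : SL(2, ℤ), Function.Injective (fun γ : Gamma0 2 => (γ : SL(2, ℤ)) * δ) :=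
    fun δ a b h => Subtype.ext (mul_right_cancel h)
  apply mkCusp
  · intro γ hγ
    exact Poin_inv _ _ hγ
  · unfold Poin
    apply mdiff_tsum
    · intro γ
      exact hol.slash _ _
    · intro A B hB
      obtain ⟨b, hb, h⟩ := poin_strip hk hl hφ A B hB
      exact ⟨fun γ => b γ, hb.subtype _, fun γ z hz => h γ z hz⟩
  · intro δ
    have key := Poin_slash ((k + l : ℕ) : ℤ) φ δ
    have hinv : ∀ (z : ℍ) (n : ℤ), (Poin ((k + l : ℕ) : ℤ) φ ∣[((k + l : ℕ) : ℤ)] δ) (ModularGroup.T ^ (2 * n) • z)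
        = (Poin ((k + l : ℕ) : ℤ) φ ∣[((k + l : ℕ) : ℤ)] δ) z := by
      intro z n
      have h1 : (Poin ((k + l : ℕ) : ℤ) φ ∣[((k + l : ℕ) : ℤ)] δ) ∣[((k + l : ℕ) : ℤ)] (ModularGroup.T ^ (2 * n)) =
          (Poin ((k + l : ℕ) : ℤ) φ ∣[((k + l : ℕ) : ℤ)] δ) := by
        rw [← SlashAction.slash_mul]
        conv_rhs => rw [← Poin_inv ((k + l : ℕ) : ℤ) φ (conj_T_mem δ n)]
        rw [← SlashAction.slash_mul]
        congr 1
        group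
      have h2 := congrFun h1 z
      rw [SL_slash_apply (_ ∣[_] _)] at h2
      rw [denom_eq_lf] at h2
      have h3 : lf ((ModularGroup.T ^ (2 * n)) 1) (z : ℂ) = 1 := by
        rw [lf, ModularGroup.coe_T_zpow]; simp
      rw [h3, _root_.one_zpow, mul_one] at h2
      exact h2
    rw [key]
    obtain ⟨b, hb, h⟩ := poin_strip hk hl hφ (2 : ℕ) 1 one_pos
    refine tsum_zeroAt _ (fun γ => poin_term_zero (by omega) (by omega) hφ _) 2 two_pos (fun γ => b (γ * δ)) (hb.comp_injective (hinj δ)) 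
      (fun γ z hz => h _ z hz) ?_
    intro z n
    have := hinv z n
    rw [key] at this
    exact_mod_cast this

end EPB

namespace EPB
open UpperHalfPlane ModularForm CongruenceSubgroup Matrix.SpecialLinearGroup Filter Topology
open EisensteinSeries
open scoped MatrixGroups Manifold Matrix

def pairFun : ℤ × ℤ ≃ (Fin 2 → ℤ) := (finTwoArrowEquiv ℤ).symm

@[simp] lemma pairFun_zero (p : ℤ × ℤ) : pairFun p 0 = p.1 := rfl
@[simp] lemma pairFun_one (p : ℤ × ℤ) : pairFun p 1 = p.2 := rfl

lemma summable_pair {k : ℕ} (hk : 3 ≤ k) (z : ℍ) :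
    Summable (fun p : ℤ × ℤ => ((p.1 : ℂ) * z + p.2) ^ (-(k : ℤ))) := by
  have := (summable_norm_eisSummand (k := k) (by exact_mod_cast hk) z).of_norm.comp_injective
    pairFun.injective
  exact this

lemma cast_even {n : ℤ} : ((n : ZMod 2) = 0) ↔ Even n := by
  rw [ZMod.intCast_eq_zero_iff_even]
lemma cast_odd {n : ℤ} : ((n : ZMod 2) = 1) ↔ Odd n := by
  rw [ZMod.intCast_eq_one_iff_odd]

lemma Einf_eq (k : ℕ) (z : ℍ) :
    Einf k z = 1 / 2 * eisensteinSeries (N := 2) ![0, 1] k z := by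
  unfold Einf eisensteinSeries
  congr 1
  refine Equiv.tsum_eq (pairFun.subtypeEquiv (p := fun p => Int.gcd p.1 p.2 = 1 ∧ Even p.1)
    (q := fun v => v ∈ gammaSet 2 1 ![0, 1]) ?_) (fun x => eisSummand k x.1 z)
  intro p
  unfold gammaSet
  simp only [Set.mem_ofPred_eq, pairFun_zero, pairFun_one]
  constructor
  · rintro ⟨h1, h2⟩
    refine ⟨?_, h1⟩
    ext i
    fin_cases i
    · simpa using cast_even.mpr h2
    · have : Odd p.2 := by
        by_contra h
        rw [Int.not_odd_iff_even] at h
        have := Int.dvd_gcd h2.two_dvd h.two_dvd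
        rw [h1] at this
        norm_num at this
      simpa using cast_odd.mpr this
  · rintro ⟨h1, h2⟩
    refine ⟨h2, ?_⟩
    have := congrFun h1 0
    simpa [cast_even] using this

lemma sum_eq {k : ℕ} (hk : 3 ≤ k) (z : ℍ) :
    Ezero k z + Einf k z = 1 / 2 * eisensteinSeries (N := 1) 0 k z := by
  unfold Ezero Einf eisensteinSeries
  rw [← mul_add]
  congr 1
  have h3 : ∑' x : gammaSet 1 1 0, eisSummand k x.1 z =
      ∑' p : {p : ℤ × ℤ | Int.gcd p.1 p.2 = 1}, ((p.1.1 : ℂ) * z + p.1.2) ^ (-(k : ℤ)) := by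
    refine (Equiv.tsum_eq (pairFun.subtypeEquiv (p := fun p => p ∈ {p : ℤ × ℤ | Int.gcd p.1 p.2 = 1})
      (q := fun v => v ∈ gammaSet 1 1 0) ?_) (fun x => eisSummand k x.1 z)).symm
    intro p
    rw [gammaSet_one_mem_iff]; rfl
  rw [h3]
  have hs := summable_pair hk z
  have e1 := tsum_subtype {p : ℤ × ℤ | Int.gcd p.1 p.2 = 1 ∧ Odd p.1} (fun p : ℤ × ℤ => ((p.1 : ℂ) * z + p.2) ^ (-(k : ℤ)))
  have e2 := tsum_subtype {p : ℤ × ℤ | Int.gcd p.1 p.2 = 1 ∧ Even p.1} (fun p : ℤ × ℤ => ((p.1 : ℂ) * z + p.2) ^ (-(k : ℤ)))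
  have e3 := tsum_subtype {p : ℤ × ℤ | Int.gcd p.1 p.2 = 1} (fun p : ℤ × ℤ => ((p.1 : ℂ) * z + p.2) ^ (-(k : ℤ)))
  rw [e3]
  refine (congrArg₂ (· + ·) e1 e2).trans ?_
  rw [← (hs.indicator _).tsum_add (hs.indicator _)]
  congr 1
  ext p
  simp only [Set.indicator, Set.mem_ofPred_eq]
  by_cases h : Int.gcd p.1 p.2 = 1
  · rcases Int.even_or_odd p.1 with h' | h'
    · have : ¬ Odd p.1 := by simpa using h'
      simp [h, h', this]
    · have : ¬ Even p.1 := by simpa using h'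
      simp [h, h', this]
  · simp [h]

/-- the three conjugates of `2 E^{i∞}`-/
def Ea (k : ℕ) (a : Fin 2 → ZMod 2) : ℍ → ℂ := eisensteinSeries (N := 2) a k
def Z (k : ℕ) (a : Fin 2 → ZMod 2) : ℍ → ℂ := eisensteinSeries (N := 1) 0 k - Ea k a

lemma Ea_slash (k : ℕ) (a : Fin 2 → ZMod 2) (γ : SL(2, ℤ)) : Ea k a ∣[(k : ℤ)] γ = Ea k (a ᵥ* γ) :=
  eisensteinSeries_slash_apply a k γ

lemma Z_slash (k : ℕ) (a : Fin 2 → ZMod 2) (γ : SL(2, ℤ)) : Z k a ∣[(k : ℤ)] γ = Z k (a ᵥ* γ) := by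
  unfold Z
  rw [sub_eq_add_neg, SlashAction.add_slash, SlashAction.neg_slash, Ea_slash,
    eisensteinSeries_slash_apply, ← sub_eq_add_neg]
  congr 2
  exact Subsingleton.elim _ _

lemma Einf_Ea (k : ℕ) (z : ℍ) : Einf k z = 1 / 2 * Ea k ![0, 1] z := Einf_eq k z
lemma Ezero_Z {k : ℕ} (hk : 3 ≤ k) (z : ℍ) : Ezero k z = 1 / 2 * Z k ![0, 1] z := by
  have h1 := sum_eq hk z
  have h2 := Einf_Ea k z
  simp only [Z, Pi.sub_apply]
  linear_combination h1 - h2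

lemma bdd_eis {N k : ℕ} [NeZero N] (hk : 3 ≤ k) (a : Fin 2 → ZMod N) :
    IsBoundedAtImInfty (eisensteinSeries a k) := by
  have := isBoundedAtImInfty_eisensteinSeriesSIF a (k := k) (by exact_mod_cast hk) 1
  rwa [SlashAction.slash_one] at this

lemma Ea_bdd {k : ℕ} (hk : 3 ≤ k) (a : Fin 2 → ZMod 2) : IsBoundedAtImInfty (Ea k a) := bdd_eis hk a
lemma Z_bdd {k : ℕ} (hk : 3 ≤ k) (a : Fin 2 → ZMod 2) : IsBoundedAtImInfty (Z k a) :=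
  Asymptotics.IsBigO.sub (bdd_eis hk _) (bdd_eis hk a)

lemma Ea_mdiff {k : ℕ} (hk : 3 ≤ k) (a : Fin 2 → ZMod 2) : MDiff (Ea k a) :=
  eisensteinSeriesSIF_mdifferentiable (by exact_mod_cast hk) a
lemma Z_mdiff {k : ℕ} (hk : 3 ≤ k) (a : Fin 2 → ZMod 2) : MDiff (Z k a) :=
  (eisensteinSeriesSIF_mdifferentiable (N := 1) (by exact_mod_cast hk) 0).sub (Ea_mdiff hk a)

lemma vec_gamma {γ : SL(2, ℤ)} (hγ : γ ∈ Gamma0 2) :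
    (![0, 1] : Fin 2 → ZMod 2) ᵥ* (γ.map (Int.castRingHom (ZMod 2)) : SL(2, ZMod 2)) = ![0, 1] := by
  have h1 : ((γ 1 0 : ℤ) : ZMod 2) = 0 := Gamma0_mem.mp hγ
  have h2 : ((γ 1 1 : ℤ) : ZMod 2) = 1 := by
    rw [cast_odd]
    rw [cast_even] at h1
    have := γ.2
    rw [Matrix.det_fin_two] at this
    by_contra h
    rw [Int.not_odd_iff_even] at h
    have h5 : Even (γ 0 0 * γ 1 1 - γ 0 1 * γ 1 0) := (h.mul_left _).sub (h1.mul_left _)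
    rw [show γ 0 0 * γ 1 1 - γ 0 1 * γ 1 0 = 1 from this] at h5
    exact absurd h5 (by decide)
  ext i
  fin_cases i
  · simpa [Matrix.vecMul, dotProduct] using h1
  · simpa [Matrix.vecMul, dotProduct] using h2

lemma vec_T (a : Fin 2 → ZMod 2) (n : ℤ) :
    a ᵥ* ((ModularGroup.T ^ (2 * n)).map (Int.castRingHom (ZMod 2)) : SL(2, ZMod 2)) = a := by
  have h2 : (2 : ZMod 2) = 0 := rfl
  have key : ∀ g : SL(2, ℤ), g.1 = !![1, 2 * n; 0, 1] →
      a ᵥ* (g.map (Int.castRingHom (ZMod 2)) : SL(2, ZMod 2)) = a := by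
    intro g hg
    ext i
    fin_cases i
    · simp [Matrix.vecMul, dotProduct, hg]
    · simp [Matrix.vecMul, dotProduct, hg, h2]
  exact key _ (ModularGroup.coe_T_zpow _)

lemma slash_T_apply {k : ℤ} {f : ℍ → ℂ} {n : ℤ} (h : f ∣[k] (ModularGroup.T ^ n) = f) (z : ℍ) :
    f (ModularGroup.T ^ n • z) = f z := by
  have := congrFun h z
  rw [SL_slash_apply] at this
  rw [denom_eq_lf] at this
  have h1 : (ModularGroup.T ^ n) 1 = ![0, 1] := by
    have := ModularGroup.coe_T_zpow n
    ext i
    have h := congrFun (congrFun this 1) i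
    fin_cases i <;> exact h
  rw [h1] at this
  simpa [lf] using this

lemma term_zero {k : ℕ} (hk : 3 ≤ k) (v : Fin 2 → ℤ) (hv : v 0 ≠ 0) :
    IsZeroAtImInfty (fun z : ℍ => eisSummand k v z) := by
  rw [UpperHalfPlane.isZeroAtImInfty_iff]
  intro ε hε
  refine ⟨max 1 (1 / ε), fun z hz => ?_⟩
  have h1 : 1 ≤ z.im := le_trans (le_max_left _ _) hz
  have h2 : 1 / ε ≤ z.im := le_trans (le_max_right _ _) hz
  have hv' : v ≠ 0 := fun h => hv (by rw [h]; rfl)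
  obtain ⟨h3, h4⟩ := lf_inv_le v hv' z h1
  have h5 := h4 hv
  have : ‖eisSummand k v z‖ = (‖lf v z‖ ^ k)⁻¹ := by
    rw [← norm_pow, ← norm_inv]; simp [eisSummand, lf]
  rw [this]
  calc (‖lf v z‖ ^ k)⁻¹ ≤ (‖lf v z‖)⁻¹ := by
        apply inv_anti₀ (by linarith)
        exact le_self_pow₀ h3 (by omega)
    _ ≤ (1 / ε)⁻¹ := by
        apply inv_anti₀ (by positivity); linarith
    _ = ε := by simp

lemma sub_tsum_zero {k : ℕ} (hk : 3 ≤ k) {ι : Type*} (f : ι → (Fin 2 → ℤ))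
    (hf : Function.Injective f) (h0 : ∀ i, f i 0 ≠ 0)
    (hper : ∀ (z : ℍ) (n : ℤ), ∑' i, eisSummand k (f i) (ModularGroup.T ^ (2 * n) • z) = ∑' i, eisSummand k (f i) z) :
    IsZeroAtImInfty (fun z => ∑' i, eisSummand k (f i) z) := by
  obtain ⟨C, hC, hb⟩ := lf_bound (2 : ℕ) 1 one_pos k
  refine tsum_zeroAt (fun i z => eisSummand k (f i) z) (fun i => term_zero hk _ (h0 i)) 2 two_pos
    (fun i => C * ‖f i‖ ^ (-(k : ℤ))) (((summable_norm_v hk).mul_left C).comp_injective hf) ?_ ?_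
  · intro i z hz
    exact hb z hz (f i)
  · intro z n
    exact hper z n

lemma Ea_zero {k : ℕ} (hk : 3 ≤ k) (a : Fin 2 → ZMod 2) (ha : a 0 ≠ 0) : IsZeroAtImInfty (Ea k a) := by
  refine sub_tsum_zero hk (fun x : gammaSet 2 1 a => x.1) Subtype.val_injective ?_ ?_
  · intro x h
    have := congrFun x.2.1 0
    simp only [Function.comp_apply] at this
    rw [h] at this
    exact ha (by simpa using this.symm)
  · intro z n
    have := slash_T_apply (k := k) (f := Ea k a) (n := 2 * n) (by rw [Ea_slash, vec_T]) z
    exact this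

lemma Z_zero {k : ℕ} (hk : 3 ≤ k) : IsZeroAtImInfty (Z k ![0, 1]) := by
  have h0 : Z k ![0, 1] = fun z : ℍ => ∑' p : {p : ℤ × ℤ // Int.gcd p.1 p.2 = 1 ∧ Odd p.1},
      eisSummand k (pairFun p.1) z := by
    ext z
    have := Ezero_Z hk z
    unfold Ezero at this
    have h2 : (1 / 2 : ℂ) ≠ 0 := by norm_num
    exact (mul_left_cancel₀ h2 this).symm
  rw [h0]
  refine sub_tsum_zero hk (fun p : {p : ℤ × ℤ // Int.gcd p.1 p.2 = 1 ∧ Odd p.1} => pairFun p.1)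
    (pairFun.injective.comp Subtype.val_injective) ?_ ?_
  · intro p h
    have := p.2.2
    simp only [pairFun_zero] at h
    rw [h] at this
    exact absurd this (by decide)
  · intro z n
    have := slash_T_apply (k := k) (f := Z k ![0, 1]) (n := 2 * n) (by rw [Z_slash, vec_T]) z
    rw [h0] at this
    exact this

lemma prod_cusp_zero {k l : ℕ} (hk : 3 ≤ k) (hl : 3 ≤ l) (a : Fin 2 → ZMod 2) (ha : a ≠ 0) :
    IsZeroAtImInfty (Z k a * Ea l a) := by
  by_cases h : a 0 = 0
  · have : a = ![0, 1] := by
      have h1 : a 1 ≠ 0 := fun h1 => ha (by ext i; fin_cases i <;> simp [h, h1])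
      have h2 : ∀ x : ZMod 2, x ≠ 0 → x = 1 := by decide
      ext i; fin_cases i
      · simp [h]
      · simp [h2 _ h1]
    rw [this]
    have := (Z_zero hk).zero_mul_isBoundedUnder_le
      ((Ea_bdd hl ![0, 1]).isBoundedUnder_le)
    exact this
  · have := (Ea_zero hl a h).zero_mul_isBoundedUnder_le ((Z_bdd hk a).isBoundedUnder_le)
    rw [mul_comm]
    exact this

lemma vec_ne (a : Fin 2 → ZMod 2) (ha : a ≠ 0) (γ : SL(2, ℤ)) :
    (a ᵥ* (γ.map (Int.castRingHom (ZMod 2)) : SL(2, ZMod 2))) ≠ (0 : Fin 2 → ZMod 2) := by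
  intro h
  apply ha
  have : a ᵥ* ((γ.map (Int.castRingHom (ZMod 2)) : SL(2, ZMod 2)).1) ᵥ* ((γ.map (Int.castRingHom (ZMod 2)) : SL(2, ZMod 2))⁻¹).1 = 0 := by
    rw [h, Matrix.zero_vecMul]
  rwa [Matrix.vecMul_vecMul, ← Matrix.SpecialLinearGroup.coe_mul, mul_inv_cancel,
    Matrix.SpecialLinearGroup.coe_one, Matrix.vecMul_one] at this


lemma v01_ne : (![0, 1] : Fin 2 → ZMod 2) ≠ 0 := fun h => by
  have := congrFun h 1
  simp at this

lemma slash_mul' {k l : ℕ} (f g : ℍ → ℂ) (δ : SL(2, ℤ)) :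
    (f * g) ∣[((k + l : ℕ) : ℤ)] δ = (f ∣[(k : ℤ)] δ) * (g ∣[(l : ℤ)] δ) := by
  push_cast
  exact mul_slash_SL2 _ _ _ _ _

lemma Einf_modular {k : ℕ} (hk : 3 ≤ k) : ∃ F : ModularForm (Gamma0 2) k, ∀ z : ℍ, F z = Einf k z := by
  obtain ⟨F, hF⟩ := mkModular (k := k) (Ea k ![0, 1]) (fun γ hγ => by rw [Ea_slash, vec_gamma hγ])
    (Ea_mdiff hk _) (fun δ => by rw [Ea_slash]; exact Ea_bdd hk _)
  exact ⟨(1 / 2 : ℂ) • F, fun z => by rw [Einf_Ea, ← hF]; rfl⟩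

lemma Ezero_modular {k : ℕ} (hk : 3 ≤ k) : ∃ F : ModularForm (Gamma0 2) k, ∀ z : ℍ, F z = Ezero k z := by
  obtain ⟨F, hF⟩ := mkModular (k := k) (Z k ![0, 1]) (fun γ hγ => by rw [Z_slash, vec_gamma hγ])
    (Z_mdiff hk _) (fun δ => by rw [Z_slash]; exact Z_bdd hk _)
  exact ⟨(1 / 2 : ℂ) • F, fun z => by rw [Ezero_Z hk, ← hF]; rfl⟩

/-- product of Eisenstein series is a cusp form -/
lemma prod_cusp {k l : ℕ} (hk : 3 ≤ k) (hl : 3 ≤ l) :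
    ∃ F : CuspForm (Gamma0 2) ((k + l : ℕ) : ℤ), ∀ z : ℍ, F z = Ezero k z * Einf l z := by
  obtain ⟨F, hF⟩ := mkCusp (k := ((k + l : ℕ) : ℤ)) (Z k ![0, 1] * Ea l ![0, 1])
    (fun γ hγ => by rw [slash_mul', Z_slash, Ea_slash, vec_gamma hγ])
    ((Z_mdiff hk _).mul (Ea_mdiff hl _))
    (fun δ => by
      rw [slash_mul', Z_slash, Ea_slash]
      exact prod_cusp_zero hk hl _ (vec_ne _ v01_ne _))
  refine ⟨(1 / 4 : ℂ) • F, fun z => ?_⟩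
  rw [Ezero_Z hk, Einf_Ea]
  change (1 / 4 : ℂ) * (F z) = _
  rw [hF, Pi.mul_apply]
  ring

/-- cusp form times modular form -/
lemma cusp_mul {k l : ℤ} (F : CuspForm (Gamma0 2) k) (G : ModularForm (Gamma0 2) l) :
    ∃ H : CuspForm (Gamma0 2) (k + l), ∀ z : ℍ, H z = F z * G z := by
  obtain ⟨H, hH⟩ := mkCusp (k := k + l) (⇑F * ⇑G)
    (fun γ hγ => by
      rw [mul_slash_SL2, cusp_slash F hγ]
      congr 1
      exact G.slash_action_eq' _ ⟨γ, hγ, rfl⟩)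
    (F.holo'.mul G.holo')
    (fun δ => by
      rw [mul_slash_SL2]
      have hc : IsCusp (mapGL ℝ δ • OnePoint.infty) 𝒮ℒ := isCusp_SL2Z_iff'.mpr ⟨δ, rfl⟩
      have hc' : IsCusp (mapGL ℝ δ • OnePoint.infty) (Gamma0 2 : Subgroup (GL (Fin 2) ℝ)) :=
        (Subgroup.IsArithmetic.isCusp_iff_isCusp_SL2Z _).mpr hc
      have hb : IsBoundedAtImInfty (⇑G ∣[l] δ) := G.bdd_at_cusps' hc' _ rfl
      exact (cusp_zero F δ).zero_mul_isBoundedUnder_le hb.isBoundedUnder_le)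
  exact ⟨H, fun z => by rw [hH]; rfl⟩

end EPB

namespace EPB
open UpperHalfPlane ModularForm CongruenceSubgroup Matrix.SpecialLinearGroup Filter Topology
open scoped MatrixGroups Manifold

/-- `λ(k) = Σ_{n odd} n^{-k}` -/
def lam (k : ℕ) : ℝ := ∑' n : ℕ, ((2 * n + 1 : ℝ) ^ k)⁻¹

lemma lam_summable {k : ℕ} (hk : 2 ≤ k) : Summable (fun n : ℕ => ((2 * n + 1 : ℝ) ^ k)⁻¹) := by
  have h := (Real.summable_nat_pow_inv (p := k)).mpr (by omega)
  have h2 := h.comp_injective (i := fun n : ℕ => 2 * n + 1) (fun a b h => by simpa using h)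
  refine h2.congr fun n => ?_
  simp

lemma lam_pos {k : ℕ} (hk : 2 ≤ k) : 0 < lam k :=
  (lam_summable hk).tsum_pos (fun n => by positivity) 0 (by positivity)

def tm (k : ℕ) (z : ℂ) (p : ℤ × ℤ) : ℂ := ((p.1 : ℂ) * z + p.2) ^ (-(k : ℤ))

lemma tm_smul (k : ℕ) (z : ℂ) (m : ℤ) (p : ℤ × ℤ) : tm k z (m * p.1, m * p.2) = ((m : ℂ) ^ k)⁻¹ * tm k z p := by
  unfold tm
  push_cast
  rw [mul_assoc, ← mul_add, mul_zpow, zpow_neg, zpow_natCast]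

lemma tm_summable {k : ℕ} (hk : 3 ≤ k) (z : ℍ) : Summable (fun p => ‖tm k z p‖) := (summable_pair hk z).norm

/-- pulling out the gcd -/
lemma tsum_prim {k : ℕ} (hk : 3 ≤ k) (z : ℍ) (Q : ℤ × ℤ → Prop)
    (h1 : ∀ (m : ℤ) (p : ℤ × ℤ), Odd m → (Q (m * p.1, m * p.2) ↔ Q p))
    (h2 : ∀ p : ℤ × ℤ, Q p → Odd (Int.gcd p.1 p.2)) :
    ∑' p : {p // Q p}, tm k z p.1 = lam k * ∑' p : {p : ℤ × ℤ // Int.gcd p.1 p.2 = 1 ∧ Q p}, tm k z p.1 := by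
  have hs := tm_summable hk z
  let e : ℕ × {p : ℤ × ℤ // Int.gcd p.1 p.2 = 1 ∧ Q p} → {p // Q p} :=
    fun x => ⟨((2 * x.1 + 1 : ℤ) * x.2.1.1, (2 * x.1 + 1 : ℤ) * x.2.1.2), (h1 _ _ ⟨x.1, rfl⟩).mpr x.2.2.2⟩
  have he : Function.Bijective e := by
    constructor
    · rintro ⟨n, ⟨⟨a, b⟩, hp, hq⟩⟩ ⟨n', ⟨⟨a', b'⟩, hp', hq'⟩⟩ h
      simp only [e, Subtype.mk.injEq, Prod.mk.injEq] at h hp hp'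
      have hg : Int.gcd ((2 * n + 1 : ℤ) * a) ((2 * n + 1 : ℤ) * b) = Int.gcd ((2 * n' + 1 : ℤ) * a') ((2 * n' + 1 : ℤ) * b') := by
        rw [h.1, h.2]
      rw [Int.gcd_mul_left, Int.gcd_mul_left, hp, hp'] at hg
      have hn : n = n' := by omega
      subst hn
      have hne : (2 * n + 1 : ℤ) ≠ 0 := by omega
      have ha := mul_left_cancel₀ hne h.1
      have hb := mul_left_cancel₀ hne h.2
      subst ha hb
      rfl
    · rintro ⟨⟨a, b⟩, hq⟩
      obtain ⟨n, hn⟩ := h2 _ hq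
      simp only at hn
      have hgne : Int.gcd a b ≠ 0 := by omega
      have hpos : 0 < Int.gcd a b := by omega
      have ha := Int.mul_ediv_cancel' (Int.gcd_dvd_left a b)
      have hb := Int.mul_ediv_cancel' (Int.gcd_dvd_right a b)
      have hcast : ((Int.gcd a b : ℕ) : ℤ) = 2 * n + 1 := by rw [hn]; push_cast; ring
      refine ⟨⟨n, ⟨(a / Int.gcd a b, b / Int.gcd a b), Int.gcd_ediv_gcd_ediv_gcd hpos, ?_⟩⟩, ?_⟩
      · rw [← h1 (2 * n + 1) _ ⟨n, rfl⟩]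
        simp only
        rw [← hcast, ha, hb]
        exact hq
      · simp only [e, Subtype.mk.injEq, Prod.mk.injEq]
        rw [← hcast]
        exact ⟨ha, hb⟩
  rw [← (Equiv.ofBijective e he).tsum_eq]
  have h3 : ∀ x, tm k z ((Equiv.ofBijective e he) x).1 = (((2 * x.1 + 1 : ℝ) ^ k)⁻¹ : ℝ) * tm k z x.2.1 := by
    intro x
    have := tm_smul k z (2 * x.1 + 1) x.2.1
    push_cast at this ⊢
    exact this
  simp_rw [h3]
  have hl := lam_summable (k := k) (by omega)
  rw [lam, Complex.ofReal_tsum]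
  rw [tsum_mul_tsum_of_summable_norm (f := fun n : ℕ => (((((2 * n + 1 : ℝ) ^ k)⁻¹ : ℝ)) : ℂ))
    (g := fun p : {p : ℤ × ℤ // Int.gcd p.1 p.2 = 1 ∧ Q p} => tm k z p.1)]
  · exact hl.norm.congr fun n => by rw [Complex.norm_real]
  · exact hs.comp_injective Subtype.val_injective

lemma gcd_odd_left {p : ℤ × ℤ} (h : Odd p.1) : Odd (Int.gcd p.1 p.2) := by
  by_contra h'
  rw [Nat.not_odd_iff_even] at h'
  have h3 : ((2 : ℕ) : ℤ) ∣ p.1 := (Int.natCast_dvd_natCast.mpr h'.two_dvd).trans (Int.gcd_dvd_left _ _)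
  rw [← Int.not_even_iff_odd] at h
  exact h (even_iff_two_dvd.mpr h3)

lemma gcd_odd_right {p : ℤ × ℤ} (h : Odd p.2) : Odd (Int.gcd p.1 p.2) := by
  rw [Int.gcd_comm]; exact gcd_odd_left (p := (p.2, p.1)) h

lemma sumA {k : ℕ} (hk : 3 ≤ k) (z : ℍ) :
    ∑' p : {p : ℤ × ℤ // Odd p.1}, tm k z p.1 = 2 * lam k * Ezero k z := by
  rw [tsum_prim hk z (fun p => Odd p.1) (fun m p hm => by simp [Int.odd_mul, hm]) (fun p h => gcd_odd_left h)]
  unfold Ezero tm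
  ring

lemma sumB {k : ℕ} (hk : 3 ≤ k) (z : ℍ) :
    ∑' p : {p : ℤ × ℤ // Even p.1 ∧ Odd p.2}, tm k z p.1 = 2 * lam k * Einf k z := by
  rw [tsum_prim hk z (fun p => Even p.1 ∧ Odd p.2) (fun m p hm => by
    have : ¬ Even m := by simpa using hm
    simp [Int.odd_mul, Int.even_mul, hm, this]) (fun p h => gcd_odd_right h.2)]
  unfold Einf
  have : ∑' p : {p : ℤ × ℤ // Int.gcd p.1 p.2 = 1 ∧ Even p.1 ∧ Odd p.2}, tm k z p.1 =
     ∑' p : {p : ℤ × ℤ // Int.gcd p.1 p.2 = 1 ∧ Even p.1}, tm k z p.1 := by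
    refine Equiv.tsum_eq (Equiv.subtypeEquivRight ?_) (fun p : {p : ℤ × ℤ // Int.gcd p.1 p.2 = 1 ∧ Even p.1} => tm k z p.1)
    rintro ⟨a, b⟩
    constructor
    · rintro ⟨h1, h2, -⟩; exact ⟨h1, h2⟩
    · rintro ⟨h1, h2⟩
      refine ⟨h1, h2, ?_⟩
      by_contra h
      rw [Int.not_odd_iff_even] at h
      have := Int.dvd_gcd h2.two_dvd h.two_dvd
      simp only at h1
      rw [h1] at this
      norm_num at this
  rw [this]
  unfold tm
  ring

def tt (k l : ℕ) (z : ℂ) (x : (ℤ × ℤ) × (ℤ × ℤ)) : ℂ := tm k z x.1 * tm l z x.2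

def dt (x : (ℤ × ℤ) × (ℤ × ℤ)) : ℤ := x.1.1 * x.2.2 - x.1.2 * x.2.1

def DP : Set ((ℤ × ℤ) × (ℤ × ℤ)) := {x | Odd x.1.1 ∧ Even x.2.1 ∧ Odd x.2.2 ∧ 0 < dt x}

lemma tt_summable {k l : ℕ} (hk : 3 ≤ k) (hl : 3 ≤ l) (z : ℍ) : Summable (tt k l z) :=
  summable_mul_of_summable_norm (tm_summable hk z) (tm_summable hl z)

lemma prod_eq_DP {k l : ℕ} (hk : 3 ≤ k) (hl : 3 ≤ l) (hke : Even k) (z : ℍ) :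
    2 * lam k * lam l * (Ezero k z * Einf l z) = ∑' x : DP, tt k l z x.1 := by
  have hA := sumA hk z
  have hB := sumB hl z
  have e1 := tsum_subtype {p : ℤ × ℤ | Odd p.1} (tm k z)
  have e2 := tsum_subtype {p : ℤ × ℤ | Even p.1 ∧ Odd p.2} (tm l z)
  have hs := tt_summable hk hl z
  have hm := tsum_mul_tsum_of_summable_norm (f := Set.indicator {p : ℤ × ℤ | Odd p.1} (tm k z))
    (g := Set.indicator {p : ℤ × ℤ | Even p.1 ∧ Odd p.2} (tm l z))
    (by simpa [Set.indicator_comp_of_zero norm_zero, norm_indicator_eq_indicator_norm] using (tm_summable hk z).indicator _)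
    (by simpa [Set.indicator_comp_of_zero norm_zero, norm_indicator_eq_indicator_norm] using (tm_summable hl z).indicator _)
  have e3 := tsum_subtype DP (tt k l z)
  let N : ((ℤ × ℤ) × (ℤ × ℤ)) ≃ ((ℤ × ℤ) × (ℤ × ℤ)) := (Equiv.neg (ℤ × ℤ)).prodCongr (Equiv.refl _)
  have hN : ∀ x, tt k l z (N x) = tt k l z x := by
    intro x
    have := tm_smul k z (-1) x.1
    have h1 : ((((-1 : ℤ) : ℂ)) ^ k)⁻¹ = 1 := by
      push_cast; rw [hke.neg_one_pow, inv_one]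
    rw [h1, one_mul] at this
    change tm k z (-x.1) * tm l z x.2 = tm k z x.1 * tm l z x.2
    rw [← this]
    congr 2
    ext <;> simp
  have e4 : ∑' x, DP.indicator (tt k l z) (N x) = ∑' x, DP.indicator (tt k l z) x := N.tsum_eq _
  have e5 : ∀ x : (ℤ × ℤ) × (ℤ × ℤ), Set.indicator {p : ℤ × ℤ | Odd p.1} (tm k z) x.1 * 
      Set.indicator {p : ℤ × ℤ | Even p.1 ∧ Odd p.2} (tm l z) x.2 = 
      DP.indicator (tt k l z) x + DP.indicator (tt k l z) (N x) := by
    intro x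
    have hdet : dt (N x) = - dt x := by
      simp [dt, N]; ring
    have hmem : N x ∈ DP ↔ Odd x.1.1 ∧ Even x.2.1 ∧ Odd x.2.2 ∧ dt x < 0 := by
      change Odd (-x.1.1) ∧ Even x.2.1 ∧ Odd x.2.2 ∧ 0 < dt (N x) ↔ _
      rw [hdet]; simp
    by_cases h : Odd x.1.1 ∧ Even x.2.1 ∧ Odd x.2.2
    · obtain ⟨h1, h2, h3⟩ := h
      have ho : Odd (dt x) := by
        unfold dt
        exact (h1.mul h3).sub_even (h2.mul_left _)
      have hne : dt x ≠ 0 := fun h => by rw [h] at ho; exact absurd ho (by decide)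
      rw [Set.indicator_of_mem (by exact h1), Set.indicator_of_mem (by exact ⟨h2, h3⟩)]
      rcases lt_or_gt_of_ne hne with hlt | hgt
      · rw [Set.indicator_of_notMem (fun h => by have := h.2.2.2; omega), Set.indicator_of_mem (hmem.mpr ⟨h1, h2, h3, hlt⟩), hN, zero_add]
        rfl
      · rw [Set.indicator_of_mem (show x ∈ DP from ⟨h1, h2, h3, hgt⟩), Set.indicator_of_notMem (fun h => by have := (hmem.mp h).2.2.2; omega), add_zero]
        rfl
    · rw [Set.indicator_of_notMem (s := DP) (fun h' => h ⟨h'.1, h'.2.1, h'.2.2.1⟩),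
        Set.indicator_of_notMem (s := DP) (fun h' => h (by have := hmem.mp h'; tauto))]
      by_cases h1 : Odd x.1.1
      · rw [Set.indicator_of_notMem (s := {p : ℤ × ℤ | Even p.1 ∧ Odd p.2}) (fun h' => h ⟨h1, h'.1, h'.2⟩)]
        simp
      · rw [Set.indicator_of_notMem (s := {p : ℤ × ℤ | Odd p.1}) h1]
        simp
  have e6 : ∑' x, (DP.indicator (tt k l z) x + DP.indicator (tt k l z) (N x)) = 2 * ∑' x, DP.indicator (tt k l z) x := by
    rw [(hs.indicator _).tsum_add, e4, two_mul]
    exact (N.summable_iff (f := DP.indicator (tt k l z))).mpr (hs.indicator _)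
  simp_rw [e5] at hm
  rw [e6, ← e1, ← e2, ← e3] at hm
  have hm' : (2 * lam k * Ezero k z) * (2 * lam l * Einf l z) = 2 * ∑' x : DP, tt k l z x.1 := by
    rw [← hA, ← hB]; exact hm
  linear_combination hm' / 2

/-- index type of the upper triangular representatives -/
abbrev UU := ℕ × (Σ m : ℕ, Fin (2 * m + 1))

def Ua (u : UU) : ℤ := 2 * u.1 + 1
def Ud (u : UU) : ℤ := 2 * u.2.1 + 1
def Ub (u : UU) : ℤ := (u.2.2 : ℕ)

lemma UU_ext {u u' : UU} (h1 : Ua u = Ua u') (h2 : Ud u = Ud u') (h3 : Ub u = Ub u') : u = u' := by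
  obtain ⟨n, m, b⟩ := u
  obtain ⟨n', m', b'⟩ := u'
  simp only [Ua, Ud, Ub] at *
  have : n = n' := by omega
  have : m = m' := by omega
  subst n' m'
  have : b = b' := by ext; omega
  subst this
  rfl

def eDP (x : Gamma0 2 × UU) : (ℤ × ℤ) × (ℤ × ℤ) :=
  ((x.1.1 0 0 * Ua x.2, x.1.1 0 0 * Ub x.2 + x.1.1 0 1 * Ud x.2),
   (x.1.1 1 0 * Ua x.2, x.1.1 1 0 * Ub x.2 + x.1.1 1 1 * Ud x.2))

lemma det_eq (g : SL(2, ℤ)) : g 0 0 * g 1 1 - g 0 1 * g 1 0 = 1 := by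
  have := g.2
  rwa [Matrix.det_fin_two] at this

lemma gamma_par (g : Gamma0 2) : Odd (g.1 0 0) ∧ Even (g.1 1 0) ∧ Odd (g.1 1 1) := by
  have h := cast_even.mp (Gamma0_mem.mp g.2)
  have hd := det_eq g.1
  have h2 : Odd (g.1 0 0 * g.1 1 1) := by
    have : g.1 0 0 * g.1 1 1 = 1 + g.1 0 1 * g.1 1 0 := by linarith
    rw [this]
    exact Odd.add_even odd_one (h.mul_left _)
  rw [Int.odd_mul] at h2
  exact ⟨h2.1, h, h2.2⟩

lemma eDP_mem (x : Gamma0 2 × UU) : eDP x ∈ DP := by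
  obtain ⟨g, u⟩ := x
  obtain ⟨h1, h2, h3⟩ := gamma_par g
  have ha : Odd (Ua u) := ⟨u.1, rfl⟩
  have hd : Odd (Ud u) := ⟨u.2.1, rfl⟩
  refine ⟨h1.mul ha, h2.mul_right _, (h2.mul_right _).add_odd (h3.mul hd), ?_⟩
  have hdet := det_eq g.1
  have : dt (eDP (g, u)) = Ua u * Ud u := by
    simp only [dt, eDP]
    linear_combination (Ua u * Ud u) * hdet
  rw [this]
  apply mul_pos <;> simp only [Ua, Ud] <;> omega

lemma eDP_inj : Function.Injective eDP := by
  rintro ⟨g, u⟩ ⟨g', u'⟩ h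
  have hd := det_eq g.1
  have hd' := det_eq g'.1
  simp only [eDP, Prod.mk.injEq] at h
  obtain ⟨⟨h1, h2⟩, h3, h4⟩ := h
  have hapos : 0 < Ua u := by simp only [Ua]; omega
  have hapos' : 0 < Ua u' := by simp only [Ua]; omega
  have hdpos : 0 < Ud u := by simp only [Ud]; omega
  have hdpos' : 0 < Ud u' := by simp only [Ud]; omega
  have hb : 0 ≤ Ub u ∧ Ub u < Ud u := by simp only [Ub, Ud]; have := u.2.2.2; omega
  have hb' : 0 ≤ Ub u' ∧ Ub u' < Ud u' := by simp only [Ub, Ud]; have := u'.2.2.2; omega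
  generalize hA : Ua u = a at *
  generalize hA' : Ua u' = a' at *
  generalize hD : Ud u = d at *
  generalize hD' : Ud u' = d' at *
  generalize hB : Ub u = b at *
  generalize hB' : Ub u' = b' at *
  generalize hx : g.1 0 0 = x at *
  generalize hy : g.1 0 1 = y at *
  generalize hz : g.1 1 0 = v at *
  generalize hw : g.1 1 1 = w at *
  generalize hx' : g'.1 0 0 = x' at *
  generalize hy' : g'.1 0 1 = y' at *
  generalize hz' : g'.1 1 0 = v' at *
  generalize hw' : g'.1 1 1 = w' at *
  -- a = a' by gcd
  have e1 : a * (x * w' - v * y') = a' := by linear_combination a' * hd' + w' * h1 - y' * h3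
  have e2 : a' * (x' * w - v' * y) = a := by linear_combination a * hd - w * h1 + y * h3
  have haa : a = a' := by
    apply le_antisymm
    · exact Int.le_of_dvd hapos' ⟨_, e1.symm⟩
    · exact Int.le_of_dvd hapos ⟨_, e2.symm⟩
  subst haa
  have exx : x = x' := mul_right_cancel₀ hapos.ne' h1
  have evv : v = v' := mul_right_cancel₀ hapos.ne' h3
  subst exx evv
  have edd : d = d' := by linear_combination x * h4 - v * h2 - d * hd + d' * hd'
  subst edd
  -- b' - b = d * (...)
  have e5 : b - b' = d * (y' * w - w' * y) := by
    linear_combination  w * h2 - y * h4 - b * hd + b' * hd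
  have e6 : y' * w - w' * y = 0 := by
    by_contra hne
    rcases lt_or_gt_of_ne hne with h | h
    · nlinarith
    · nlinarith
  rw [e6, mul_zero] at e5
  have ebb : b = b' := by linarith
  subst ebb
  have eyy : y = y' := mul_right_cancel₀ hdpos.ne' (by linarith)
  have eww : w = w' := mul_right_cancel₀ hdpos.ne' (by linarith)
  subst eyy eww
  have hu : u = u' := UU_ext (by rw [hA, hA']) (by rw [hD, hD']) (by rw [hB, hB'])
  have hg : g = g' := by
    apply Subtype.ext
    ext i j
    fin_cases i <;> fin_cases j
    · exact hx.trans hx'.symm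
    · exact hy.trans hy'.symm
    · exact hz.trans hz'.symm
    · exact hw.trans hw'.symm
  rw [hu, hg]

lemma eDP_surj {y : (ℤ × ℤ) × (ℤ × ℤ)} (hy : y ∈ DP) : ∃ x, eDP x = y := by
  obtain ⟨⟨p, q⟩, ⟨r, s⟩⟩ := y
  obtain ⟨h1, h2, h3, h4⟩ := hy
  simp only [dt] at h1 h2 h3 h4
  obtain ⟨a, ha⟩ : ∃ a : ℤ, a = (Int.gcd p r : ℤ) := ⟨_, rfl⟩
  have haodd : Odd (Int.gcd p r) := gcd_odd_left (p := (p, r)) h1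
  obtain ⟨n, hn⟩ := haodd
  have han : a = 2 * n + 1 := by rw [ha, hn]; push_cast; ring
  obtain ⟨x, hx⟩ : a ∣ p := ha ▸ Int.gcd_dvd_left _ _
  obtain ⟨v, hv⟩ : a ∣ r := ha ▸ Int.gcd_dvd_right _ _
  have hbz := Int.gcd_eq_gcd_ab p r
  rw [← ha] at hbz
  set α := Int.gcdA p r
  set β := Int.gcdB p r
  have hane : a ≠ 0 := by omega
  have hdet1 : x * α + v * β = 1 := by
    apply mul_left_cancel₀ hane
    rw [hx, hv] at hbz
    linear_combination -hbz
  -- d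
  set d : ℤ := x * s - v * q with hd
  have hdet2 : a * d = p * s - q * r := by rw [hd, hx, hv]; ring
  have hdpos : 0 < d := by
    have : 0 < a * d := by rw [hdet2]; exact h4
    have ha0 : 0 < a := by omega
    exact (mul_pos_iff_of_pos_left ha0).mp this
  have hdodd : Odd d := by
    have : Odd (a * d) := by rw [hdet2]; exact (h1.mul h3).sub_even (h2.mul_left _)
    exact (Int.odd_mul.mp this).2
  obtain ⟨m0, hm0⟩ := hdodd
  obtain ⟨m, rfl⟩ : ∃ m : ℕ, m0 = m := ⟨m0.toNat, by omega⟩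
  set b0 : ℤ := α * q + β * s with hb0
  set t := b0 / d with ht
  set b := b0 % d with hb
  have hbt : b0 = b + d * t := (Int.emod_add_mul_ediv b0 d).symm
  have hbnn : 0 ≤ b := Int.emod_nonneg _ hdpos.ne'
  have hblt : b < d := Int.emod_lt_of_pos _ hdpos
  have hveven : Even v := by
    have : Even (a * v) := by rw [← hv]; exact h2
    rcases Int.even_mul.mp this with h | h
    · exfalso
      rw [han] at h
      exact absurd h (by simp)
    · exact h
  let g : SL(2, ℤ) := ⟨!![x, -β + x * t; v, α + v * t], by rw [Matrix.det_fin_two_of]; linear_combination hdet1⟩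
  have hg : g ∈ Gamma0 2 := Gamma0_mem.mpr (cast_even.mpr hveven)
  refine ⟨(⟨g, hg⟩, (n, ⟨m, ⟨b.toNat, by omega⟩⟩)), ?_⟩
  have hbc : ((b.toNat : ℕ) : ℤ) = b := Int.toNat_of_nonneg hbnn
  have g00 : g 0 0 = x := rfl
  have g01 : g 0 1 = -β + x * t := rfl
  have g10 : g 1 0 = v := rfl
  have g11 : g 1 1 = α + v * t := rfl
  simp only [eDP, Ua, Ub, Ud, hbc, g00, g01, g10, g11]
  rw [← han, ← hm0]
  have hq : x * b + (-β + x * t) * d = q := by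
    linear_combination x * (hb0 - hbt) - β * hd + q * hdet1
  have hs : v * b + (α + v * t) * d = s := by
    linear_combination v * (hb0 - hbt) + α * hd + s * hdet1
  rw [hq, hs, hx, hv, mul_comm x, mul_comm v]

end EPB

namespace EPB
open UpperHalfPlane ModularForm CongruenceSubgroup Matrix.SpecialLinearGroup Filter Topology
open scoped MatrixGroups Manifold

lemma Ua_pos (u : UU) : (0 : ℝ) < Ua u := by
  have : 0 < Ua u := by simp only [Ua]; omega
  exact_mod_cast this
lemma Ud_pos (u : UU) : (0 : ℝ) < Ud u := by
  have : 0 < Ud u := by simp only [Ud]; omega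
  exact_mod_cast this

/-- action of upper triangular matrices -/
def Uz (u : UU) (z : ℍ) : ℍ := ⟨((Ua u : ℝ) / (Ud u : ℝ) : ℝ) * (z : ℂ) + (((Ub u : ℝ) / (Ud u : ℝ) : ℝ) : ℂ), by
  rw [Complex.add_im, Complex.im_ofReal_mul, Complex.ofReal_im, add_zero]
  exact mul_pos (div_pos (Ua_pos u) (Ud_pos u)) z.im_pos⟩

lemma Uz_im (u : UU) (z : ℍ) : (Uz u z).im = (Ua u : ℝ) / (Ud u : ℝ) * z.im := by
  change (((Ua u : ℝ) / (Ud u : ℝ) : ℝ) * (z : ℂ) + (((Ub u : ℝ) / (Ud u : ℝ) : ℝ) : ℂ)).im = _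
  rw [Complex.add_im, Complex.im_ofReal_mul, Complex.ofReal_im, add_zero]
  rfl

lemma Uz_coe (u : UU) (z : ℍ) : (Uz u z : ℂ) = (Ua u * z + Ub u) / Ud u := by
  change (((Ua u : ℝ) / (Ud u : ℝ) : ℝ) * (z : ℂ) + (((Ub u : ℝ) / (Ud u : ℝ) : ℝ) : ℂ)) = _
  push_cast
  ring

/-- Cohen kernel -/
def RK (k l : ℕ) : ℍ → ℂ := Poin ((k + l : ℕ) : ℤ) (fun τ => (τ : ℂ) ^ (-(k : ℤ)))

lemma RK_term (k l : ℕ) (g : SL(2, ℤ)) (z : ℍ) :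
    ((fun τ : ℍ => (τ : ℂ) ^ (-(k : ℤ))) ∣[((k + l : ℕ) : ℤ)] g) z = lf (g 0) z ^ (-(k : ℤ)) * lf (g 1) z ^ (-(l : ℤ)) := by
  rw [SL_slash_apply, smul_eq_lf, denom_eq_lf]
  have h0 := lf_ne (row_ne g 0) z
  have h1 := lf_ne (row_ne g 1) z
  simp only [zpow_neg, zpow_natCast, Nat.cast_add]
  rw [div_pow, zpow_add₀ h1]
  simp only [zpow_natCast]
  field_simp

lemma neumann_term (k l : ℕ) (g : Gamma0 2) (u : UU) (z : ℍ) :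
    tt k l z (eDP (g, u)) = ((Ud u : ℂ) ^ (k + l))⁻¹ * 
      ((fun τ : ℍ => (τ : ℂ) ^ (-(k : ℤ))) ∣[((k + l : ℕ) : ℤ)] g.1) (Uz u z) := by
  rw [RK_term]
  have hd : (Ud u : ℂ) ≠ 0 := by exact_mod_cast (Ud_pos u).ne'
  have key : ∀ i, lf (g.1 i) (Uz u z) = (((g.1 i 0 * Ua u : ℤ) : ℂ) * z + ((g.1 i 0 * Ub u + g.1 i 1 * Ud u : ℤ) : ℂ)) / Ud u := by
    intro i
    rw [lf, Uz_coe]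
    push_cast
    field_simp
    ring
  rw [key 0, key 1]
  simp only [tt, tm, eDP]
  rw [div_zpow, div_zpow]
  simp only [zpow_neg, zpow_natCast, pow_add]
  field_simp

lemma neumann {k l : ℕ} (hk : 3 ≤ k) (hl : 3 ≤ l) (hke : Even k) (z : ℍ) :
    HasSum (fun u : UU => ((Ud u : ℂ) ^ (k + l))⁻¹ * RK k l (Uz u z))
      (2 * lam k * lam l * (Ezero k z * Einf l z)) := by
  rw [prod_eq_DP hk hl hke]
  let e : UU × Gamma0 2 → DP := fun x => ⟨eDP (x.2, x.1), eDP_mem _⟩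
  have he : Function.Bijective e := by
    constructor
    · rintro ⟨u, g⟩ ⟨u', g'⟩ h
      have := eDP_inj (Subtype.ext_iff.mp h)
      simp only [Prod.mk.injEq] at this
      rw [this.1, this.2]
    · rintro ⟨y, hy⟩
      obtain ⟨⟨g, u⟩, hx⟩ := eDP_surj hy
      exact ⟨(u, g), Subtype.ext hx⟩
  have hs : Summable (fun x : DP => tt k l z x.1) := (tt_summable hk hl z).subtype _
  have h1 := ((Equiv.ofBijective e he).hasSum_iff.mpr hs.hasSum)
  refine h1.prod_fiberwise fun u => ?_
  simp only [Function.comp_apply, Equiv.ofBijective_apply, e]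
  simp_rw [neumann_term k l]
  apply HasSum.mul_left
  have h2 := (poin_summable (k := k) (l := l) (C := 1) (φ := fun τ : ℍ => (τ : ℂ) ^ (-(k : ℤ))) hk hl
    (fun τ => by rw [norm_zpow, one_mul]) (Uz u z)).of_norm
  exact (h2.comp_injective (i := fun g : Gamma0 2 => g.1) Subtype.val_injective).hasSum

lemma RK_cusp {k l : ℕ} (hk : 3 ≤ k) (hl : 3 ≤ l) :
    ∃ F : CuspForm (Gamma0 2) ((k + l : ℕ) : ℤ), ⇑F = RK k l := by
  refine Poin_cusp (C := 1) hk hl ?_ (fun τ => by rw [norm_zpow, one_mul])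
  rw [mdifferentiable_iff]
  have : DifferentiableOn ℂ (fun z : ℂ => z ^ (-(k : ℤ))) upperHalfPlaneSet := by
    intro z hz
    refine (DifferentiableAt.zpow differentiableAt_id (Or.inl ?_)).differentiableWithinAt
    rintro rfl
    simp at hz
  refine this.congr fun z hz => ?_
  simp only [Function.comp_apply]
  rw [ofComplex_apply_of_im_pos hz]

lemma lam_le {k : ℕ} (hk : 3 ≤ k) : lam k ≤ 13 / 12 := by
  unfold lam
  rw [(lam_summable (by omega)).tsum_eq_zero_add]
  have h : ∑' n : ℕ, ((2 * ((n + 1 : ℕ) : ℝ) + 1) ^ k)⁻¹ ≤ 1 / 12 := by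
    apply Real.tsum_le_of_sum_range_le (fun n => by positivity)
    intro N
    have : ∑ i ∈ Finset.range N, ((2 * ((i + 1 : ℕ) : ℝ) + 1) ^ k)⁻¹ ≤ 1 / 12 * (1 - 1 / (N + 1)) := by
      induction N with
      | zero => simp
      | succ N ih =>
        rw [Finset.sum_range_succ]
        have h3 : ((2 * ((N + 1 : ℕ) : ℝ) + 1) ^ k)⁻¹ ≤ 1 / 12 * (1 / (N + 1) - 1 / (N + 2)) := by
          have h4 : (1 : ℝ) / 12 * (1 / (N + 1) - 1 / (N + 2)) = (12 * (N + 1) * (N + 2) : ℝ)⁻¹ := by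
            field_simp; ring
          rw [h4]
          apply inv_anti₀ (by positivity)
          have h5 : (2 * ((N + 1 : ℕ) : ℝ) + 1) ^ 3 ≤ (2 * ((N + 1 : ℕ) : ℝ) + 1) ^ k :=
            pow_le_pow_right₀ (by push_cast; linarith [(Nat.cast_nonneg N : (0 : ℝ) ≤ N)]) hk
          refine le_trans ?_ h5
          push_cast
          have := (Nat.cast_nonneg N : (0 : ℝ) ≤ N)
          nlinarith [pow_nonneg this 2, pow_nonneg this 3]
        push_cast at *
        have h7 : (N : ℝ) + 1 + 1 = N + 2 := by ring
        rw [h7]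
        linarith
    refine this.trans ?_
    have : (0 : ℝ) ≤ 1 / (N + 1) := by positivity
    linarith
  simp only [Nat.cast_zero, mul_zero, zero_add, one_pow, inv_one]
  linarith

def wt (M : ℕ) (u : UU) : ℝ := ((Ua u : ℝ) ^ M)⁻¹ * ((Ud u : ℝ) ^ M)⁻¹

lemma wt_sum {M : ℕ} (hM : 4 ≤ M) : HasSum (wt M) (lam M * lam (M - 1)) := by
  have h1 := (lam_summable (k := M) (by omega)).hasSum
  have h2 : HasSum (fun s : Σ m : ℕ, Fin (2 * m + 1) => ((2 * s.1 + 1 : ℝ) ^ M)⁻¹) (lam (M - 1)) := by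
    have hin : ∀ m : ℕ, HasSum (fun _ : Fin (2 * m + 1) => ((2 * m + 1 : ℝ) ^ M)⁻¹) (((2 * m + 1 : ℝ) ^ (M - 1))⁻¹) := by
      intro m
      have := hasSum_fintype (fun _ : Fin (2 * m + 1) => ((2 * m + 1 : ℝ) ^ M)⁻¹)
      convert this using 1
      simp only [Finset.sum_const, Finset.card_univ, Fintype.card_fin, nsmul_eq_mul]
      obtain ⟨N, rfl⟩ : ∃ N, M = N + 1 := ⟨M - 1, by omega⟩
      simp only [Nat.add_sub_cancel, pow_succ]
      push_cast
      field_simp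
    refine HasSum.sigma_of_hasSum (lam_summable (k := M - 1) (by omega)).hasSum hin ?_
    rw [summable_sigma_of_nonneg (fun x => by positivity)]
    refine ⟨fun m => (hin m).summable, ?_⟩
    refine (lam_summable (k := M - 1) (by omega)).congr fun m => ?_
    exact ((hin m).tsum_eq).symm
  have h3 := h1.mul h2 (h1.summable.mul_of_nonneg h2.summable (fun n => by positivity) (fun n => by positivity))
  have h4 : wt M = fun x : UU => ((2 * x.1 + 1 : ℝ) ^ M)⁻¹ * ((2 * x.2.1 + 1 : ℝ) ^ M)⁻¹ := by
    ext u
    simp [wt, Ua, Ud]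
  rw [h4]
  exact h3

lemma neumann_zero {M : ℕ} (hM : 4 ≤ M) (H : CuspForm (Gamma0 2) ((2 * M : ℕ) : ℤ))
    (h : ∀ z : ℍ, HasSum (fun u : UU => ((Ud u : ℂ) ^ (2 * M))⁻¹ * H (Uz u z)) 0) (z : ℍ) : H z = 0 := by
  obtain ⟨C, hC⟩ := CuspFormClass.exists_bound H
  have hC' : ∀ τ : ℍ, ‖H τ‖ ≤ C / τ.im ^ M := by
    intro τ
    refine (hC τ).trans_eq ?_
    congr 1
    rw [← Real.rpow_natCast]
    congr 1
    push_cast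
    ring
  set q : ℝ := lam M * lam (M - 1) - 1 with hq
  have hw := wt_sum hM
  let u0 : UU := (0, ⟨0, 0⟩)
  have hwu0 : wt M u0 = 1 := by simp [wt, u0, Ua, Ud]
  have hwpos : ∀ u, 0 ≤ wt M u := fun u => by
    have := Ua_pos u; have := Ud_pos u
    unfold wt; positivity
  have hwq : HasSum (fun u => if u = u0 then 0 else wt M u) q := by
    have := hw.sub (hasSum_ite_eq u0 (1 : ℝ))
    have h8 : (fun u => if u = u0 then 0 else wt M u) = fun u => wt M u - if u = u0 then 1 else 0 := by
      ext u
      split_ifs with h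
      · rw [h, hwu0, sub_self]
      · rw [sub_zero]
    rw [h8]
    exact this
  have hq0 : 0 ≤ q := hwq.nonneg (fun u => by split_ifs <;> simp [hwpos])
  have hq1 : q < 1 := by
    have h1 := lam_le (k := M) (by omega)
    have h2 := lam_le (k := M - 1) (by omega)
    have h3 := lam_pos (k := M) (by omega)
    have h4 := lam_pos (k := M - 1) (by omega)
    rw [hq]
    nlinarith
  have hu0 : ∀ τ, Uz u0 τ = τ := by
    intro τ
    apply UpperHalfPlane.ext
    rw [Uz_coe]
    simp [u0, Ua, Ud, Ub]
  have step : ∀ B : ℝ, (∀ τ : ℍ, ‖H τ‖ ≤ B / τ.im ^ M) → ∀ τ : ℍ, ‖H τ‖ ≤ (B * q) / τ.im ^ M := by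
    intro B hB τ
    have hτ := τ.im_pos
    have hterm : ∀ u, ‖((Ud u : ℂ) ^ (2 * M))⁻¹ * H (Uz u τ)‖ ≤ B / τ.im ^ M * wt M u := by
      intro u
      have h1 := hB (Uz u τ)
      rw [Uz_im] at h1
      have ha := Ua_pos u
      have hd := Ud_pos u
      rw [norm_mul, norm_inv, norm_pow, Complex.norm_intCast, abs_of_pos hd]
      calc _ ≤ (((Ud u : ℝ)) ^ (2 * M))⁻¹ * (B / ((Ua u : ℝ) / (Ud u) * τ.im) ^ M) := by gcongr
        _ = _ := by
          unfold wt
          rw [mul_pow, div_pow, two_mul, pow_add]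
          field_simp
    have hs := h τ
    have h2 := hs.summable.tsum_eq_add_tsum_ite u0
    rw [hs.tsum_eq] at h2
    have h3 : ((Ud u0 : ℂ) ^ (2 * M))⁻¹ * H (Uz u0 τ) = H τ := by
      rw [hu0]; simp [u0, Ud]
    rw [h3] at h2
    have h4 : H τ = - ∑' u, if u = u0 then 0 else ((Ud u : ℂ) ^ (2 * M))⁻¹ * H (Uz u τ) := by
      linear_combination -h2
    rw [h4, norm_neg]
    have h5 := hwq.mul_left (B / τ.im ^ M)
    have h6 := tsum_of_norm_bounded (f := fun u => if u = u0 then 0 else ((Ud u : ℂ) ^ (2 * M))⁻¹ * H (Uz u τ)) h5 (fun u => by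
      split_ifs
      · simp
      · exact hterm u)
    refine h6.trans_eq ?_
    ring
  have iter : ∀ n : ℕ, ∀ τ : ℍ, ‖H τ‖ ≤ (C * q ^ n) / τ.im ^ M := by
    intro n
    induction n with
    | zero => simpa using hC'
    | succ n ih =>
      have := step _ ih
      intro τ
      refine (this τ).trans_eq ?_
      rw [pow_succ]; ring
  have hlim : Tendsto (fun n : ℕ => (C * q ^ n) / z.im ^ M) atTop (𝓝 ((C * 0) / z.im ^ M)) :=
    ((tendsto_pow_atTop_nhds_zero_of_lt_one hq0 hq1).const_mul C).div_const _
  have := ge_of_tendsto' hlim (fun n => iter n z)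
  simpa using this

end EPB

namespace EPB
open UpperHalfPlane ModularForm CongruenceSubgroup Matrix.SpecialLinearGroup Filter Topology
open scoped MatrixGroups Manifold ComplexConjugate

/-! ### Reproducing formula -/

def rho (w : ℍ) : ℝ := w.im / ‖(w : ℂ) + Complex.I‖ ^ 2

def cay (w : ℍ) : ℂ := ((w : ℂ) - Complex.I) / ((w : ℂ) + Complex.I)

lemma wI_ne (w : ℍ) : (w : ℂ) + Complex.I ≠ 0 := by
  intro h
  have := congrArg Complex.im h
  have h2 := w.im_pos
  simp only [Complex.add_im, Complex.I_im, Complex.zero_im, coe_im] at this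
  linarith

lemma rho_pos (w : ℍ) : 0 < rho w := by
  have := norm_pos_iff.mpr (wI_ne w)
  have := w.im_pos
  unfold rho; positivity

lemma rho_eq (w : ℍ) : rho w = w.im / (w.re ^ 2 + (w.im + 1) ^ 2) := by
  unfold rho
  rw [← Complex.normSq_eq_norm_sq, Complex.normSq_apply]
  congr 1
  simp
  ring

lemma cay_norm (w : ℍ) : 1 - ‖cay w‖ ^ 2 = 4 * rho w := by
  have h := norm_pos_iff.mpr (wI_ne w)
  unfold cay rho
  rw [norm_div, div_pow]
  rw [eq_comm, ← sub_eq_zero]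
  field_simp
  simp only [← Complex.normSq_eq_norm_sq, Complex.normSq_apply]
  simp
  ring

lemma cay_lt (w : ℍ) : ‖cay w‖ < 1 := by
  have h1 := cay_norm w
  have h2 := rho_pos w
  have h3 := norm_nonneg (cay w)
  nlinarith

lemma continuous_rho : Continuous rho := by
  unfold rho
  refine Continuous.div UpperHalfPlane.continuous_im ?_ ?_
  · exact ((UpperHalfPlane.continuous_coe.add continuous_const).norm.pow 2)
  · intro w
    have := norm_pos_iff.mpr (wI_ne w)
    positivity

lemma continuous_cay : Continuous cay := by
  unfold cay
  exact (UpperHalfPlane.continuous_coe.sub continuous_const).div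
    (UpperHalfPlane.continuous_coe.add continuous_const) wI_ne

lemma rho_integrable {M : ℕ} (hM : 4 ≤ M) : Integrable (fun w : ℍ => rho w ^ M) := by
  rw [volume_def]
  have hmeas : Measurable (fun z : ℍ => (1 / NNReal.mk z.im z.im_pos.le) ^ 2) := by
    refine Measurable.pow_const (Measurable.div measurable_const ?_) 2
    exact (UpperHalfPlane.continuous_im.measurable).subtype_mk
  rw [integrable_withDensity_iff_integrable_smul hmeas]
  have h1 : Integrable (fun p : ℝ × ℝ => (1 + p.1 ^ 2)⁻¹ * (1 + p.2 ^ 2)⁻¹) :=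
    integrable_inv_one_add_sq.mul_prod integrable_inv_one_add_sq
  have h2 : Integrable (fun z : ℂ => (1 + z.re ^ 2)⁻¹ * (1 + z.im ^ 2)⁻¹) := by
    have := (Complex.volume_preserving_equiv_real_prod.integrable_comp_emb
      (MeasurableEquiv.measurableEmbedding _)).mpr h1
    exact this
  have h3 : Integrable (fun w : ℍ => (1 + w.re ^ 2)⁻¹ * (1 + w.im ^ 2)⁻¹) (volume.comap UpperHalfPlane.coe) := by
    have := (measurableEmbedding_coe.integrable_map_iff (μ := volume.comap UpperHalfPlane.coe)
      (g := fun z : ℂ => (1 + z.re ^ 2)⁻¹ * (1 + z.im ^ 2)⁻¹)).mp (by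
        rw [measurableEmbedding_coe.map_comap]
        exact h2.integrableOn)
    exact this
  refine h3.mono' ?_ (Filter.Eventually.of_forall fun w => ?_)
  · exact ((hmeas.smul (continuous_rho.pow M).measurable)).aestronglyMeasurable
  · have hy := w.im_pos
    have hr := rho_pos w
    have e : ‖(1 / NNReal.mk w.im w.im_pos.le) ^ 2 • rho w ^ M‖ = (w.im ^ 2)⁻¹ * rho w ^ M := by
      rw [NNReal.smul_def]
      rw [smul_eq_mul, Real.norm_of_nonneg (by positivity)]
      push_cast
      simp
    rw [e, rho_eq]
    obtain ⟨N, rfl⟩ : ∃ N, M = N + 4 := ⟨M - 4, by omega⟩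
    set x := w.re
    set y := w.im
    have hD : 0 < x ^ 2 + (y + 1) ^ 2 := by positivity
    have hle1 : y / (x ^ 2 + (y + 1) ^ 2) ≤ 1 := by
      rw [div_le_one hD]; nlinarith [sq_nonneg x]
    have hnn : 0 ≤ y / (x ^ 2 + (y + 1) ^ 2) := by positivity
    rw [pow_add]
    calc (y ^ 2)⁻¹ * ((y / (x ^ 2 + (y + 1) ^ 2)) ^ N * (y / (x ^ 2 + (y + 1) ^ 2)) ^ 4) 
        ≤ (y ^ 2)⁻¹ * (1 * (y / (x ^ 2 + (y + 1) ^ 2)) ^ 4) := by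
          gcongr
          exact pow_le_one₀ hnn hle1
      _ = (y / (x ^ 2 + (y + 1) ^ 2)) ^ 2 * ((x ^ 2 + (y + 1) ^ 2)⁻¹ * (x ^ 2 + (y + 1) ^ 2)⁻¹) := by
          field_simp
      _ ≤ 1 * ((1 + x ^ 2)⁻¹ * (1 + y ^ 2)⁻¹) := by
          have a1 : (x ^ 2 + (y + 1) ^ 2)⁻¹ ≤ (1 + x ^ 2)⁻¹ := inv_anti₀ (by positivity) (by nlinarith)
          have a2 : (x ^ 2 + (y + 1) ^ 2)⁻¹ ≤ (1 + y ^ 2)⁻¹ :=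
            inv_anti₀ (by positivity) (by nlinarith [sq_nonneg x])
          exact mul_le_mul (pow_le_one₀ hnn hle1)
            (mul_le_mul a1 a2 (by positivity) (by positivity)) (by positivity) (by positivity)
      _ = _ := by rw [one_mul]

lemma vol_ne_zero : (volume : Measure ℍ) ≠ 0 := by
  intro h
  have hmeas : Measurable (fun z : ℍ => (1 / NNReal.mk z.im z.im_pos.le) ^ 2) := by
    refine Measurable.pow_const (Measurable.div measurable_const ?_) 2
    exact (UpperHalfPlane.continuous_im.measurable).subtype_mk
  rw [volume_def, withDensity_eq_zero_iff (hmeas.coe_nnreal_ennreal.aemeasurable)] at h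
  have h2 : (volume.comap UpperHalfPlane.coe) (Set.univ : Set ℍ) = 0 := by
    rw [Filter.EventuallyEq, ae_iff] at h
    convert h using 2
    symm
    rw [Set.eq_univ_iff_forall]
    intro z
    have := z.im_pos
    simp only [Set.mem_ofPred_eq, Pi.zero_apply]
    intro h3
    have h4 : (1 / NNReal.mk z.im z.im_pos.le) ^ 2 = 0 := by exact_mod_cast h3
    have h5 : NNReal.mk z.im z.im_pos.le ≠ 0 := fun h => this.ne' (congrArg NNReal.toReal h)
    exact pow_ne_zero 2 (one_div_ne_zero h5) h4
  rw [measurableEmbedding_coe.comap_apply, Set.image_univ] at h2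
  have h3 := isOpenEmbedding_coe.isOpen_range.measure_pos volume ⟨_, UpperHalfPlane.I, rfl⟩
  exact h3.ne' h2

def kap (M : ℕ) : ℝ := ∫ w : ℍ, rho w ^ M

lemma kap_pos {M : ℕ} (hM : 4 ≤ M) : 0 < kap M := by
  unfold kap
  rw [integral_pos_iff_support_of_nonneg (fun w => by have := rho_pos w; positivity) (rho_integrable hM)]
  have : Function.support (fun w : ℍ => rho w ^ M) = Set.univ := by
    rw [Set.eq_univ_iff_forall]
    intro w
    exact (pow_pos (rho_pos w) M).ne'
  rw [this]
  exact (Measure.measure_univ_pos).mpr vol_ne_zero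

/-- rotations -/
def rot (θ : ℝ) : SL(2, ℝ) := ⟨!![Real.cos (θ / 2), Real.sin (θ / 2); -Real.sin (θ / 2), Real.cos (θ / 2)], by
  rw [Matrix.det_fin_two_of]
  nlinarith [Real.sin_sq_add_cos_sq (θ / 2)]⟩

lemma cay_rot (θ : ℝ) (w : ℍ) : cay (rot θ • w) = Complex.exp (θ * Complex.I) * cay w := by
  have h1 := UpperHalfPlane.coe_specialLinearGroup_apply (rot θ) w
  have e : Complex.exp (θ * Complex.I) = (Real.cos (θ / 2) + Real.sin (θ / 2) * Complex.I) ^ 2 := by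
    push_cast
    rw [← Complex.exp_mul_I, ← Complex.exp_nat_mul]
    congr 1
    push_cast
    ring
  have hcs : (Real.cos (θ / 2) : ℂ) ^ 2 + (Real.sin (θ / 2) : ℂ) ^ 2 = 1 := by
    exact_mod_cast Real.cos_sq_add_sin_sq (θ / 2)
  have hd2 : (-(Real.sin (θ / 2) : ℂ)) * w + Real.cos (θ / 2) ≠ 0 := by
    intro h
    have him := congrArg Complex.im h
    have hre := congrArg Complex.re h
    have hw := w.im_pos
    simp only [Complex.add_im, Complex.mul_im, Complex.neg_re, Complex.neg_im, Complex.ofReal_re,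
      Complex.ofReal_im, Complex.zero_im, neg_zero, zero_mul, add_zero, coe_im] at him
    have hs : Real.sin (θ / 2) = 0 := by
      rcases mul_eq_zero.mp him with h | h
      · linarith
      · exact absurd h hw.ne'
    rw [hs] at hre
    have hc : Real.cos (θ / 2) = 0 := by simpa [Complex.ofReal_re, ← Complex.ofReal_cos, -Complex.ofReal_cos] using hre
    have := Real.cos_sq_add_sin_sq (θ / 2)
    rw [hs, hc] at this
    norm_num at this
  have h2 : ((rot θ • w : ℍ) : ℂ) = (Real.cos (θ / 2) * w + Real.sin (θ / 2)) / (-(Real.sin (θ / 2) : ℂ) * w + Real.cos (θ / 2)) := by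
    rw [h1]
    simp [rot]
  have h3 := wI_ne (rot θ • w)
  have h4 := wI_ne w
  unfold cay
  rw [e, mul_div_assoc', div_eq_div_iff h3 h4, h2]
  generalize (Real.cos (θ / 2) : ℂ) = c at *
  generalize (Real.sin (θ / 2) : ℂ) = s at *
  have hI := Complex.I_sq
  generalize Complex.I = i at *
  have e1 : ((c * w + s) - (-s * w + c) * i) = (c + s * i) * (w - i) := by
    linear_combination s * hI
  have e2 : ((c * w + s) + (-s * w + c) * i) = (c - s * i) * (w + i) := by
    linear_combination s * hI
  have e3 : (c + s * i) * (c - s * i) = 1 := by linear_combination hcs - s ^ 2 * hI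
  have f1 : (c * w + s) / (-s * w + c) - i = (c + s * i) * (w - i) / (-s * w + c) := by
    rw [← e1, sub_div, mul_div_cancel_left₀ _ hd2]
  have f2 : (c * w + s) / (-s * w + c) + i = (c - s * i) * (w + i) / (-s * w + c) := by
    rw [← e2, add_div (c * (w : ℂ) + s), mul_div_cancel_left₀ _ hd2]
  rw [f1, f2]
  simp only [div_eq_mul_inv]
  linear_combination  - (c + s * i) * (w - i) * (w + i) * (-s * w + c)⁻¹ * e3

lemma rho_rot (θ : ℝ) (w : ℍ) : rho (rot θ • w) = rho w := by
  have h1 := cay_norm (rot θ • w)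
  have h2 := cay_norm w
  rw [cay_rot, norm_mul, Complex.norm_exp_ofReal_mul_I, one_mul, h2] at h1
  linarith

lemma mp_SL (g : SL(2, ℝ)) : MeasurePreserving (fun w : ℍ => g • w) :=
  measurePreserving_smul (g : GL (Fin 2) ℝ) (volume : Measure ℍ)

end EPB

namespace EPB
open UpperHalfPlane ModularForm CongruenceSubgroup Matrix.SpecialLinearGroup Filter Topology
open scoped MatrixGroups Manifold ComplexConjugate

lemma circ_mean (F : ℂ → ℂ) (hF : DifferentiableOn ℂ F (Metric.ball 0 1)) (t : ℂ) (ht : ‖t‖ < 1) :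
    ∫ θ in (0:ℝ)..(2 * Real.pi), F (Complex.exp (θ * Complex.I) * t) = 2 * Real.pi * F 0 := by
  have hd : DiffContOnCl ℂ F (Metric.ball 0 |‖t‖|) := by
    refine DifferentiableOn.diffContOnCl (hF.mono ?_)
    refine Metric.closure_ball_subset_closedBall.trans ?_
    rw [abs_norm]
    exact Metric.closedBall_subset_ball ht
  have h := hd.circleAverage
  rw [Real.circleAverage_eq_integral_add (Complex.arg t)] at h
  have e : ∀ θ : ℝ, circleMap 0 ‖t‖ (θ + Complex.arg t) = Complex.exp (θ * Complex.I) * t := by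
    intro θ
    conv_rhs => rw [← Complex.norm_mul_exp_arg_mul_I t]
    simp only [circleMap]
    push_cast
    rw [add_mul, Complex.exp_add]
    ring
  simp only [e] at h
  rw [← h]
  have : (Real.pi : ℂ) ≠ 0 := by exact_mod_cast Real.pi_ne_zero
  rw [Complex.real_smul]
  push_cast
  rw [mul_inv_cancel_left₀ (by simp)]

lemma mean_disc {K M : ℕ} (hM : 4 ≤ M) (F : ℂ → ℂ) (hF : DifferentiableOn ℂ F (Metric.ball 0 1)) (C : ℝ)
    (hb : ∀ w : ℍ, ‖F (cay w)‖ * rho w ^ K ≤ C * rho w ^ M) :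
    Integrable (fun w : ℍ => F (cay w) * (rho w : ℂ) ^ K) ∧
    ∫ w : ℍ, F (cay w) * (rho w : ℂ) ^ K = F 0 * kap K := by
  have hrot : ∀ θ : ℝ, ∫ w : ℍ, F (Complex.exp (θ * Complex.I) * cay w) * (rho w : ℂ) ^ K =
      ∫ w : ℍ, F (cay w) * (rho w : ℂ) ^ K := by
    intro θ
    rw [← integral_smul_eq_self (μ := (volume : Measure ℍ)) (fun w : ℍ => F (cay w) * (rho w : ℂ) ^ K)
      (g := (rot θ : GL (Fin 2) ℝ))]
    refine integral_congr_ae (Eventually.of_forall fun w => ?_)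
    have e1 := cay_rot θ w
    have e2 := rho_rot θ w
    change cay ((rot θ : GL (Fin 2) ℝ) • w) = _ at e1
    change rho ((rot θ : GL (Fin 2) ℝ) • w) = _ at e2
    simp only [e1, e2]
  have hcont : Continuous (fun p : ℝ × ℍ => F (Complex.exp (p.1 * Complex.I) * cay p.2) * (rho p.2 : ℂ) ^ K) := by
    refine Continuous.mul ?_ ?_
    · refine hF.continuousOn.comp_continuous ?_ ?_
      · have := continuous_cay
        fun_prop
      · intro p
        rw [mem_ball_zero_iff, norm_mul, Complex.norm_exp_ofReal_mul_I, one_mul]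
        exact cay_lt _
    · have := continuous_rho
      fun_prop
  have hbd : ∀ p : ℝ × ℍ, ‖F (Complex.exp (p.1 * Complex.I) * cay p.2) * (rho p.2 : ℂ) ^ K‖ ≤ C * rho p.2 ^ M := by
    intro p
    have := hb (rot p.1 • p.2)
    rw [rho_rot, cay_rot] at this
    rw [norm_mul, norm_pow, Complex.norm_real, Real.norm_of_nonneg (rho_pos _).le]
    exact this
  have hInt : Integrable (fun p : ℝ × ℍ => F (Complex.exp (p.1 * Complex.I) * cay p.2) * (rho p.2 : ℂ) ^ K)
      ((volume.restrict (Set.Ioc 0 (2 * Real.pi))).prod volume) := by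
    refine Integrable.mono' (g := fun p => C * rho p.2 ^ M) ?_ ?_ (Eventually.of_forall hbd)
    · exact ((rho_integrable hM).const_mul C).comp_snd _
    · exact hcont.aestronglyMeasurable
  have h0 : Integrable (fun w : ℍ => F (cay w) * (rho w : ℂ) ^ K) := by
    refine Integrable.mono' ((rho_integrable hM).const_mul C) ?_ (Eventually.of_forall fun w => ?_)
    · have := hcont.comp (f := fun w : ℍ => ((0 : ℝ), w)) (by fun_prop)
      have e : (fun w : ℍ => F (cay w) * (rho w : ℂ) ^ K) =
        ((fun p : ℝ × ℍ => F (Complex.exp (p.1 * Complex.I) * cay p.2) * (rho p.2 : ℂ) ^ K) ∘ fun w : ℍ => ((0 : ℝ), w)) := by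
        funext w
        simp
      rw [e]
      exact this.aestronglyMeasurable
    · have := hbd (0, w)
      simpa using this
  refine ⟨h0, ?_⟩
  have hs := integral_integral_swap
    (f := fun (θ : ℝ) (w : ℍ) => F (Complex.exp (θ * Complex.I) * cay w) * (rho w : ℂ) ^ K) hInt
  simp only [hrot] at hs
  have h2pi : (0 : ℝ) ≤ 2 * Real.pi := by positivity
  have e : ∀ w : ℍ, ∫ θ in Set.Ioc 0 (2 * Real.pi), F (Complex.exp ((θ : ℝ) * Complex.I) * cay w) * (rho w : ℂ) ^ K =
     2 * Real.pi * F 0 * (rho w : ℂ) ^ K := by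
    intro w
    rw [integral_mul_const, ← intervalIntegral.integral_of_le h2pi, circ_mean F hF _ (cay_lt w)]
  simp only [e] at hs
  rw [integral_const_mul, integral_const] at hs
  have e3 : ∫ w : ℍ, (rho w : ℂ) ^ K = kap K := by
    unfold kap
    rw [← integral_complex_ofReal]
    push_cast
    rfl
  rw [e3] at hs
  simp only [measureReal_restrict_apply_univ, Real.volume_real_Ioc_of_le h2pi, sub_zero, Complex.real_smul] at hs
  have : (Real.pi : ℂ) ≠ 0 := by exact_mod_cast Real.pi_ne_zero
  push_cast at hs
  have h3 : (2 * (Real.pi : ℂ)) ≠ 0 := by simp [this]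
  apply mul_left_cancel₀ h3
  rw [hs]; ring


lemma rho_conj (w : ℍ) : (rho w : ℂ) = - ((w.im : ℂ) / (((w : ℂ) + Complex.I) * (Complex.I - conj (w : ℂ)))) := by
  unfold rho
  have : ((‖(w : ℂ) + Complex.I‖ ^ 2 : ℝ) : ℂ) = - (((w : ℂ) + Complex.I) * (Complex.I - conj (w : ℂ))) := by
    rw [← Complex.normSq_eq_norm_sq, ← Complex.mul_conj]
    simp only [map_add, Complex.conj_I]
    ring
  rw [Complex.ofReal_div, this, div_neg]

lemma repr_I {M : ℕ} (hM : 4 ≤ M) (G : ℍ → ℂ) (hG : MDiff G) (C : ℝ) (hC : ∀ τ : ℍ, ‖G τ‖ ≤ C / τ.im ^ M) :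
    Integrable (fun w : ℍ => G w * ((Complex.I - conj (w : ℂ)) ^ (2 * M))⁻¹ * (w.im : ℂ) ^ (2 * M)) ∧
    ∫ w : ℍ, G w * ((Complex.I - conj (w : ℂ)) ^ (2 * M))⁻¹ * (w.im : ℂ) ^ (2 * M) =
      G UpperHalfPlane.I * ((2 * Complex.I) ^ (2 * M) * kap (2 * M)) := by
  set F : ℂ → ℂ := fun t => G (ofComplex (Complex.I * (1 + t) / (1 - t))) * ((1 - t) ^ (2 * M))⁻¹ with hFdef
  have h1t : ∀ t ∈ Metric.ball (0 : ℂ) 1, 1 - t ≠ 0 := by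
    intro t ht h
    rw [mem_ball_zero_iff] at ht
    have : t = 1 := by linear_combination -h
    rw [this] at ht
    simp at ht
  have hF : DifferentiableOn ℂ F (Metric.ball 0 1) := by
    rw [mdifferentiable_iff] at hG
    refine DifferentiableOn.mul ?_ ?_
    · refine hG.comp (f := fun t : ℂ => Complex.I * (1 + t) / (1 - t)) ?_ ?_
      · refine DifferentiableOn.div (by fun_prop) (by fun_prop) h1t
      · intro t ht
        have hne := h1t t ht
        rw [mem_ball_zero_iff] at ht
        change 0 < (Complex.I * (1 + t) / (1 - t)).im
        have hn : 0 < Complex.normSq (1 - t) := Complex.normSq_pos.mpr hne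
        have ht2 : t.re ^ 2 + t.im ^ 2 < 1 := by
          have : Complex.normSq t < 1 := by
            rw [Complex.normSq_eq_norm_sq]; nlinarith [norm_nonneg t]
          rw [Complex.normSq_apply] at this
          nlinarith
        rw [Complex.div_im]
        rw [← sub_div]
        apply div_pos _ hn
        simp
        nlinarith
    · exact DifferentiableOn.inv (by fun_prop) (fun t ht => pow_ne_zero _ (h1t t ht))
  have hFc : ∀ w : ℍ, F (cay w) = G w * ((w : ℂ) + Complex.I) ^ (2 * M) / (2 * Complex.I) ^ (2 * M) := by
    intro w
    have hw := wI_ne w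
    have e1 : 1 - cay w = 2 * Complex.I / ((w : ℂ) + Complex.I) := by
      unfold cay
      rw [eq_div_iff hw, sub_mul, div_mul_cancel₀ _ hw]
      ring
    have e2 : 1 + cay w = 2 * w / ((w : ℂ) + Complex.I) := by
      unfold cay
      rw [eq_div_iff hw, add_mul, div_mul_cancel₀ _ hw]
      ring
    have e3 : Complex.I * (1 + cay w) / (1 - cay w) = w := by
      rw [e1, e2]
      have := Complex.I_ne_zero
      field_simp
    simp only [hFdef]
    rw [e3, ofComplex_apply, e1, div_pow, inv_div, mul_div_assoc]
  have hb : ∀ w : ℍ, ‖F (cay w)‖ * rho w ^ (2 * M) ≤ (C / 2 ^ (2 * M)) * rho w ^ M := by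
    intro w
    have hr := rho_pos w
    have hy := w.im_pos
    have hn := norm_pos_iff.mpr (wI_ne w)
    rw [hFc, norm_div, norm_mul, norm_pow, norm_pow, norm_mul, Complex.norm_I, mul_one]
    have e : rho w ^ (2 * M) = rho w ^ M * (w.im ^ M / ‖(w : ℂ) + Complex.I‖ ^ (2 * M)) := by
      rw [two_mul, pow_add]
      congr 1
      rw [← two_mul, pow_mul, ← div_pow]
      rfl
    rw [e]
    have h2 : ‖(2 : ℂ)‖ = 2 := by simp
    rw [h2]
    have := hC w
    rw [le_div_iff₀ (by positivity)] at this
    calc ‖G w‖ * ‖(w : ℂ) + Complex.I‖ ^ (2 * M) / 2 ^ (2 * M) * (rho w ^ M * (w.im ^ M / ‖(w : ℂ) + Complex.I‖ ^ (2 * M)))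
        = (‖G w‖ * w.im ^ M) / 2 ^ (2 * M) * rho w ^ M := by field_simp
      _ ≤ _ := by gcongr
  obtain ⟨i1, i2⟩ := mean_disc hM F hF _ hb
  have hI2 : (2 * Complex.I) ^ (2 * M) ≠ 0 := pow_ne_zero _ (by simp)
  have key : (fun w : ℍ => G w * ((Complex.I - conj (w : ℂ)) ^ (2 * M))⁻¹ * (w.im : ℂ) ^ (2 * M)) =
      fun w : ℍ => (2 * Complex.I) ^ (2 * M) * (F (cay w) * (rho w : ℂ) ^ (2 * M)) := by
    funext w
    rw [hFc, rho_conj, Even.neg_pow (even_two_mul M), div_pow, mul_pow ((w : ℂ) + Complex.I)]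
    have := pow_ne_zero (2 * M) (wI_ne w)
    rw [div_eq_mul_inv, div_eq_mul_inv, mul_inv]
    field_simp
  rw [key]
  refine ⟨i1.const_mul _, ?_⟩
  rw [integral_const_mul, i2]
  have : F 0 = G UpperHalfPlane.I := by
    simp only [hFdef]
    simp only [add_zero, sub_zero, mul_one, div_one, one_pow, inv_one]
    congr 1
    exact ofComplex_apply UpperHalfPlane.I
  rw [this]; ring

def aff (ζ : ℍ) : GL (Fin 2) ℝ := Matrix.GeneralLinearGroup.mkOfDetNeZero !![ζ.im, ζ.re; 0, 1] (by
  rw [Matrix.det_fin_two_of]; simpa using ζ.im_pos.ne')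

lemma aff_det (ζ : ℍ) : 0 < (aff ζ).det.val := by
  simp [aff, Matrix.GeneralLinearGroup.mkOfDetNeZero, ζ.im_pos]

lemma aff_smul (ζ w : ℍ) : ((aff ζ • w : ℍ) : ℂ) = ζ.im * w + ζ.re := by
  rw [coe_smul_of_det_pos (aff_det ζ)]
  simp [num, denom, aff, Matrix.GeneralLinearGroup.mkOfDetNeZero]

lemma aff_I (ζ : ℍ) : aff ζ • UpperHalfPlane.I = ζ := by
  ext
  rw [aff_smul]
  apply Complex.ext <;> simp

lemma repr_gen {M : ℕ} (hM : 4 ≤ M) (G : ℍ → ℂ) (hG : MDiff G) (C : ℝ) (hC : ∀ τ : ℍ, ‖G τ‖ ≤ C / τ.im ^ M) (ζ : ℍ) :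
    Integrable (fun w : ℍ => G w * (((ζ : ℂ) - conj (w : ℂ)) ^ (2 * M))⁻¹ * (w.im : ℂ) ^ (2 * M)) ∧
    ∫ w : ℍ, G w * (((ζ : ℂ) - conj (w : ℂ)) ^ (2 * M))⁻¹ * (w.im : ℂ) ^ (2 * M) =
      G ζ * ((2 * Complex.I) ^ (2 * M) * kap (2 * M)) := by
  have him : ∀ w : ℍ, (aff ζ • w).im = ζ.im * w.im := by
    intro w
    have := congrArg Complex.im (aff_smul ζ w)
    simpa using this
  have hζ := ζ.im_pos
  have h := repr_I hM (fun w => G (aff ζ • w)) (hG.comp (mdifferentiable_smul (aff_det ζ))) (C / ζ.im ^ M) (by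
    intro τ
    have := hC (aff ζ • τ)
    rwa [him, mul_pow, ← div_div] at this)
  have key : (fun w : ℍ => G (aff ζ • w) * ((Complex.I - conj (w : ℂ)) ^ (2 * M))⁻¹ * (w.im : ℂ) ^ (2 * M)) =
     (fun w : ℍ => (fun w : ℍ => G w * (((ζ : ℂ) - conj (w : ℂ)) ^ (2 * M))⁻¹ * (w.im : ℂ) ^ (2 * M)) (aff ζ • w)) := by
    funext w
    have hz : (ζ : ℂ) = ζ.re + ζ.im * Complex.I := (Complex.re_add_im (ζ : ℂ)).symm
    have e : (ζ : ℂ) - conj ((aff ζ • w : ℍ) : ℂ) = ζ.im * (Complex.I - conj (w : ℂ)) := by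
      rw [aff_smul]
      conv_lhs => rw [hz]
      simp only [map_add, map_mul, Complex.conj_ofReal]
      ring
    have hc : ((ζ.im : ℂ)) ^ (2 * M) ≠ 0 := pow_ne_zero _ (by exact_mod_cast hζ.ne')
    simp only [e, him]
    push_cast
    rw [mul_pow, mul_pow, mul_inv]
    field_simp
  rw [key] at h
  have mp : MeasurePreserving (fun w : ℍ => aff ζ • w) := measurePreserving_smul _ _
  refine ⟨?_, ?_⟩
  · exact (mp.integrable_comp_emb (MeasurableEquiv.smul (aff ζ)).measurableEmbedding).mp h.1
  · have h2 := h.2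
    rw [integral_smul_eq_self (μ := (volume : Measure ℍ)) (fun w : ℍ => G w * (((ζ : ℂ) - conj (w : ℂ)) ^ (2 * M))⁻¹ * (w.im : ℂ) ^ (2 * M))
      (g := aff ζ), aff_I] at h2
    exact h2

end EPB

namespace EPB
open UpperHalfPlane ModularForm CongruenceSubgroup Matrix.SpecialLinearGroup Filter Topology
open scoped MatrixGroups Manifold ComplexConjugate ENNReal

lemma fold_abs {X Γ : Type*} [MeasurableSpace X] [Group Γ] [Countable Γ] [MulAction Γ X] [MeasurableConstSMul Γ X]
    (μ : Measure X) [SMulInvariantMeasure Γ X μ] (ψ : X → ℝ) (hψ : Measurable ψ) (hpos : ∀ x, 0 < ψ x)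
    (hsum : ∀ x, Summable fun γ : Γ => ψ (γ • x)) (f : X → ℂ) (hf : Measurable f) (hfi : Integrable f μ)
    (h0 : ∀ x, HasSum (fun γ : Γ => f (γ • x)) 0) : ∫ x, f x ∂μ = 0 := by
  set Ψ : X → ℝ := fun x => ∑' γ : Γ, ψ (γ • x) with hΨ
  have hΨpos : ∀ x, 0 < Ψ x := fun x => (hsum x).tsum_pos (fun γ => (hpos _).le) 1 (hpos _)
  have hΨinv : ∀ (γ : Γ) x, Ψ (γ • x) = Ψ x := by
    intro γ x
    simp only [hΨ, smul_smul]
    exact (Equiv.mulRight γ).tsum_eq (fun γ => ψ (γ • x))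
  have hΨm : Measurable Ψ := by
    have : Ψ = fun x => (∑' γ : Γ, ENNReal.ofReal (ψ (γ • x))).toReal := by
      funext x
      rw [← ENNReal.ofReal_tsum_of_nonneg (fun γ => (hpos _).le) (hsum x), ENNReal.toReal_ofReal (hΨpos x).le]
    rw [this]
    refine (Measurable.tsum fun γ => ?_).ennreal_toReal
    exact (hψ.comp (measurable_const_smul γ)).ennreal_ofReal
  set h : X → ℝ := fun x => ψ x / Ψ x with hh
  have hhm : Measurable h := hψ.div hΨm
  have hhpos : ∀ x, 0 < h x := fun x => div_pos (hpos x) (hΨpos x)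
  have hh1 : ∀ x, HasSum (fun γ : Γ => h (γ • x)) 1 := by
    intro x
    have := (hsum x).hasSum.div_const (Ψ x)
    simp only [hh, hΨinv]
    rwa [show (∑' γ : Γ, ψ (γ • x)) / Ψ x = 1 from div_self (hΨpos x).ne'] at this
  have hA : ∑' γ : Γ, ∫⁻ x, ‖f x * (h (γ • x) : ℂ)‖ₑ ∂μ ≠ ∞ := by
    rw [← lintegral_tsum]
    · have : ∀ x, ∑' γ : Γ, ‖f x * (h (γ • x) : ℂ)‖ₑ = ‖f x‖ₑ := by
        intro x
        simp only [enorm_mul]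
        rw [ENNReal.tsum_mul_left]
        have e : ∀ γ : Γ, ‖((h (γ • x) : ℝ) : ℂ)‖ₑ = ENNReal.ofReal (h (γ • x)) := by
          intro γ
          rw [← ofReal_norm, Complex.norm_real, Real.norm_of_nonneg (hhpos _).le]
        simp only [e]
        rw [← ENNReal.ofReal_tsum_of_nonneg (fun γ => (hhpos _).le) (hh1 x).summable, (hh1 x).tsum_eq]
        simp
      simp only [this]
      exact hfi.2.ne
    · intro γ
      have := hhm.comp (measurable_const_smul (α := X) γ)
      exact ((hf.mul (Complex.measurable_ofReal.comp this)).enorm).aemeasurable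
  have step1 : ∫ x, f x ∂μ = ∑' γ : Γ, ∫ x, f x * (h (γ • x) : ℂ) ∂μ := by
    rw [← integral_tsum _ hA]
    · refine integral_congr_ae (Eventually.of_forall fun x => ?_)
      simp only
      rw [tsum_mul_left]
      have := (Complex.hasSum_ofReal.mpr (hh1 x)).tsum_eq
      rw [this]
      simp
    · intro γ
      have := hhm.comp (measurable_const_smul (α := X) γ)
      exact (hf.mul (Complex.measurable_ofReal.comp this)).aestronglyMeasurable
  have e1 : ∀ γ : Γ, ∫ x, f x * (h (γ • x) : ℂ) ∂μ = ∫ x, f (γ⁻¹ • x) * (h x : ℂ) ∂μ := by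
    intro γ
    rw [← integral_smul_eq_self (μ := μ) (fun x => f (γ⁻¹ • x) * (h x : ℂ)) (g := γ)]
    simp only [inv_smul_smul]
  have e2 : ∀ γ : Γ, ∫⁻ x, ‖f x * (h (γ • x) : ℂ)‖ₑ ∂μ = ∫⁻ x, ‖f (γ⁻¹ • x) * (h x : ℂ)‖ₑ ∂μ := by
    intro γ
    rw [← (measurePreserving_smul γ μ).lintegral_comp_emb (MeasurableEquiv.smul γ).measurableEmbedding
      (fun x => ‖f (γ⁻¹ • x) * (h x : ℂ)‖ₑ)]
    simp only [inv_smul_smul]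
  rw [step1]
  simp only [e1]
  simp only [e2] at hA
  rw [← integral_tsum _ hA]
  · have : ∀ x, ∑' γ : Γ, f (γ⁻¹ • x) * (h x : ℂ) = 0 := by
      intro x
      have e := (Equiv.inv Γ).tsum_eq (fun γ => f (γ • x))
      simp only [Equiv.inv_apply] at e
      rw [tsum_mul_right, e, (h0 x).tsum_eq, zero_mul]
    simp only [this, integral_zero]
  · intro γ
    exact ((hf.comp (measurable_const_smul (α := X) γ⁻¹)).mul (Complex.measurable_ofReal.comp hhm)).aestronglyMeasurable

lemma pw_bound (M : ℕ) (w : ℍ) : ∃ C : ℝ, ∀ τ : ℍ, ‖(((τ : ℂ) + w) ^ (2 * M))⁻¹‖ ≤ C * ‖(τ : ℂ)‖ ^ (-(M : ℤ)) := by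
  have hw := w.im_pos
  refine ⟨(w.im ^ M)⁻¹ * (1 + ‖(w : ℂ)‖ / w.im) ^ M, fun τ => ?_⟩
  have hτ := τ.im_pos
  have h1 : w.im ≤ ‖(τ : ℂ) + w‖ := by
    have := (le_abs_self _).trans (Complex.abs_im_le_norm ((τ : ℂ) + w))
    simp only [Complex.add_im, coe_im] at this
    linarith
  have hτn : 0 < ‖(τ : ℂ)‖ := norm_pos_iff.mpr (ne_zero τ)
  have h2 : ‖(τ : ℂ)‖ ≤ (1 + ‖(w : ℂ)‖ / w.im) * ‖(τ : ℂ) + w‖ := by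
    have h3 : ‖(τ : ℂ)‖ ≤ ‖(τ : ℂ) + w‖ + ‖(w : ℂ)‖ := by
      have := norm_sub_le ((τ : ℂ) + w) w
      simpa using this
    have h4 : ‖(w : ℂ)‖ ≤ ‖(w : ℂ)‖ / w.im * ‖(τ : ℂ) + w‖ := by
      calc ‖(w : ℂ)‖ = ‖(w : ℂ)‖ / w.im * w.im := by field_simp
        _ ≤ _ := by gcongr
    linarith
  have hn : 0 < ‖(τ : ℂ) + w‖ := hw.trans_le h1
  rw [norm_inv, norm_pow, two_mul, pow_add, mul_inv, zpow_neg, zpow_natCast, mul_assoc]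
  refine mul_le_mul (by gcongr) ?_ (by positivity) (by positivity)
  rw [← div_eq_mul_inv, le_div_iff₀ (by positivity), ← div_eq_inv_mul, div_le_iff₀ (by positivity), ← mul_pow]
  gcongr

/-- Bergman-type kernel -/
def hK (M : ℕ) (w : ℍ) : ℍ → ℂ := Poin ((2 * M : ℕ) : ℤ) (fun τ => (((τ : ℂ) + w) ^ (2 * M))⁻¹)

lemma hK_summable {M : ℕ} (hM : 4 ≤ M) (w z : ℍ) :
    Summable fun g : SL(2, ℤ) => ‖((fun τ : ℍ => (((τ : ℂ) + w) ^ (2 * M))⁻¹) ∣[((2 * M : ℕ) : ℤ)] g) z‖ := by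
  obtain ⟨C, hC⟩ := pw_bound M w
  have := poin_summable (k := M) (l := M) (by omega) (by omega) hC z
  rwa [← two_mul] at this

lemma pw_ne (τ w : ℍ) : (τ : ℂ) + w ≠ 0 := by
  intro h
  have := congrArg Complex.im h
  have h1 := τ.im_pos
  have h2 := w.im_pos
  simp only [Complex.add_im, coe_im, Complex.zero_im] at this
  linarith

lemma hK_cusp {M : ℕ} (hM : 4 ≤ M) (w : ℍ) : ∃ F : CuspForm (Gamma0 2) ((2 * M : ℕ) : ℤ), ⇑F = hK M w := by
  obtain ⟨C, hC⟩ := pw_bound M w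
  have := Poin_cusp (k := M) (l := M) (by omega) (by omega) (φ := fun τ => (((τ : ℂ) + w) ^ (2 * M))⁻¹) ?_ hC
  · rwa [← two_mul] at this
  · rw [mdifferentiable_iff]
    have : DifferentiableOn ℂ (fun z : ℂ => ((z + w) ^ (2 * M))⁻¹) {z | 0 < z.im} := by
      refine DifferentiableOn.inv (by fun_prop) (fun z hz => pow_ne_zero _ ?_)
      exact pw_ne ⟨z, hz⟩ w
    refine this.congr fun z hz => ?_
    simp only [Function.comp_apply]
    rw [ofComplex_apply_of_im_pos hz]

/-- slash term -/
lemma hK_term (M : ℕ) (w z : ℍ) (g : SL(2, ℤ)) :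
    ((fun τ : ℍ => (((τ : ℂ) + w) ^ (2 * M))⁻¹) ∣[((2 * M : ℕ) : ℤ)] g) z =
      ((lf (g 0) z + w * lf (g 1) z) ^ (2 * M))⁻¹ := by
  rw [SL_slash_apply, denom_eq_lf, smul_eq_lf, zpow_neg, zpow_natCast, ← mul_inv, ← mul_pow]
  have := lf_ne (row_ne g 1) z
  congr 2
  field_simp

lemma fold {M : ℕ} (hM : 4 ≤ M) (f : ℍ → ℂ) (hc : Continuous f) (hfi : Integrable f)
    (h0 : ∀ w : ℍ, HasSum (fun γ : Gamma0 2 => f ((γ : SL(2, ℤ)) • w)) 0) : ∫ w, f w = 0 := by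
  have hinv : SMulInvariantMeasure (Gamma0 2) ℍ volume := by
    refine ⟨fun γ s hs => ?_⟩
    exact (measurePreserving_smul ((γ : SL(2, ℤ)) : GL (Fin 2) ℝ) (volume : Measure ℍ)).measure_preimage hs.nullMeasurableSet
  have : Countable SL(2, ℤ) := rows_inj.countable
  have hm : MeasurableConstSMul (Gamma0 2) ℍ := ⟨fun γ =>
    (measurePreserving_smul ((γ : SL(2, ℤ)) : GL (Fin 2) ℝ) (volume : Measure ℍ)).measurable⟩
  refine fold_abs (Γ := Gamma0 2) volume (fun w => rho w ^ M) (continuous_rho.pow M).measurable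
    (fun w => pow_pos (rho_pos w) M) ?_ f hc.measurable hfi h0
  intro w
  have h := ((hK_summable hM UpperHalfPlane.I w).mul_left (w.im ^ M)).subtype (fun g => g ∈ Gamma0 2)
  refine h.congr fun γ => ?_
  symm
  change rho ((γ : SL(2, ℤ)) • w) ^ M = w.im ^ M * ‖((fun τ : ℍ => (((τ : ℂ) + UpperHalfPlane.I) ^ (2 * M))⁻¹) ∣[((2 * M : ℕ) : ℤ)] (γ : SL(2, ℤ))) w‖
  rw [SL_slash_apply]
  unfold rho
  rw [ModularGroup.im_smul_eq_div_normSq, norm_mul, norm_inv, norm_pow, zpow_neg, zpow_natCast, norm_inv, norm_pow,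
    Complex.normSq_eq_norm_sq, div_pow, div_pow, coe_I, pow_mul, pow_mul]
  have := norm_pos_iff.mpr (denom_ne_zero ((γ : SL(2, ℤ)) : GL (Fin 2) ℝ) w)
  field_simp


def refl (w : ℍ) : ℍ := ⟨-conj (w : ℂ), by simpa using w.im_pos⟩

lemma cusp_bound {M : ℕ} (g : CuspForm (Gamma0 2) ((2 * M : ℕ) : ℤ)) : ∃ C : ℝ, ∀ τ : ℍ, ‖g τ‖ ≤ C / τ.im ^ M := by
  obtain ⟨C, hC⟩ := CuspFormClass.exists_bound g
  refine ⟨C, fun τ => ?_⟩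
  have := hC τ
  have e : ((((2 * M : ℕ) : ℤ) : ℝ) / 2) = (M : ℝ) := by push_cast; ring
  rwa [e, Real.rpow_natCast] at this

lemma inv_entries (γ : SL(2, ℤ)) (z : ℂ) : lf (γ⁻¹ 0) z = γ 1 1 * z - γ 0 1 ∧ lf (γ⁻¹ 1) z = - γ 1 0 * z + γ 0 0 := by
  have h := Matrix.SpecialLinearGroup.SL2_inv_expl γ
  constructor
  · simp only [lf, h]
    simp
    ring
  · simp only [lf, h]
    simp

lemma kernel_pt {M : ℕ} (g : CuspForm (Gamma0 2) ((2 * M : ℕ) : ℤ)) (ζ w : ℍ) (γ : SL(2, ℤ)) (hγ : γ ∈ Gamma0 2) :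
    g (γ • w) * (((ζ : ℂ) - conj ((γ • w : ℍ) : ℂ)) ^ (2 * M))⁻¹ * ((γ • w).im : ℂ) ^ (2 * M) =
    g w * (w.im : ℂ) ^ (2 * M) * ((fun τ : ℍ => (((τ : ℂ) + refl w) ^ (2 * M))⁻¹) ∣[((2 * M : ℕ) : ℤ)] γ⁻¹) ζ := by
  rw [hK_term]
  have h1 := congrFun (cusp_slash g hγ) w
  rw [SL_slash_apply, denom_eq_lf] at h1
  have hd := lf_ne (row_ne γ 1) w
  have hdK := pow_ne_zero (2 * M) hd
  rw [zpow_neg, zpow_natCast, mul_inv_eq_iff_eq_mul₀ hdK] at h1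
  have hdc : conj (lf (γ 1) w) ≠ 0 := by simpa using hd
  have him : (((γ • w).im : ℝ) : ℂ) = w.im / (lf (γ 1) w * conj (lf (γ 1) w)) := by
    rw [ModularGroup.im_smul_eq_div_normSq, denom_eq_lf, Complex.mul_conj]
    push_cast
    rfl
  have e : lf (γ⁻¹ 0) ζ + (refl w : ℂ) * lf (γ⁻¹ 1) ζ = conj (lf (γ 1) w) * ((ζ : ℂ) - conj ((γ • w : ℍ) : ℂ)) := by
    rw [smul_eq_lf, map_div₀, mul_sub, mul_div_cancel₀ _ hdc, (inv_entries γ _).1, (inv_entries γ _).2]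
    simp only [lf, refl, map_add, map_mul, map_intCast]
    ring
  rw [h1, him, e, div_pow, mul_pow, mul_pow]
  have hdcK := pow_ne_zero (2 * M) hdc
  field_simp

lemma kernel_trick {M : ℕ} (hM : 4 ≤ M) {ι : Type*} (s : Finset ι) (c : ι → ℂ) (ζ : ι → ℍ)
    (h : ∀ w : ℍ, ∑ i ∈ s, c i * hK M w (ζ i) = 0) (g : CuspForm (Gamma0 2) ((2 * M : ℕ) : ℤ)) :
    ∑ i ∈ s, c i * g (ζ i) = 0 := by
  obtain ⟨C, hC⟩ := cusp_bound g
  have hrep := fun i => repr_gen hM g g.holo' C hC (ζ i)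
  set f : ι → ℍ → ℂ := fun i w => g w * (((ζ i : ℂ) - conj (w : ℂ)) ^ (2 * M))⁻¹ * (w.im : ℂ) ^ (2 * M) with hf
  have hfc : ∀ i, Continuous (f i) := by
    intro i
    have h1 : Continuous (g : ℍ → ℂ) := g.holo'.continuous
    refine (h1.mul (Continuous.inv₀ ?_ ?_)).mul ?_
    · have := continuous_coe
      fun_prop
    · intro w
      refine pow_ne_zero _ ?_
      have := pw_ne (ζ i) (refl w)
      simpa [refl, sub_eq_add_neg] using this
    · have := UpperHalfPlane.continuous_im
      fun_prop
  have hz := fold hM (fun w => ∑ i ∈ s, c i * f i w)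
    (continuous_finsetSum _ fun i _ => continuous_const.mul (hfc i))
    (integrable_finsetSum _ fun i _ => (hrep i).1.const_mul (c i)) (by
      intro w
      have hs : ∀ i, HasSum (fun γ : Gamma0 2 => f i ((γ : SL(2, ℤ)) • w))
          (g w * (w.im : ℂ) ^ (2 * M) * hK M (refl w) (ζ i)) := by
        intro i
        have h1 : Summable fun γ : Gamma0 2 => ((fun τ : ℍ => (((τ : ℂ) + refl w) ^ (2 * M))⁻¹) ∣[((2 * M : ℕ) : ℤ)] (γ : SL(2, ℤ))) (ζ i) :=
          (Summable.of_norm (hK_summable hM (refl w) (ζ i))).subtype _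
        have h2 := h1.hasSum.mul_left (g w * (w.im : ℂ) ^ (2 * M))
        have h3 := (Equiv.inv (Gamma0 2)).hasSum_iff.mpr h2
        refine h3.congr_fun ?_
        intro γ
        exact kernel_pt g (ζ i) w γ γ.2
      have := hasSum_sum (s := s) fun i _ => (hs i).mul_left (c i)
      have h4 := h (refl w)
      have h5 : ∑ i ∈ s, c i * (g w * (w.im : ℂ) ^ (2 * M) * hK M (refl w) (ζ i)) = 0 := by
        rw [← mul_zero (g w * (w.im : ℂ) ^ (2 * M)), ← h4, Finset.mul_sum]
        exact Finset.sum_congr rfl fun i _ => by ring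
      rw [h5] at this
      exact this)
  rw [integral_finsetSum _ fun i _ => (hrep i).1.const_mul (c i)] at hz
  have e : ∀ i, ∫ w, c i * f i w = (c i * g (ζ i)) * ((2 * Complex.I) ^ (2 * M) * kap (2 * M)) := by
    intro i
    rw [integral_const_mul, (hrep i).2]
    ring
  rw [Finset.sum_congr rfl fun i _ => e i, ← Finset.sum_mul] at hz
  refine (mul_eq_zero.mp hz).resolve_right (mul_ne_zero (pow_ne_zero _ (by simp)) ?_)
  exact_mod_cast (kap_pos (by omega)).ne'

end EPB

namespace EPB
open UpperHalfPlane ModularForm CongruenceSubgroup Matrix.SpecialLinearGroup Filter Topology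
open scoped MatrixGroups Manifold ComplexConjugate

lemma slash_mdiff {K : ℤ} (F : CuspForm (Gamma0 2) K) (δ : SL(2, ℤ)) : MDiff ((F : ℍ → ℂ) ∣[K] δ) :=
  F.holo'.slash _ _

lemma slash_bdd {K : ℤ} (F : CuspForm (Gamma0 2) K) (δ : SL(2, ℤ)) :
    IsBoundedAtImInfty ((F : ℍ → ℂ) ∣[K] δ) :=
  (cusp_zero F δ).isBoundedAtImInfty

lemma slash_T2 {K : ℤ} (F : CuspForm (Gamma0 2) K) (δ : SL(2, ℤ)) :
    ((F : ℍ → ℂ) ∣[K] δ) ∣[K] (ModularGroup.T ^ (2:ℤ)) = (F : ℍ → ℂ) ∣[K] δ := by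
  have h := conj_T_mem δ 1
  rw [mul_one] at h
  have h2 := cusp_slash F h
  rw [← SlashAction.slash_mul]
  conv_rhs => rw [← h2, ← SlashAction.slash_mul]
  congr 1
  group

lemma per_of_T {f : ℍ → ℂ} {n : ℤ} (h : ∀ z : ℍ, f (ModularGroup.T ^ n • z) = f z) :
    Function.Periodic (f ∘ ofComplex) (n : ℝ) := by
  intro w
  by_cases hw : 0 < w.im
  · have hw2 : 0 < (w + (n:ℝ)).im := by simpa using hw
    simp only [Function.comp_apply]
    rw [ofComplex_apply_of_im_pos hw, ofComplex_apply_of_im_pos hw2, ← h ⟨w, hw⟩,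
      UpperHalfPlane.modular_T_zpow_smul]
    congr 1
    ext
    simp [add_comm]
  · have hw2 : ¬ 0 < (w + (n:ℝ)).im := by simpa using hw
    simp only [Function.comp_apply]
    rw [ofComplex_apply_of_im_nonpos (not_lt.mp hw), ofComplex_apply_of_im_nonpos (not_lt.mp hw2)]

lemma slash_per {K : ℤ} (F : CuspForm (Gamma0 2) K) (δ : SL(2, ℤ)) :
    Function.Periodic (((F : ℍ → ℂ) ∣[K] δ) ∘ ofComplex) (2 : ℝ) := by
  have := per_of_T (f := (F : ℍ → ℂ) ∣[K] δ) (n := 2) (fun z => slash_T_apply (slash_T2 F δ) z)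
  simpa using this

lemma cusp_decay {K : ℤ} (F : CuspForm (Gamma0 2) K) (δ : SL(2, ℤ)) :
    ((F : ℍ → ℂ) ∣[K] δ) =O[atImInfty] fun τ ↦ Real.exp (-Real.pi * τ.im) := by
  have := (cusp_zero F δ).exp_decay_atImInfty (h := 2) two_pos (slash_per F δ) (slash_mdiff F δ)
    (slash_bdd F δ)
  refine this.trans (Asymptotics.isBigO_of_le _ fun τ => le_of_eq ?_)
  congr 2; ring

/-- the product over the three cosets -/
def nrm (K : ℤ) (f : ℍ → ℂ) : ℍ → ℂ :=
  f * (f ∣[K] ModularGroup.S) * (f ∣[K] (ModularGroup.S * ModularGroup.T))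

lemma nrm_inv {K : ℤ} (F : CuspForm (Gamma0 2) K) (γ : SL(2, ℤ)) :
    (nrm K F) ∣[K + K + K] γ = nrm K F := by
  have key : ∀ a b : SL(2, ℤ), a * b⁻¹ ∈ Gamma0 2 → (F : ℍ → ℂ) ∣[K] a = (F : ℍ → ℂ) ∣[K] b := by
    intro a b h
    have h2 := cusp_slash F h
    conv_rhs => rw [← h2, ← SlashAction.slash_mul]
    congr 1
    group
  refine SlashInvariantForm.slash_action_generators_SL2Z ?_ ?_ γ
  · unfold nrm
    rw [mul_slash_SL2, mul_slash_SL2, ← SlashAction.slash_mul, ← SlashAction.slash_mul]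
    rw [key (ModularGroup.S * ModularGroup.S) 1, key (ModularGroup.S * ModularGroup.T * ModularGroup.S) (ModularGroup.S * ModularGroup.T), SlashAction.slash_one]
    · ring
    · simp only [Gamma0_mem]; decide
    · simp only [Gamma0_mem]; decide
  · unfold nrm
    rw [mul_slash_SL2, mul_slash_SL2, ← SlashAction.slash_mul, ← SlashAction.slash_mul]
    rw [key (ModularGroup.S * ModularGroup.T * ModularGroup.T) ModularGroup.S, cusp_slash]
    · ring
    · simp only [Gamma0_mem]; decide
    · simp only [Gamma0_mem]; decide

lemma nrm_modular {K : ℤ} (F : CuspForm (Gamma0 2) K) : ∃ G : ModularForm 𝒮ℒ (K + K + K), ⇑G = nrm K F := by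
  have hb : IsBoundedAtImInfty (nrm K F) := by
    have h1 := slash_bdd F 1
    rw [SlashAction.slash_one] at h1
    exact (h1.mul (slash_bdd F _)).mul (slash_bdd F _)
  refine ⟨⟨⟨nrm K F, ?_⟩, ?_, ?_⟩, rfl⟩
  · rintro _ ⟨A, rfl⟩
    exact nrm_inv F A
  · exact (F.holo'.mul (slash_mdiff F _)).mul (slash_mdiff F _)
  · intro c hc
    rw [OnePoint.isBoundedAt_iff_forall_SL2Z hc]
    intro γ _
    have := nrm_inv F γ
    change IsBoundedAtImInfty (nrm K F ∣[K + K + K] γ)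
    rw [this]; exact hb

lemma coeff_zero_of_decay {k : ℤ} (G : ModularForm 𝒮ℒ k) (n m : ℕ) (hnm : n < m)
    (h : (G : ℍ → ℂ) =O[atImInfty] fun τ ↦ Real.exp (-2 * Real.pi * m * τ.im)) :
    (qExpansion 1 G).coeff n = 0 := by
  obtain ⟨C, hC⟩ := h.bound
  obtain ⟨A, -, hA⟩ := UpperHalfPlane.atImInfty_basis.eventually_iff.mp hC
  have key : ∀ t : ℝ, max A 1 ≤ t → ‖(qExpansion 1 G).coeff n‖ ≤ |C| * Real.exp (-2 * Real.pi * t) := by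
    intro t ht
    have ht0 : 0 < t := lt_of_lt_of_le (by positivity) ((le_max_right _ _).trans ht)
    rw [ModularFormClass.qExpansion_coeff_eq_intervalIntegral G one_pos one_mem_strictPeriods_SL n ht0]
    rw [norm_mul]
    simp only [Complex.ofReal_one, div_one, norm_one, one_mul]
    refine (intervalIntegral.norm_integral_le_of_norm_le_const (C := |C| * Real.exp (-2 * Real.pi * t)) ?_).trans (by simp)
    intro u _
    have h1 := @hA ⟨u + t * Complex.I, by simpa using ht0⟩ (by
      show A ≤ UpperHalfPlane.im _
      simp [UpperHalfPlane.im]; exact (le_max_left _ _).trans ht)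
    rw [norm_mul]
    have h2 : ‖1 / Function.Periodic.qParam 1 (u + t * Complex.I) ^ n‖ = Real.exp (2 * Real.pi * n * t) := by
      rw [norm_div, norm_one, norm_pow, Function.Periodic.norm_qParam, ← Real.exp_nat_mul, one_div, ← Real.exp_neg]
      congr 1
      simp; ring
    rw [h2]
    refine (mul_le_mul_of_nonneg_left (h1.trans (mul_le_mul_of_nonneg_right (le_abs_self C) (norm_nonneg _))) (Real.exp_pos _).le).trans ?_
    rw [Real.norm_of_nonneg (Real.exp_pos _).le, mul_left_comm, ← Real.exp_add]
    refine mul_le_mul_of_nonneg_left (Real.exp_le_exp.mpr ?_) (abs_nonneg _)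
    have : (UpperHalfPlane.im ⟨u + t * Complex.I, by simpa using ht0⟩) = t := by simp [UpperHalfPlane.im]
    rw [this]
    have h3 : (n : ℝ) + 1 ≤ m := by exact_mod_cast hnm
    nlinarith [Real.pi_pos, mul_pos Real.pi_pos ht0]
  have lim : Tendsto (fun t : ℝ => |C| * Real.exp (-2 * Real.pi * t)) atTop (𝓝 0) := by
    have : Tendsto (fun t : ℝ => Real.exp (-2 * Real.pi * t)) atTop (𝓝 0) :=
      Real.tendsto_exp_atBot.comp (tendsto_id.const_mul_atTop_of_neg (by linarith [Real.pi_pos]))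
    simpa using this.const_mul |C|
  have := ge_of_tendsto lim ((eventually_ge_atTop (max A 1)).mono key)
  exact norm_le_zero_iff.mp this

lemma decay_of_coeff {K : ℤ} (F : CuspForm (Gamma0 2) K) (m : ℕ)
    (h : ∀ n < m, (qExpansion 1 F).coeff n = 0) :
    (F : ℍ → ℂ) =O[atImInfty] fun τ ↦ Real.exp (-2 * Real.pi * m * τ.im) := by
  have hper : (1:ℝ) ∈ (Gamma0 2 : Subgroup (GL (Fin 2) ℝ)).strictPeriods := by simp
  have hs : ∀ τ : ℍ, HasSum (fun n : ℕ ↦ (qExpansion 1 F).coeff n • Function.Periodic.qParam 1 τ ^ n) (F τ) :=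
    fun τ => hasSum_qExpansion one_pos (SlashInvariantFormClass.periodic_comp_ofComplex F hper)
      F.holo' (by have := slash_bdd F 1; rwa [SlashAction.slash_one] at this) τ
  have hI := (hs UpperHalfPlane.I).summable.norm
  set r : ℝ := ‖Function.Periodic.qParam 1 (UpperHalfPlane.I : ℂ)‖ with hr
  have hr' : r = Real.exp (-2 * Real.pi) := by
    rw [hr, Function.Periodic.norm_qParam]; simp
  have hr0 : 0 < r := by rw [hr']; exact Real.exp_pos _
  rw [Asymptotics.isBigO_iff]
  refine ⟨(r ^ m)⁻¹ * ∑' n : ℕ, ‖(qExpansion 1 F).coeff n • Function.Periodic.qParam 1 (UpperHalfPlane.I : ℂ) ^ n‖, ?_⟩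
  rw [UpperHalfPlane.atImInfty_basis.eventually_iff]
  refine ⟨1, trivial, fun τ hτ => ?_⟩
  have hτ1 : 1 ≤ τ.im := hτ
  have hq : ‖Function.Periodic.qParam 1 (τ : ℂ)‖ = Real.exp (-2 * Real.pi * τ.im) := by
    rw [Function.Periodic.norm_qParam]; simp
  have hqr : Real.exp (-2 * Real.pi * τ.im) ≤ r := by
    rw [hr']; apply Real.exp_le_exp.mpr; nlinarith [Real.pi_pos]
  have hb : ∀ n : ℕ, ‖(qExpansion 1 F).coeff n • Function.Periodic.qParam 1 (τ : ℂ) ^ n‖ ≤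
      (Real.exp (-2 * Real.pi * m * τ.im) * (r ^ m)⁻¹) * ‖(qExpansion 1 F).coeff n • Function.Periodic.qParam 1 (UpperHalfPlane.I : ℂ) ^ n‖ := by
    intro n
    rcases lt_or_ge n m with hn | hn
    · simp [h n hn]
    · obtain ⟨e, rfl⟩ := Nat.exists_eq_add_of_le hn
      rw [norm_smul, norm_smul, norm_pow, norm_pow, hq, ← hr, pow_add, pow_add]
      have h1 : Real.exp (-2 * Real.pi * τ.im) ^ m = Real.exp (-2 * Real.pi * m * τ.im) := by
        rw [← Real.exp_nat_mul]; congr 1; ring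
      rw [h1]
      have h2 : Real.exp (-2 * Real.pi * τ.im) ^ e ≤ r ^ e := pow_le_pow_left₀ (Real.exp_pos _).le hqr e
      have h3 : Real.exp (-2 * Real.pi * m * τ.im) * (r ^ m)⁻¹ * (‖(qExpansion 1 F).coeff (m + e)‖ * (r ^ m * r ^ e)) =
        ‖(qExpansion 1 F).coeff (m + e)‖ * (Real.exp (-2 * Real.pi * m * τ.im) * r ^ e) := by
        field_simp
      rw [h3]
      gcongr
  have h4 := (hI.mul_left (Real.exp (-2 * Real.pi * m * τ.im) * (r ^ m)⁻¹)).hasSum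
  have h5 := tsum_of_norm_bounded h4 hb
  rw [(hs τ).tsum_eq] at h5
  refine h5.trans (le_of_eq ?_)
  rw [tsum_mul_left, Real.norm_of_nonneg (Real.exp_pos _).le]
  ring

lemma cusp_eq_zero {K d : ℕ} (hK : 3 * K < 12 * (d + 2)) (F : CuspForm (Gamma0 2) (K : ℤ))
    (h : ∀ n < d + 1, (qExpansion 1 F).coeff n = 0) : F = 0 := by
  obtain ⟨G, hG⟩ := nrm_modular F
  have h1 := decay_of_coeff F _ h
  have hd : (G : ℍ → ℂ) =O[atImInfty] fun τ ↦ Real.exp (-2 * Real.pi * (d + 2 : ℕ) * τ.im) := by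
    rw [hG]
    refine ((h1.mul (cusp_decay F _)).mul (cusp_decay F _)).trans (Asymptotics.isBigO_of_le _ fun τ => le_of_eq ?_)
    rw [← Real.exp_add, ← Real.exp_add]
    congr 2
    push_cast; ring
  have hG0 : G = 0 := by
    apply ModularForm.sturm_bound_levelOne
    have h2 : ((((K:ℤ) + K + K).toNat / 12 : ℕ) : ℕ∞) < ((d + 2 : ℕ) : ℕ∞) := by
      rw [Nat.cast_lt]; omega
    refine lt_of_lt_of_le h2 (PowerSeries.nat_le_order _ _ fun i hi => coeff_zero_of_decay G i (d + 2) hi hd)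
  rw [hG0] at hG
  have h0 : nrm K F = 0 := hG.symm
  have hz : ∀ δ : SL(2, ℤ), (F : ℍ → ℂ) ∣[(K:ℤ)] δ = 0 → (F : ℍ → ℂ) = 0 := by
    intro δ hδ
    have : ((F : ℍ → ℂ) ∣[(K:ℤ)] δ) ∣[(K:ℤ)] δ⁻¹ = 0 := by rw [hδ, SlashAction.zero_slash]
    rwa [← SlashAction.slash_mul, mul_inv_cancel, SlashAction.slash_one] at this
  unfold nrm at h0
  have hF : MDiff (F : ℍ → ℂ) := F.holo'
  rw [UpperHalfPlane.mul_eq_zero_iff (hF.mul (slash_mdiff F _)) (slash_mdiff F _),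
    UpperHalfPlane.mul_eq_zero_iff hF (slash_mdiff F _)] at h0
  have : (F : ℍ → ℂ) = 0 := by
    rcases h0 with (h0 | h0) | h0
    · exact h0
    · exact hz _ h0
    · exact hz _ h0
  exact DFunLike.coe_injective this

/-- coefficient map -/
def coefMap (K : ℤ) (d : ℕ) : CuspForm (Gamma0 2) K →ₗ[ℂ] (Fin d → ℂ) where
  toFun F := fun j => (qExpansion 1 F).coeff (j + 1)
  map_add' F G := by
    ext j
    have hper : (1:ℝ) ∈ (Gamma0 2 : Subgroup (GL (Fin 2) ℝ)).strictPeriods := by simp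
    have := ModularForm.qExpansion_add (F := CuspForm (Gamma0 2) K) one_pos hper F G
    rw [show ⇑(F + G) = ⇑F + ⇑G from rfl, this]; simp
  map_smul' a F := by
    ext j
    have hper : (1:ℝ) ∈ (Gamma0 2 : Subgroup (GL (Fin 2) ℝ)).strictPeriods := by simp
    have := ModularForm.qExpansion_smul one_pos hper a F
    rw [show ⇑(a • F) = a • ⇑F from rfl, this]; simp

lemma coefMap_inj {K d : ℕ} (hK : 3 * K < 12 * (d + 2)) : Function.Injective (coefMap (K : ℤ) d) := by
  rw [← LinearMap.ker_eq_bot, LinearMap.ker_eq_bot']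
  intro F hF
  apply cusp_eq_zero hK
  intro n hn
  have hper : (1:ℝ) ∈ (Gamma0 2 : Subgroup (GL (Fin 2) ℝ)).strictPeriods := by simp
  rcases n with _ | n
  · exact CuspFormClass.qExpansion_coeff_zero F one_pos hper
  · exact congrFun hF ⟨n, by omega⟩

lemma cusp_finite {K d : ℕ} (hK : 3 * K < 12 * (d + 2)) :
    FiniteDimensional ℂ (CuspForm (Gamma0 2) (K : ℤ)) :=
  FiniteDimensional.of_injective _ (coefMap_inj hK)

lemma cusp_finrank {K d : ℕ} (hK : 3 * K < 12 * (d + 2)) :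
    Module.finrank ℂ (CuspForm (Gamma0 2) (K : ℤ)) ≤ d := by
  have := LinearMap.finrank_le_finrank_of_injective (coefMap_inj hK)
  simpa using this

/-- Any linear functional is a finite combination of point evaluations. -/
lemma functional_eval {K d : ℕ} (hK : 3 * K < 12 * (d + 2))
    (L : CuspForm (Gamma0 2) (K : ℤ) →ₗ[ℂ] ℂ) :
    ∃ (s : Finset ℍ) (c : ℍ → ℂ), ∀ F, L F = ∑ z ∈ s, c z * F z := by
  have := cusp_finite hK
  let ev : ℍ → Module.Dual ℂ (CuspForm (Gamma0 2) (K : ℤ)) := fun z =>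
    { toFun := fun F => F z, map_add' := fun _ _ => rfl, map_smul' := fun _ _ => rfl }
  have htop : Submodule.span ℂ (Set.range ev) = ⊤ := by
    rw [← Subspace.dualCoannihilator_dualAnnihilator_eq (W := Submodule.span ℂ (Set.range ev))]
    have : (Submodule.span ℂ (Set.range ev)).dualCoannihilator = ⊥ := by
      rw [eq_bot_iff]
      intro F hF
      rw [Submodule.mem_dualCoannihilator] at hF
      rw [Submodule.mem_bot]
      ext z
      exact hF (ev z) (Submodule.subset_span ⟨z, rfl⟩)
    rw [this, Submodule.dualAnnihilator_bot]
  have hL : L ∈ Submodule.span ℂ (Set.range ev) := by rw [htop]; trivial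
  obtain ⟨c, hc⟩ := (Finsupp.mem_span_range_iff_exists_finsupp).mp hL
  refine ⟨c.support, c, fun F => ?_⟩
  rw [← hc, Finsupp.sum, LinearMap.sum_apply]
  rfl

end EPB

namespace EPB
open UpperHalfPlane ModularForm CongruenceSubgroup Matrix.SpecialLinearGroup Filter Topology
open scoped MatrixGroups Manifold ComplexConjugate

open Polynomial in
lemma poly_anti (Q : ℝ[X]) : ∃ P : ℝ[X], derivative P = Q ∧ P.eval 0 = 0 := by
  induction Q using Polynomial.induction_on' with
  | add p q hp hq =>
    obtain ⟨P, h1, h2⟩ := hp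
    obtain ⟨P', h1', h2'⟩ := hq
    exact ⟨P + P', by simp [h1, h1'], by simp [h2, h2']⟩
  | monomial n a =>
    refine ⟨monomial (n + 1) (a / (n + 1)), ?_, by simp⟩
    rw [derivative_monomial]
    have : ((n:ℝ) + 1) ≠ 0 := by positivity
    simp [this]

open Polynomial in
/-- polynomial primitive -/
def bP (p q : ℕ) : ℝ[X] := (poly_anti (X ^ p * (1 - X) ^ q)).choose

lemma bP_der (p q : ℕ) : Polynomial.derivative (bP p q) = Polynomial.X ^ p * (1 - Polynomial.X) ^ q :=
  (poly_anti _).choose_spec.1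

lemma bP_zero (p q : ℕ) : (bP p q).eval 0 = 0 := (poly_anti _).choose_spec.2

def bet (p q : ℕ) : ℝ := (bP p q).eval 1

lemma bet_pos (p q : ℕ) : 0 < bet p q := by
  have h : StrictMonoOn (fun x => (bP p q).eval x) (Set.Icc 0 1) := by
    refine strictMonoOn_of_deriv_pos (convex_Icc 0 1) (bP p q).continuous.continuousOn ?_
    intro x hx
    rw [interior_Icc] at hx
    rw [Polynomial.deriv, bP_der]
    have := hx.1
    have := sub_pos.mpr hx.2
    simp; positivity
  have := h (by simp : (0:ℝ) ∈ Set.Icc (0:ℝ) 1) (by simp : (1:ℝ) ∈ Set.Icc (0:ℝ) 1) one_pos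
  rw [bet]
  simpa [bP_zero] using this

lemma beta_real (p q : ℕ) {a b : ℝ} (ha : 0 < a) (hb : 0 < b) :
    IntegrableOn (fun y : ℝ => y ^ p * ((a * y + b) ^ (p + q + 2))⁻¹) (Set.Ioi 0) ∧
    ∫ y in Set.Ioi (0:ℝ), y ^ p * ((a * y + b) ^ (p + q + 2))⁻¹ = bet p q / (a ^ (p + 1) * b ^ (q + 1)) := by
  have hd : ∀ y ∈ Set.Ici (0:ℝ), HasDerivAt (fun y => (bP p q).eval (a * y / (a * y + b)) / (a ^ (p + 1) * b ^ (q + 1)))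
      (y ^ p * ((a * y + b) ^ (p + q + 2))⁻¹) y := by
    intro y hy
    have hy0 : (0:ℝ) ≤ y := hy
    have hne : a * y + b ≠ 0 := by positivity
    have h1 : HasDerivAt (fun y : ℝ => a * y) a y := by simpa using (hasDerivAt_id y).const_mul a
    have h2 := h1.div (h1.add_const b) hne
    have h3 := (((bP p q).hasDerivAt _).comp y h2).div_const (a ^ (p + 1) * b ^ (q + 1))
    refine h3.congr_deriv ?_
    rw [bP_der]
    simp only [Polynomial.eval_mul, Polynomial.eval_pow, Polynomial.eval_X, Polynomial.eval_sub, Polynomial.eval_one, Pi.div_apply]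
    have : 1 - a * y / (a * y + b) = b / (a * y + b) := by field_simp; ring
    rw [this, div_pow, div_pow]
    field_simp
    ring
  have hlim : Tendsto (fun y => (bP p q).eval (a * y / (a * y + b)) / (a ^ (p + 1) * b ^ (q + 1))) atTop
      (𝓝 (bet p q / (a ^ (p + 1) * b ^ (q + 1)))) := by
    refine Tendsto.div_const ?_ _
    refine ((bP p q).continuous.tendsto 1).comp ?_
    have h1 : Tendsto (fun y : ℝ => 1 - b * (a * y + b)⁻¹) atTop (𝓝 (1 - b * 0)) :=
      tendsto_const_nhds.sub ((tendsto_inv_atTop_zero.comp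
        (tendsto_atTop_add_const_right _ _ (tendsto_id.const_mul_atTop ha))).const_mul b)
    rw [mul_zero, sub_zero] at h1
    refine h1.congr' ?_
    filter_upwards [eventually_ge_atTop 0] with y hy
    have hne : a * y + b ≠ 0 := by positivity
    field_simp; ring
  have hInt := integrableOn_Ioi_deriv_of_nonneg' hd (fun y hy => by
    have : (0:ℝ) < y := hy
    positivity) hlim
  refine ⟨hInt, ?_⟩
  rw [integral_Ioi_of_hasDerivAt_of_tendsto' hd hInt hlim]
  simp [bP_zero]

lemma norm_lin {α β : ℂ} (h : 0 ≤ (α * conj β).re) {y : ℝ} (hy : 0 ≤ y) :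
    ‖α‖ * y + ‖β‖ ≤ 2 * ‖α * y + β‖ := by
  have h1 : ‖α * y + β‖ ^ 2 = ‖α‖ ^ 2 * y ^ 2 + ‖β‖ ^ 2 + 2 * y * (α * conj β).re := by
    rw [← Complex.normSq_eq_norm_sq, ← Complex.normSq_eq_norm_sq, ← Complex.normSq_eq_norm_sq]
    simp [Complex.normSq_apply]; ring
  have h2 : 0 ≤ 2 * y * (α * conj β).re := by positivity
  have := norm_nonneg α
  have := norm_nonneg β
  refine abs_le_of_sq_le_sq' ?_ (by positivity) |>.2
  nlinarith [sq_nonneg (‖α‖ * y - ‖β‖)]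

lemma beta_complex (p q : ℕ) {α β : ℂ} (hα : α ≠ 0) (hβ : β ≠ 0) (h : 0 ≤ (α * conj β).re) :
    IntegrableOn (fun y : ℝ => (y:ℂ) ^ p * ((α * y + β) ^ (p + q + 2))⁻¹) (Set.Ioi 0) ∧
    (∫ y in Set.Ioi (0:ℝ), (y:ℂ) ^ p * ((α * y + β) ^ (p + q + 2))⁻¹ = bet p q / (α ^ (p + 1) * β ^ (q + 1))) ∧
    (∫ y in Set.Ioi (0:ℝ), ‖(y:ℂ) ^ p * ((α * y + β) ^ (p + q + 2))⁻¹‖ ≤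
      2 ^ (p + q + 2) * bet p q * (‖α‖ ^ (p + 1) * ‖β‖ ^ (q + 1))⁻¹) := by
  have hα' := norm_pos_iff.mpr hα
  have hβ' := norm_pos_iff.mpr hβ
  have hne : ∀ y : ℝ, 0 ≤ y → α * y + β ≠ 0 := by
    intro y hy h0
    have := norm_lin h hy
    rw [h0, norm_zero] at this
    have : 0 < ‖α‖ * y + ‖β‖ := by positivity
    linarith
  obtain ⟨hi, hv⟩ := beta_real p q hα' hβ'
  have hbd : ∀ y ∈ Set.Ioi (0:ℝ), ‖(y:ℂ) ^ p * ((α * y + β) ^ (p + q + 2))⁻¹‖ ≤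
      2 ^ (p + q + 2) * (y ^ p * ((‖α‖ * y + ‖β‖) ^ (p + q + 2))⁻¹) := by
    intro y hy
    have hy0 : (0:ℝ) < y := hy
    rw [norm_mul, norm_pow, Complex.norm_real, Real.norm_of_nonneg hy0.le, norm_inv, norm_pow, mul_left_comm]
    refine mul_le_mul_of_nonneg_left ?_ (by positivity)
    have h1 := norm_lin h hy0.le
    have h2 : 0 < ‖α * y + β‖ := norm_pos_iff.mpr (hne y hy0.le)
    rw [← div_eq_mul_inv, ← div_pow, ← inv_pow]
    gcongr
    rw [le_div_iff₀ (by positivity), inv_mul_le_iff₀ h2]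
    linarith
  have hcont : ContinuousOn (fun y : ℝ => (y:ℂ) ^ p * ((α * y + β) ^ (p + q + 2))⁻¹) (Set.Ioi 0) := by
    refine ContinuousOn.mul (by fun_prop) (ContinuousOn.inv₀ (by fun_prop) ?_)
    intro y hy
    exact pow_ne_zero _ (hne y (le_of_lt hy))
  have hInt : IntegrableOn (fun y : ℝ => (y:ℂ) ^ p * ((α * y + β) ^ (p + q + 2))⁻¹) (Set.Ioi 0) := by
    refine Integrable.mono' (hi.const_mul (2 ^ (p + q + 2))) (hcont.aestronglyMeasurable measurableSet_Ioi) ?_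
    exact (ae_restrict_iff' measurableSet_Ioi).mpr (ae_of_all _ hbd)
  refine ⟨hInt, ?_, ?_⟩
  · have hd : ∀ y ∈ Set.Ici (0:ℝ), HasDerivAt (fun y : ℝ => Polynomial.aeval (α * y / (α * y + β)) (bP p q) / (α ^ (p + 1) * β ^ (q + 1)))
      ((y:ℂ) ^ p * ((α * y + β) ^ (p + q + 2))⁻¹) y := by
      intro y hy
      have hn := hne y hy
      have h1 : HasDerivAt (fun y : ℂ => α * y) α y := by simpa using (hasDerivAt_id (y:ℂ)).const_mul α
      have h2 := h1.div (h1.add_const β) hn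
      have h3 := (((bP p q).hasDerivAt_aeval (α * y / (α * y + β))).comp (y:ℂ) h2).div_const (α ^ (p + 1) * β ^ (q + 1))
      refine h3.comp_ofReal.congr_deriv ?_
      rw [bP_der]
      simp only [map_mul, map_pow, map_sub, map_one, Polynomial.aeval_X]
      have : 1 - α * y / (α * y + β) = β / (α * y + β) := by field_simp; ring
      rw [this, div_pow, div_pow]
      field_simp
      ring
    have hlim : Tendsto (fun y : ℝ => Polynomial.aeval (α * y / (α * y + β)) (bP p q) / (α ^ (p + 1) * β ^ (q + 1))) atTop
        (𝓝 (bet p q / (α ^ (p + 1) * β ^ (q + 1)))) := by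
      refine Tendsto.div_const ?_ _
      have hb : (bet p q : ℂ) = Polynomial.aeval (1:ℂ) (bP p q) := by
        have := Polynomial.aeval_algebraMap_apply ℂ (1:ℝ) (bP p q)
        rw [map_one] at this
        rw [this, bet]; simp
      rw [hb]
      refine (((bP p q).continuous_aeval (A := ℂ)).tendsto 1).comp ?_
      have h0 : Tendsto (fun y : ℝ => (α * y + β)⁻¹) atTop (𝓝 0) := by
        apply tendsto_inv₀_cobounded.comp
        rw [← tendsto_norm_atTop_iff_cobounded]
        refine tendsto_atTop_mono' atTop (f₁ := fun y : ℝ => (‖α‖ * y + ‖β‖) / 2) ?_ ?_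
        · filter_upwards [eventually_ge_atTop 0] with y hy
          linarith [norm_lin h hy]
        · exact (tendsto_atTop_add_const_right _ _ (tendsto_id.const_mul_atTop hα')).atTop_div_const two_pos
      have h1 : Tendsto (fun y : ℝ => 1 - β * (α * y + β)⁻¹) atTop (𝓝 (1 - β * 0)) :=
        tendsto_const_nhds.sub (h0.const_mul β)
      rw [mul_zero, sub_zero] at h1
      refine h1.congr' ?_
      filter_upwards [eventually_ge_atTop 0] with y hy
      have hn := hne y hy
      field_simp; ring
    rw [integral_Ioi_of_hasDerivAt_of_tendsto' hd hInt hlim]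
    have h0 : Polynomial.aeval (0:ℂ) (bP p q) = 0 := by
      have := Polynomial.aeval_algebraMap_apply ℂ (0:ℝ) (bP p q)
      rw [map_zero] at this
      rw [this]; simp [bP_zero]
    simp [h0]
  · refine (setIntegral_mono_on hInt.norm (hi.const_mul _) measurableSet_Ioi hbd).trans (le_of_eq ?_)
    rw [integral_const_mul, hv]; ring

end EPB

namespace EPB
open UpperHalfPlane ModularForm CongruenceSubgroup Matrix.SpecialLinearGroup Filter Topology
open scoped MatrixGroups Manifold ComplexConjugate

/-- the point `iy` -/
def iy (y : ℝ) : ℍ := ofComplex (y * Complex.I)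

lemma iy_coe {y : ℝ} (hy : 0 < y) : (iy y : ℂ) = y * Complex.I := by
  have h : 0 < (y * Complex.I).im := by simpa using hy
  rw [iy, ofComplex_apply_of_im_pos h]

lemma iy_im {y : ℝ} (hy : 0 < y) : (iy y).im = y := by
  rw [← UpperHalfPlane.coe_im, iy_coe hy]; simp

lemma iy_tendsto : Tendsto iy atTop atImInfty := by
  rw [UpperHalfPlane.atImInfty, tendsto_comap_iff]
  refine tendsto_id.congr' ?_
  filter_upwards [eventually_gt_atTop 0] with y hy
  simp [iy_im hy]

lemma iy_S {y : ℝ} (hy : 0 < y) : ModularGroup.S • iy y = iy y⁻¹ := by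
  ext
  rw [UpperHalfPlane.modular_S_smul]
  have hyc : (y:ℂ) ≠ 0 := by exact_mod_cast hy.ne'
  simp [iy_coe hy, iy_coe (inv_pos.mpr hy), mul_comm]

lemma iy_cont (f : ℍ → ℂ) (hf : Continuous f) : ContinuousOn (fun y : ℝ => f (iy y)) (Set.Ioi 0) := by
  refine hf.comp_continuousOn ?_
  have : ContinuousOn (fun y : ℝ => (iy y : ℂ)) (Set.Ioi 0) := by
    refine ContinuousOn.congr (f := fun y : ℝ => (y * Complex.I : ℂ)) (by fun_prop) ?_
    intro y hy
    exact iy_coe hy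
  exact UpperHalfPlane.isEmbedding_coe.continuousOn_iff.mpr this

lemma iy_top {K : ℤ} (F : CuspForm (Gamma0 2) K) (δ : SL(2, ℤ)) :
    (fun y : ℝ => ((F : ℍ → ℂ) ∣[K] δ) (iy y)) =O[atTop] fun y => Real.exp (-Real.pi * y) := by
  refine ((cusp_decay F δ).comp_tendsto iy_tendsto).trans_eventuallyEq ?_
  filter_upwards [eventually_gt_atTop 0] with y hy
  simp [iy_im hy]

lemma iy_bot {K : ℕ} (F : CuspForm (Gamma0 2) (K : ℤ)) :
    (fun y : ℝ => F (iy y)) =O[𝓝[>] 0] fun y : ℝ => (1:ℝ) := by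
  have h1 : (fun y : ℝ => (y⁻¹ : ℂ) ^ K * ((F : ℍ → ℂ) ∣[(K:ℤ)] ModularGroup.S) (iy y⁻¹)) =O[𝓝[>] 0]
      fun y : ℝ => (1:ℝ) := by
    have h2 : (fun t : ℝ => (t : ℂ) ^ K * ((F : ℍ → ℂ) ∣[(K:ℤ)] ModularGroup.S) (iy t)) =O[atTop] fun t : ℝ => (1:ℝ) := by
      have h3 : (fun t : ℝ => (t : ℂ) ^ K) =O[atTop] fun t : ℝ => Real.exp (Real.pi * t) := by
        have := (isLittleO_pow_exp_pos_mul_atTop K Real.pi_pos).isBigO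
        refine Asymptotics.IsBigO.congr_left (Asymptotics.IsBigO.norm_left (f' := fun t : ℝ => t ^ K) this).norm_left ?_ |>.of_norm_left
        intro t
        simp
      refine (h3.mul (iy_top F _)).congr_right ?_
      intro t
      rw [← Real.exp_add]; simp
    have := h2.comp_tendsto tendsto_inv_nhdsGT_zero
    refine this.congr_left ?_
    intro y; simp
  refine Asymptotics.IsBigO.congr' (Asymptotics.IsBigO.norm_left h1) ?_ EventuallyEq.rfl |>.of_norm_left
  filter_upwards [self_mem_nhdsWithin] with y hy
  have hy0 : (0:ℝ) < y := hy
  rw [SL_slash_apply, iy_S (inv_pos.mpr hy0), inv_inv, ModularGroup.denom_S, iy_coe (inv_pos.mpr hy0)]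
  simp only [norm_mul, norm_pow, norm_zpow, Complex.norm_I, norm_inv, Complex.ofReal_inv, zpow_neg, zpow_natCast, mul_one]
  have : ‖(y:ℂ)‖ ≠ 0 := by simpa using hy0.ne'
  field_simp

lemma int_F {K : ℕ} (F : CuspForm (Gamma0 2) (K : ℤ)) (p : ℕ) :
    IntegrableOn (fun y : ℝ => (y:ℂ) ^ p * F (iy y)) (Set.Ioi 0) := by
  have hc : ContinuousOn (fun y : ℝ => F (iy y)) (Set.Ioi 0) := iy_cont F F.holo'.continuous
  have h1 := iy_top F 1
  rw [SlashAction.slash_one] at h1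
  have := mellinConvergent_of_isBigO_rpow_exp (f := fun y : ℝ => F (iy y)) (s := (p + 1 : ℝ)) (b := 0) Real.pi_pos
    (hc.locallyIntegrableOn measurableSet_Ioi) h1 (by simpa using iy_bot F) (by simp; positivity)
  refine IntegrableOn.congr_fun this ?_ measurableSet_Ioi
  intro y hy
  simp

/-- period functional -/
def Lam (K p : ℕ) : CuspForm (Gamma0 2) (K : ℤ) →ₗ[ℂ] ℂ where
  toFun F := ∫ y in Set.Ioi (0:ℝ), (y:ℂ) ^ p * F (iy y)
  map_add' F G := by
    rw [← integral_add (int_F F p) (int_F G p)]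
    congr 1; ext y
    rw [show (F + G) (iy y) = F (iy y) + G (iy y) from rfl]; ring
  map_smul' a F := by
    rw [RingHom.id_apply, smul_eq_mul, ← integral_const_mul]
    congr 1; ext y
    rw [show (a • F) (iy y) = a * F (iy y) from rfl]; ring

lemma Lam_hK_term {M p q : ℕ} (hpq : p + q + 2 = 2 * M) (w : ℍ) (g : SL(2, ℤ)) :
    IntegrableOn (fun y : ℝ => (y:ℂ) ^ p * ((lf (g 0) (iy y) + w * lf (g 1) (iy y)) ^ (2 * M))⁻¹) (Set.Ioi 0) ∧
    (∫ y in Set.Ioi (0:ℝ), (y:ℂ) ^ p * ((lf (g 0) (iy y) + w * lf (g 1) (iy y)) ^ (2 * M))⁻¹ =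
      bet p q / Complex.I ^ (p + 1) * ((g 1 1 * (w:ℂ) + g 0 1) ^ (-((q + 1 : ℕ) : ℤ)) * (g 1 0 * (w:ℂ) + g 0 0) ^ (-((p + 1 : ℕ) : ℤ)))) ∧
    (∫ y in Set.Ioi (0:ℝ), ‖(y:ℂ) ^ p * ((lf (g 0) (iy y) + w * lf (g 1) (iy y)) ^ (2 * M))⁻¹‖ ≤
      2 ^ (p + q + 2) * bet p q * ‖(g 1 1 * (w:ℂ) + g 0 1) ^ (-((q + 1 : ℕ) : ℤ)) * (g 1 0 * (w:ℂ) + g 0 0) ^ (-((p + 1 : ℕ) : ℤ))‖) := by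
  set α : ℂ := Complex.I * (g 1 0 * (w:ℂ) + g 0 0) with hα
  set β : ℂ := g 1 1 * (w:ℂ) + g 0 1 with hβ
  have hdet : (g 0 0 * g 1 1 - g 0 1 * g 1 0 : ℤ) = 1 := by
    have := g.det_coe
    rwa [Matrix.det_fin_two] at this
  have hdetR : ((g 0 0 : ℝ) * g 1 1 - g 0 1 * g 1 0) = 1 := by exact_mod_cast hdet
  have hα1 : g 1 0 * (w:ℂ) + g 0 0 ≠ 0 := by
    have := lf_ne (v := ![g 1 0, g 0 0]) (by
      intro h
      have h0 := congrFun h 0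
      have h1 := congrFun h 1
      simp at h0 h1
      rw [h0, h1] at hdet; simp at hdet) w
    simpa [lf] using this
  have hα0 : α ≠ 0 := mul_ne_zero Complex.I_ne_zero hα1
  have hβ0 : β ≠ 0 := by
    have := lf_ne (v := ![g 1 1, g 0 1]) (by
      intro h
      have h0 := congrFun h 0
      have h1 := congrFun h 1
      simp at h0 h1
      rw [h0, h1] at hdet; simp at hdet) w
    simpa [lf] using this
  have hre : (α * conj β).re = w.im := by
    have : (α * conj β).re = w.im * ((g 0 0 : ℝ) * g 1 1 - g 0 1 * g 1 0) := by
      rw [hα, hβ]; simp; ring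
    rw [this, hdetR, mul_one]
  obtain ⟨h1, h2, h3⟩ := beta_complex p q hα0 hβ0 (by rw [hre]; exact w.im_pos.le)
  have heq : ∀ y ∈ Set.Ioi (0:ℝ), (y:ℂ) ^ p * ((α * y + β) ^ (p + q + 2))⁻¹ =
      (y:ℂ) ^ p * ((lf (g 0) (iy y) + w * lf (g 1) (iy y)) ^ (2 * M))⁻¹ := by
    intro y hy
    rw [hpq, lf, lf, iy_coe hy, hα, hβ]
    congr 3
    ring
  refine ⟨h1.congr_fun heq measurableSet_Ioi, ?_, ?_⟩
  · rw [← setIntegral_congr_fun measurableSet_Ioi heq, h2, hα, mul_pow, zpow_neg, zpow_neg, zpow_natCast, zpow_natCast]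
    field_simp
  · rw [← setIntegral_congr_fun measurableSet_Ioi (fun y hy => congrArg norm (heq y hy))]
    refine h3.trans (le_of_eq ?_)
    rw [hα, norm_mul, Complex.norm_I, one_mul, norm_mul, norm_zpow, norm_zpow, zpow_neg, zpow_neg, zpow_natCast, zpow_natCast, mul_inv]
    ring

/-- transposition along the antidiagonal-type involution -/
def swp (g : Gamma0 2) : Gamma0 2 :=
  ⟨⟨!![g.1 1 1, g.1 0 1; g.1 1 0, g.1 0 0], by
    have := g.1.det_coe
    rw [Matrix.det_fin_two] at this
    rw [Matrix.det_fin_two_of]; linarith⟩, by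
    have := g.2
    rw [Gamma0_mem] at this
    exact Gamma0_mem.mpr this⟩

lemma swp_swp (g : Gamma0 2) : swp (swp g) = g := by
  apply Subtype.ext
  apply Subtype.ext
  ext i j
  fin_cases i <;> fin_cases j <;> rfl

def swpEquiv : Gamma0 2 ≃ Gamma0 2 := ⟨swp, swp, swp_swp, swp_swp⟩

lemma Lam_hK {M p q : ℕ} (hM : 4 ≤ M) (hp : 2 ≤ p) (hq : 2 ≤ q) (hpq : p + q + 2 = 2 * M) (w : ℍ)
    (F : CuspForm (Gamma0 2) ((2 * M : ℕ) : ℤ)) (hF : ⇑F = hK M w) :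
    Lam (2 * M) p F = bet p q / Complex.I ^ (p + 1) * RK (q + 1) (p + 1) w := by
  have hs := poin_summable (k := q + 1) (l := p + 1) (C := 1) (φ := fun τ => (τ : ℂ) ^ (-((q + 1 : ℕ) : ℤ)))
    (by omega) (by omega) (fun τ => by rw [norm_zpow, one_mul]) w
  have hs2 : Summable fun g : Gamma0 2 => ‖(lf ((swp g).1 0) w ^ (-((q + 1 : ℕ) : ℤ)) * lf ((swp g).1 1) w ^ (-((p + 1 : ℕ) : ℤ)))‖ := by
    refine (Equiv.summable_iff swpEquiv (f := fun g : Gamma0 2 => ‖(lf (g.1 0) w ^ (-((q + 1 : ℕ) : ℤ)) * lf (g.1 1) w ^ (-((p + 1 : ℕ) : ℤ)))‖)).mpr ?_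
    refine (hs.comp_injective (i := fun g : Gamma0 2 => (g : SL(2, ℤ))) Subtype.val_injective).congr ?_
    intro g
    simp only [Function.comp_apply, RK_term]
  have hterm : ∀ g : Gamma0 2, lf ((swp g).1 0) w ^ (-((q + 1 : ℕ) : ℤ)) * lf ((swp g).1 1) w ^ (-((p + 1 : ℕ) : ℤ)) =
      ((g.1 1 1 * (w:ℂ) + g.1 0 1) ^ (-((q + 1 : ℕ) : ℤ)) * (g.1 1 0 * (w:ℂ) + g.1 0 0) ^ (-((p + 1 : ℕ) : ℤ))) := by
    intro g
    rfl
  have : Countable SL(2, ℤ) := rows_inj.countable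
  have : Countable (Gamma0 2) := Subtype.val_injective.countable (f := fun g : Gamma0 2 => (g : SL(2, ℤ)))
  have hsum := hasSum_integral_of_summable_integral_norm (μ := volume.restrict (Set.Ioi (0:ℝ)))
    (F := fun (g : Gamma0 2) (y : ℝ) => (y:ℂ) ^ p * ((lf (g.1 0) (iy y) + w * lf (g.1 1) (iy y)) ^ (2 * M))⁻¹)
    (fun g => (Lam_hK_term hpq w g.1).1) (by
      refine Summable.of_nonneg_of_le (fun g => integral_nonneg fun y => norm_nonneg _) (fun g => (Lam_hK_term hpq w g.1).2.2) ?_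
      refine Summable.mul_left _ (hs2.congr fun g => ?_)
      rw [hterm])
  have h1 : Lam (2 * M) p F = ∫ y in Set.Ioi (0:ℝ), ∑' g : Gamma0 2, (y:ℂ) ^ p * ((lf (g.1 0) (iy y) + w * lf (g.1 1) (iy y)) ^ (2 * M))⁻¹ := by
    change ∫ y in Set.Ioi (0:ℝ), (y:ℂ) ^ p * F (iy y) = _
    congr 1; ext y
    rw [tsum_mul_left, hF, hK, Poin]
    congr 2; ext g
    rw [hK_term]
  rw [h1, ← hsum.tsum_eq]
  simp only [(Lam_hK_term hpq w _).2.1]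
  rw [tsum_mul_left, RK, Poin]
  congr 1
  rw [← swpEquiv.tsum_eq (f := fun g : Gamma0 2 => ((fun τ : ℍ => (τ : ℂ) ^ (-((q + 1 : ℕ) : ℤ))) ∣[((q + 1 + (p + 1) : ℕ) : ℤ)] (g : SL(2, ℤ))) w)]
  congr 1; ext g
  rw [RK_term]
  exact (hterm g).symm

end EPB

namespace EPB
open UpperHalfPlane ModularForm CongruenceSubgroup Matrix.SpecialLinearGroup Filter Topology
open scoped MatrixGroups Manifold ComplexConjugate

/-- coefficient of the period polynomial -/
def pc (c : ℂ) (k l : ℕ) : ℂ := c * (2 * lam k * lam l : ℂ)⁻¹ * (Complex.I ^ l / bet (l - 1) (k - 1))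

lemma coe_sum_cusp {K : ℤ} {ι : Type*} (s : Finset ι) (a : ι → ℂ) (F : ι → CuspForm (Gamma0 2) K) (z : ℍ) :
    (∑ j ∈ s, a j • F j) z = ∑ j ∈ s, a j * F j z := by
  classical
  induction s using Finset.induction_on with
  | empty => simp
  | insert i s hi ih =>
    rw [Finset.sum_insert hi, Finset.sum_insert hi, ← ih]; rfl

theorem period_vanish {M d : ℕ} (hM : 4 ≤ M) (hd : 3 * (2 * M) < 12 * (d + 2)) {ι : Type*} [Fintype ι]
    (k l : ι → ℕ) (hk : ∀ j, 3 ≤ k j) (hl : ∀ j, 3 ≤ l j) (hke : ∀ j, Even (k j)) (hkl : ∀ j, k j + l j = 2 * M)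
    (c : ι → ℂ) (h : ∀ z : ℍ, ∑ j, c j * (Ezero (k j) z * Einf (l j) z) = 0)
    (F : CuspForm (Gamma0 2) ((2 * M : ℕ) : ℤ)) :
    ∑ j, pc (c j) (k j) (l j) * Lam (2 * M) (l j - 1) F = 0 := by
  have hlam : ∀ m : ℕ, 3 ≤ m → (lam m : ℂ) ≠ 0 := fun m hm => by
    exact_mod_cast (lam_pos (by omega : 2 ≤ m)).ne'
  have hR : ∀ j, ∃ R : CuspForm (Gamma0 2) ((2 * M : ℕ) : ℤ), ⇑R = RK (k j) (l j) := by
    intro j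
    have := RK_cusp (hk j) (hl j)
    rwa [hkl j] at this
  choose R hR using hR
  have hRK : ∀ w : ℍ, ∑ j, c j * (2 * lam (k j) * lam (l j) : ℂ)⁻¹ * RK (k j) (l j) w = 0 := by
    intro w
    have := neumann_zero hM (∑ j, (c j * (2 * lam (k j) * lam (l j) : ℂ)⁻¹) • R j) (by
      intro z
      have h1 := hasSum_sum (s := Finset.univ) (fun j _ => (neumann (hk j) (hl j) (hke j) z).mul_left (c j * (2 * lam (k j) * lam (l j) : ℂ)⁻¹))
      have h2 : ∑ j, c j * (2 * lam (k j) * lam (l j) : ℂ)⁻¹ * (2 * lam (k j) * lam (l j) * (Ezero (k j) z * Einf (l j) z)) = 0 := by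
        rw [← h z]
        refine Finset.sum_congr rfl fun j _ => ?_
        have := hlam _ (hk j)
        have := hlam _ (hl j)
        field_simp
      rw [h2] at h1
      refine h1.congr_fun ?_
      intro u
      rw [coe_sum_cusp, Finset.mul_sum]
      refine Finset.sum_congr rfl fun j _ => ?_
      rw [hR, hkl]; ring) w
    rw [coe_sum_cusp] at this
    rw [← this]
    refine Finset.sum_congr rfl fun j _ => ?_
    rw [hR]
  obtain ⟨s, e, he⟩ := functional_eval hd (∑ j, pc (c j) (k j) (l j) • Lam (2 * M) (l j - 1))
  have hLF : ∀ G, (∑ j, pc (c j) (k j) (l j) • Lam (2 * M) (l j - 1)) G = ∑ j, pc (c j) (k j) (l j) * Lam (2 * M) (l j - 1) G := by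
    intro G
    simp [LinearMap.sum_apply]
  rw [← hLF, he]
  refine kernel_trick hM s e (fun z => z) (fun w => ?_) F
  obtain ⟨G, hG⟩ := hK_cusp hM w
  rw [← hG, ← he, hLF, ← hRK w]
  refine Finset.sum_congr rfl fun j _ => ?_
  have h3 := hk j
  have h4 := hl j
  have h5 := hkl j
  rw [Lam_hK (q := k j - 1) hM (by omega) (by omega) (by omega) w G hG, pc, Nat.sub_add_cancel (by omega), Nat.sub_add_cancel (by omega)]
  have h6 : (bet (l j - 1) (k j - 1) : ℂ) ≠ 0 := by exact_mod_cast (bet_pos _ _).ne'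
  have h7 : (Complex.I ^ l j) ≠ 0 := pow_ne_zero _ Complex.I_ne_zero
  field_simp

end EPB

namespace EPB
open Filter Topology

section descartes
open Polynomial

lemma signVar_lt (P : ℝ[X]) (hP : P ≠ 0) : P.signVariations + 1 ≤ P.support.card := by
  induction hn : P.support.card using Nat.strong_induction_on generalizing P with
  | _ n ih =>
    by_cases h0 : P.eraseLead = 0
    · have h1 : P = monomial P.natDegree P.leadingCoeff := by
        have := P.eraseLead_add_monomial_natDegree_leadingCoeff
        rw [h0, zero_add] at this; exact this.symm
      have h2 : P.signVariations = 0 := by rw [h1]; exact signVariations_monomial _ _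
      have h3 : 0 < P.support.card := by
        rw [Finset.card_pos]; exact nonempty_support_iff.mpr hP
      omega
    · have h1 := eraseLead_support_card_lt hP
      have h2 := ih _ (by omega) P.eraseLead h0 rfl
      have h3 := signVariations_le_eraseLead_succ (P := P)
      omega

lemma no_root_sign (q : ℝ[X]) (hq0 : q ≠ 0) (hq : q.roots = 0) : ∃ s : ℝ, (s = 1 ∨ s = -1) ∧ ∀ y, 0 < s * q.eval y := by
  have hne : ∀ y, q.eval y ≠ 0 := by
    intro y hy
    have : y ∈ q.roots := (mem_roots hq0).2 hy
    simp [hq] at this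
  by_cases h : 0 < q.eval 0
  · refine ⟨1, Or.inl rfl, fun y => ?_⟩
    by_contra hc
    have hc' : q.eval y ≤ 0 := by linarith
    obtain ⟨x, hx⟩ := mem_range_of_exists_le_of_exists_ge q.continuous (c := 0) ⟨y, hc'⟩ ⟨0, h.le⟩
    exact hne x hx
  · refine ⟨-1, Or.inr rfl, fun y => ?_⟩
    by_contra hc
    have hc' : 0 ≤ q.eval y := by linarith
    obtain ⟨x, hx⟩ := mem_range_of_exists_le_of_exists_ge q.continuous (c := 0) ⟨0, not_lt.1 h⟩ ⟨y, hc'⟩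
    exact hne x hx

lemma multiset_prod_nonneg (s : Multiset ℝ) (f : ℝ → ℝ) (h : ∀ a ∈ s, 0 ≤ f a) : 0 ≤ (s.map f).prod := by
  apply Multiset.prod_nonneg
  intro b hb
  obtain ⟨a, ha, rfl⟩ := Multiset.mem_map.1 hb
  exact h a ha

lemma descartes_twist (p : ℝ[X]) (hp : p ≠ 0) (r : ℝ → ℝ) (hr : StrictAntiOn r (Set.Ioi 0)) :
    ∃ Q : ℝ[X], Q.natDegree < p.support.card ∧ ∃ s : ℝ, (∀ y, 0 < y → 0 ≤ s * (p.eval y * Q.eval (r y))) ∧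
      ∀ y, 0 < y → s * (p.eval y * Q.eval (r y)) = 0 → y ∈ p.roots := by
  classical
  obtain ⟨q, hq, -, hq0⟩ := exists_prod_multiset_X_sub_C_mul p
  have hqne : q ≠ 0 := by rintro rfl; simp at hq; exact hp hq.symm
  obtain ⟨s, hs, hsq⟩ := no_root_sign q hqne hq0
  have hs0 : s ≠ 0 := by rcases hs with rfl | rfl <;> norm_num
  set S := p.roots.filter (0 < ·) with hS
  refine ⟨(S.map fun a => C (r a) - X).prod, ?_, s, ?_, ?_⟩
  · have h1 : (S.map fun a => (C (r a) - X : ℝ[X])).prod.natDegree ≤ S.card := by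
      refine (natDegree_multiset_prod_le _).trans ?_
      rw [Multiset.map_map]
      refine (Multiset.sum_le_card_nsmul _ 1 ?_).trans ?_
      · intro x hx
        obtain ⟨a, _, rfl⟩ := Multiset.mem_map.1 hx
        simp only [Function.comp]
        compute_degree
      · simp
    have h2 : S.card ≤ p.signVariations := by
      rw [hS, ← Multiset.countP_eq_card_filter]
      exact roots_countP_pos_le_signVariations _
    have := signVar_lt p hp
    omega
  · intro y hy
    have e1 : p.eval y = (S.map fun a => y - a).prod * ((p.roots.filter (¬ 0 < ·)).map fun a => y - a).prod * q.eval y := by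
      conv_lhs => rw [← hq]
      rw [eval_mul, eval_multiset_prod, Multiset.map_map, ← Multiset.prod_add, ← Multiset.map_add, Multiset.filter_add_not]
      simp [Function.comp_def]
    have e2 : (S.map fun a => C (r a) - X).prod.eval (r y) = (S.map fun a => r a - r y).prod := by
      rw [eval_multiset_prod, Multiset.map_map]
      simp [Function.comp_def]
    have e3 : s * (p.eval y * (S.map fun a => C (r a) - X).prod.eval (r y)) =
        (S.map fun a => (y - a) * (r a - r y)).prod * ((p.roots.filter (¬ 0 < ·)).map fun a => y - a).prod * (s * q.eval y) := by
      rw [e1, e2, Multiset.prod_map_mul]; ring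
    rw [e3]
    refine mul_nonneg (mul_nonneg ?_ ?_) (hsq y).le
    · refine multiset_prod_nonneg _ _ fun a ha => ?_
      have ha' : 0 < a := (Multiset.mem_filter.1 ha).2
      rcases le_total a y with h | h
      · exact mul_nonneg (by linarith) (by linarith [hr.antitoneOn ha' hy h])
      · exact mul_nonneg_of_nonpos_of_nonpos (by linarith) (by linarith [hr.antitoneOn hy ha' h])
    · refine multiset_prod_nonneg _ _ fun a ha => ?_
      have ha' : ¬ 0 < a := (Multiset.mem_filter.1 ha).2
      linarith
  · intro y hy h
    rcases mul_eq_zero.1 ((mul_eq_zero.1 h).resolve_left hs0) with h | h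
    · exact (mem_roots hp).2 h
    · rw [eval_multiset_prod, Multiset.map_map, Multiset.prod_eq_zero_iff] at h
      obtain ⟨a, ha, hae⟩ := Multiset.mem_map.1 h
      have ha' := (Multiset.mem_filter.1 ha)
      simp only [Function.comp, eval_sub, eval_C, eval_X] at hae
      have : a = y := hr.injOn ha'.2 hy (by linarith)
      rw [← this]; exact ha'.1

end descartes

lemma moment_zero {d : ℕ} (c : Fin d → ℝ) (e : Fin d → ℕ) (he : Function.Injective e) (G r : ℝ → ℝ)
    (hG : ∀ y, 0 < y → 0 < G y) (hr : StrictAntiOn r (Set.Ioi 0))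
    (hInt : ∀ i, ∀ n < d, IntegrableOn (fun y : ℝ => y ^ e i * (G y * r y ^ n)) (Set.Ioi 0))
    (h : ∀ n < d, ∑ i, c i * ∫ y in Set.Ioi (0 : ℝ), y ^ e i * (G y * r y ^ n) = 0) : ∀ i, c i = 0 := by
  classical
  open Polynomial in
  by_contra hc
  push Not at hc
  obtain ⟨i₀, hi₀⟩ := hc
  set p : ℝ[X] := ∑ i, monomial (e i) (c i) with hpdef
  have hcoef : ∀ i, p.coeff (e i) = c i := by
    intro i
    rw [hpdef, finsetSum_coeff]
    simp [coeff_monomial, he.eq_iff]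
  have hp : p ≠ 0 := by
    intro h0
    have := hcoef i₀
    rw [h0] at this
    exact hi₀ (by simpa using this.symm)
  have hcard : p.support.card ≤ d := by
    have : p.support ⊆ Finset.univ.image e := by
      intro m hm
      rw [mem_support_iff, hpdef, finsetSum_coeff] at hm
      obtain ⟨i, -, hi⟩ := Finset.exists_ne_zero_of_sum_ne_zero hm
      rw [coeff_monomial] at hi
      simp only [Finset.mem_image, Finset.mem_univ, true_and]
      exact ⟨i, by by_contra h; simp [h] at hi⟩
    refine (Finset.card_le_card this).trans (Finset.card_image_le.trans ?_)
    simp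
  obtain ⟨Q, hQd, s, hs, hz⟩ := descartes_twist p hp r hr
  have hpe : ∀ y, p.eval y = ∑ i, c i * y ^ e i := by
    intro y; rw [hpdef, eval_finsetSum]; simp
  have hQe : ∀ x, Q.eval x = ∑ n ∈ Finset.range d, Q.coeff n * x ^ n := fun x =>
    eval_eq_sum_range' (by omega) x
  have hform : ∀ y, s * (p.eval y * Q.eval (r y)) * G y =
      ∑ i, ∑ n ∈ Finset.range d, s * c i * Q.coeff n * (y ^ e i * (G y * r y ^ n)) := by
    intro y
    rw [hpe, hQe, Finset.sum_mul_sum, Finset.mul_sum, Finset.sum_mul]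
    refine Finset.sum_congr rfl fun i _ => ?_
    rw [Finset.mul_sum, Finset.sum_mul]
    exact Finset.sum_congr rfl fun n _ => by ring
  have hI : IntegrableOn (fun y => s * (p.eval y * Q.eval (r y)) * G y) (Set.Ioi 0) := by
    simp_rw [hform]
    exact integrable_finsetSum _ fun i _ => integrable_finsetSum _ fun n hn =>
      (hInt i n (Finset.mem_range.1 hn)).const_mul _
  have hval : ∫ y in Set.Ioi (0 : ℝ), s * (p.eval y * Q.eval (r y)) * G y = 0 := by
    simp_rw [hform]
    rw [integral_finsetSum _ fun i _ => integrable_finsetSum _ fun n hn =>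
      (hInt i n (Finset.mem_range.1 hn)).const_mul _]
    have : ∀ i : Fin d, ∫ y in Set.Ioi (0 : ℝ), ∑ n ∈ Finset.range d, s * c i * Q.coeff n * (y ^ e i * (G y * r y ^ n)) =
        ∑ n ∈ Finset.range d, s * Q.coeff n * (c i * ∫ y in Set.Ioi (0 : ℝ), y ^ e i * (G y * r y ^ n)) := by
      intro i
      rw [integral_finsetSum _ fun n hn => (hInt i n (Finset.mem_range.1 hn)).const_mul _]
      refine Finset.sum_congr rfl fun n _ => ?_
      rw [integral_const_mul]; ring
    simp_rw [this]
    rw [Finset.sum_comm]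
    refine Finset.sum_eq_zero fun n hn => ?_
    rw [← Finset.mul_sum, h n (Finset.mem_range.1 hn), mul_zero]
  have hae := (setIntegral_eq_zero_iff_of_nonneg_ae (μ := volume) (s := Set.Ioi (0:ℝ)) (by
    filter_upwards [ae_restrict_mem measurableSet_Ioi] with y hy
    exact mul_nonneg (hs y hy) (hG y hy).le) hI).1 hval
  have hnull : volume.restrict (Set.Ioi (0:ℝ)) {y | y ∈ p.roots}ᶜ = 0 := by
    have : ∀ᵐ y ∂volume.restrict (Set.Ioi (0:ℝ)), y ∈ p.roots := by
      filter_upwards [hae, ae_restrict_mem measurableSet_Ioi] with y hy hy0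
      refine hz y hy0 ?_
      simpa [(hG y hy0).ne'] using hy
    exact this
  have hfin : Set.Finite {y | y ∈ p.roots} := by
    have : {y | y ∈ p.roots} = (p.roots.toFinset : Set ℝ) := by ext; simp
    rw [this]; exact Finset.finite_toSet _
  have h0 : volume.restrict (Set.Ioi (0:ℝ)) {y | y ∈ p.roots} = 0 := by
    exact le_antisymm ((Measure.restrict_apply_le _ _).trans (hfin.measure_zero volume).le) bot_le
  have : volume.restrict (Set.Ioi (0:ℝ)) Set.univ = 0 := by
    rw [← Set.union_compl_self {y | y ∈ p.roots}]
    exact measure_union_null h0 hnull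
  simp at this
end EPB

namespace EPB
open UpperHalfPlane ModularForm CongruenceSubgroup Matrix.SpecialLinearGroup Filter Topology
open scoped MatrixGroups Manifold ComplexConjugate

/-- inner Lambert sum -/
def inn (k : ℕ) (x : ℝ) : ℝ := ∑' m : ℕ+, (m : ℝ) ^ (k - 1) * x ^ (m : ℕ)
def AA (k : ℕ) (t : ℝ) : ℝ := ∑' a : ℕ, inn k (Real.exp (-(2 * Real.pi * ((2 * a + 1) * t))))

lemma inn_hasSum (k : ℕ) {x : ℝ} (h0 : 0 < x) (h1 : x < 1) : Summable (fun m : ℕ+ => (m : ℝ) ^ (k - 1) * x ^ (m : ℕ)) := by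
  have := summable_pow_mul_geometric_of_norm_lt_one (k - 1) (r := x) (by rw [Real.norm_eq_abs, abs_of_pos h0]; exact h1)
  exact this.comp_injective PNat.coe_injective

lemma inn_pos (k : ℕ) {x : ℝ} (h0 : 0 < x) (h1 : x < 1) : 0 < inn k x :=
  (inn_hasSum k h0 h1).tsum_pos (fun m => by positivity) 1 (by simp; exact h0)

lemma lipschitz {k : ℕ} (hk : 3 ≤ k) {c t : ℝ} (hc : 0 < c) (ht : 0 < t) :
    ∑' n : ℤ, ((c : ℂ) * (t * Complex.I) + n) ^ (-(k : ℤ)) =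
      ((-2 * Real.pi * Complex.I) ^ k / (k - 1).factorial) * (inn k (Real.exp (-(2 * Real.pi * (c * t)))) : ℂ) := by
  have h := EisensteinSeries.qExpansion_identity_pnat (k := k - 1) (by omega) (iy (c * t))
  rw [iy_coe (by positivity), show k - 1 + 1 = k by omega] at h
  have e1 : ∑' n : ℤ, ((c : ℂ) * (t * Complex.I) + n) ^ (-(k : ℤ)) = ∑' n : ℤ, 1 / (((c * t : ℝ) : ℂ) * Complex.I + n) ^ k := by
    refine tsum_congr fun n => ?_
    rw [zpow_neg, zpow_natCast, one_div]; push_cast; rw [mul_assoc]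
  rw [e1, h]
  congr 1
  rw [inn, Complex.ofReal_tsum]
  refine tsum_congr fun m => ?_
  push_cast
  congr 3
  linear_combination (2 * Real.pi * (c * t)) * Complex.I_sq

def eO : ℤ × ℤ ≃ {p : ℤ × ℤ // Odd p.1} where
  toFun x := ⟨(2 * x.1 + 1, x.2), ⟨x.1, rfl⟩⟩
  invFun p := (p.1.1 / 2, p.1.2)
  left_inv x := by ext <;> simp; omega
  right_inv p := by
    obtain ⟨⟨a, b⟩, n, hn⟩ := p
    simp only at hn
    ext <;> simp; omega

def eOE : {p : ℤ × ℤ // Odd p.1} ≃ {p : ℤ × ℤ // Even p.1 ∧ Odd p.2} where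
  toFun p := ⟨(-2 * p.1.2, p.1.1), ⟨-p.1.2, by ring⟩, p.2⟩
  invFun p := ⟨(p.1.2, -(p.1.1 / 2)), p.2.2⟩
  left_inv p := by ext <;> simp; omega
  right_inv p := by
    obtain ⟨⟨a, b⟩, ⟨n, hn⟩, h⟩ := p
    simp only at hn
    ext <;> simp; omega

lemma Ezero_iy {k : ℕ} (hk : 3 ≤ k) (hke : Even k) {t : ℝ} (ht : 0 < t) :
    Ezero k (iy t) = ((-2 * Real.pi * Complex.I) ^ k / (k - 1).factorial / lam k) * (AA k t : ℂ) ∧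
    Summable (fun a : ℕ => inn k (Real.exp (-(2 * Real.pi * ((2 * a + 1) * t))))) := by
  have hlam : (lam k : ℂ) ≠ 0 := by exact_mod_cast (lam_pos (by omega : 2 ≤ k)).ne'
  have hs : Summable (fun x : ℤ × ℤ => tm k (iy t) (eO x).1) :=
    ((tm_summable hk (iy t)).of_norm).comp_injective (Subtype.val_injective.comp eO.injective)
  have h1 := sumA hk (iy t)
  rw [← eO.tsum_eq, hs.tsum_prod] at h1
  set g : ℤ → ℂ := fun a => ∑' n : ℤ, tm k (iy t) (eO (a, n)).1 with hg
  have hgs : Summable g := hs.prod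
  have hneg : ∀ n : ℕ, g (-(n + 1 : ℤ)) = g n := by
    intro n
    simp only [hg]
    rw [← (Equiv.neg ℤ).tsum_eq]
    refine tsum_congr fun m => ?_
    simp only [tm, eO, Equiv.coe_fn_mk, Equiv.neg_apply]
    have hke' : Even (-(k : ℤ)) := ((Int.even_coe_nat k).2 hke).neg
    rw [← hke'.neg_zpow]
    congr 1
    push_cast; ring
  have hgn : ∀ n : ℕ, g n = ((-2 * Real.pi * Complex.I) ^ k / (k - 1).factorial) *
      (inn k (Real.exp (-(2 * Real.pi * ((2 * n + 1) * t)))) : ℂ) := by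
    intro n
    rw [← lipschitz hk (by positivity) ht]
    simp only [hg]
    refine tsum_congr fun m => ?_
    simp only [tm, eO, Equiv.coe_fn_mk, iy_coe ht]
    push_cast; rfl
  have hC : ((-2 * Real.pi * Complex.I) ^ k / (k - 1).factorial : ℂ) ≠ 0 := by
    have : (Real.pi : ℂ) ≠ 0 := by exact_mod_cast Real.pi_ne_zero
    have h2 : ((k - 1).factorial : ℂ) ≠ 0 := by exact_mod_cast Nat.factorial_ne_zero _
    exact div_ne_zero (pow_ne_zero _ (by simp [this])) h2
  have hgs' : Summable (fun n : ℕ => g n) := hgs.comp_injective Nat.cast_injective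
  have hsR : Summable (fun a : ℕ => inn k (Real.exp (-(2 * Real.pi * ((2 * a + 1) * t))))) := by
    simp_rw [hgn] at hgs'
    rw [summable_mul_left_iff hC] at hgs'
    exact Complex.summable_ofReal.1 hgs'
  refine ⟨?_, hsR⟩
  have h2 : ∑' a : ℤ, g a = 2 * ∑' n : ℕ, g n := by
    rw [tsum_of_nat_of_neg_add_one hgs' (by simp_rw [hneg]; exact hgs')]
    simp_rw [hneg]; ring
  rw [h2] at h1
  simp_rw [hgn] at h1
  rw [tsum_mul_left, ← Complex.ofReal_tsum] at h1
  rw [AA]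
  field_simp
  field_simp at h1
  linear_combination -h1

lemma Einf_iy {k : ℕ} (hk : 3 ≤ k) {t : ℝ} (ht : 0 < t) :
    Einf k (iy (1 / (2 * t))) = (t * Complex.I) ^ k * Ezero k (iy t) := by
  have hlam : (lam k : ℂ) ≠ 0 := by exact_mod_cast (lam_pos (by omega : 2 ≤ k)).ne'
  have h1 := sumA hk (iy t)
  have h2 := sumB hk (iy (1 / (2 * t)))
  rw [← eOE.tsum_eq] at h2
  have htc : (t : ℂ) ≠ 0 := by exact_mod_cast ht.ne'
  have : ∀ p : {p : ℤ × ℤ // Odd p.1}, tm k (iy (1 / (2 * t))) (eOE p).1 = (t * Complex.I) ^ k * tm k (iy t) p.1 := by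
    intro p
    simp only [tm, eOE, Equiv.coe_fn_mk, iy_coe ht]
    rw [iy_coe (by positivity), zpow_neg, zpow_neg, zpow_natCast, zpow_natCast, ← inv_pow, ← inv_pow, ← mul_pow]
    congr 1
    have : (((-2 * p.1.2 : ℤ) : ℂ) * (((1 / (2 * t) : ℝ) : ℂ) * Complex.I) + (p.1.1 : ℂ)) =
        ((t * Complex.I))⁻¹ * ((p.1.1 : ℂ) * (t * Complex.I) + p.1.2) := by
      push_cast
      field_simp
      ring_nf
      simp [Complex.I_sq]
    rw [this, mul_inv, inv_inv]
  simp_rw [this] at h2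
  rw [tsum_mul_left, h1] at h2
  have h3 : (lam k : ℂ) * Einf k (iy (1 / (2 * t))) = lam k * ((t * Complex.I) ^ k * Ezero k (iy t)) := by
    linear_combination -h2 / 2
  exact mul_left_cancel₀ hlam h3
end EPB

namespace EPB
open UpperHalfPlane ModularForm CongruenceSubgroup Matrix.SpecialLinearGroup Filter Topology
open scoped MatrixGroups Manifold ComplexConjugate

lemma sinh_ratio {u v : ℝ} (hu : 0 < u) (huv : u ≤ v) : v * Real.sinh u ≤ u * Real.sinh v := by
  have hc : ConvexOn ℝ (Set.Ici 0) Real.sinh := by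
    apply MonotoneOn.convexOn_of_deriv (convex_Ici 0) Real.continuous_sinh.continuousOn
      Real.differentiable_sinh.differentiableOn
    rw [interior_Ici, Real.deriv_sinh]
    intro a ha b hb hab
    rw [Real.cosh_le_cosh, abs_of_pos ha, abs_of_pos hb]; exact hab
  have hv : 0 < v := hu.trans_le huv
  have := hc.2 (Set.mem_Ici.2 hv.le) (Set.mem_Ici.2 le_rfl) (show 0 ≤ u / v by positivity)
    (show 0 ≤ 1 - u / v by rw [sub_nonneg]; exact (div_le_one hv).2 huv) (by ring)
  simp only [smul_eq_mul, mul_zero, add_zero, Real.sinh_zero] at this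
  rw [div_mul_cancel₀ _ hv.ne'] at this
  calc v * Real.sinh u ≤ v * (u / v * Real.sinh v) := by gcongr
    _ = u * Real.sinh v := by field_simp

def gg (s : ℝ) : ℝ := 1 / (4 * Real.sinh (s / 2) ^ 2)

lemma inn4 {s : ℝ} (hs : 0 < s) : inn 4 (Real.exp (-s)) = gg s * (1 + 6 * gg s) := by
  set x := Real.exp (-s) with hx
  have hx0 : 0 < x := Real.exp_pos _
  have hx1 : x < 1 := by rw [hx, Real.exp_lt_one_iff]; linarith
  have hn : ‖x‖ < 1 := by rw [Real.norm_eq_abs, abs_of_pos hx0]; exact hx1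
  have a3 := hasSum_choose_mul_geometric_of_norm_lt_one 3 hn
  have a2 := hasSum_choose_mul_geometric_of_norm_lt_one 2 hn
  have a1 := hasSum_choose_mul_geometric_of_norm_lt_one 1 hn
  have hsum := (((a3.mul_left 6).sub (a2.mul_left 6)).add a1).mul_left x
  have hval : inn 4 x = x * (6 * (1 / (1 - x) ^ (3 + 1)) - 6 * (1 / (1 - x) ^ (2 + 1)) + 1 / (1 - x) ^ (1 + 1)) := by
    rw [← hsum.tsum_eq, inn, ← Equiv.pnatEquivNat.symm.tsum_eq]
    refine tsum_congr fun n => ?_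
    have h3 : ((n + 3).choose 3 : ℝ) = (n + 3) * (n + 2) * (n + 1) / 6 := by
      rw [Nat.cast_choose_eq_ascPochhammer_div]
      simp [ascPochhammer_succ_eval, Nat.factorial]
      ring
    have h2 : ((n + 2).choose 2 : ℝ) = (n + 2) * (n + 1) / 2 := by
      rw [Nat.cast_choose_eq_ascPochhammer_div]
      simp [ascPochhammer_succ_eval, Nat.factorial]
      ring
    have h1 : ((n + 1).choose 1 : ℝ) = n + 1 := by simp
    rw [h3, h2, h1]
    simp [Nat.succPNat]
    ring
  have hg : gg s = x / (1 - x) ^ 2 := by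
    have hE : Real.exp (-(s / 2)) ≠ 0 := (Real.exp_pos _).ne'
    have hxE : x = Real.exp (-(s / 2)) ^ 2 := by rw [hx, ← Real.exp_nat_mul]; congr 1; push_cast; ring
    have hE2 : Real.exp (s / 2) = (Real.exp (-(s / 2)))⁻¹ := by rw [Real.exp_neg, inv_inv]
    rw [gg, Real.sinh_eq, hE2]
    have h1 : 1 - x ≠ 0 := by linarith
    rw [hxE] at h1 ⊢
    have h2 : (Real.exp (-(s / 2)))⁻¹ - Real.exp (-(s / 2)) ≠ 0 := by
      intro h
      apply h1
      field_simp at h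
      simpa using h
    have h3 : (Real.exp (-(s / 2)))⁻¹ - Real.exp (-(s / 2)) = (1 - Real.exp (-(s / 2)) ^ 2) / Real.exp (-(s / 2)) := by
      field_simp
    rw [h3]
    field_simp
    norm_num
  rw [hval, hg]
  have h1 : 1 - x ≠ 0 := by linarith
  field_simp
  ring

lemma sq_inn4_anti {s t : ℝ} (hs : 0 < s) (hst : s < t) :
    t ^ 2 * inn 4 (Real.exp (-t)) < s ^ 2 * inn 4 (Real.exp (-s)) := by
  have ht := hs.trans hst
  rw [inn4 hs, inn4 ht]
  have p1 : 0 < Real.sinh (s / 2) := Real.sinh_pos_iff.2 (by linarith)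
  have p2 : 0 < Real.sinh (t / 2) := Real.sinh_pos_iff.2 (by linarith)
  have p3 : Real.sinh (s / 2) < Real.sinh (t / 2) := Real.sinh_lt_sinh.2 (by linarith)
  have g1 : gg t < gg s := by
    unfold gg; gcongr
  have g0 : 0 < gg t := by unfold gg; positivity
  have h := sinh_ratio (u := s / 2) (v := t / 2) (by linarith) (by linarith)
  have g2 : t ^ 2 * gg t ≤ s ^ 2 * gg s := by
    unfold gg
    rw [mul_one_div, mul_one_div, div_le_div_iff₀ (by positivity) (by positivity)]
    have : (t * Real.sinh (s / 2)) ^ 2 ≤ (s * Real.sinh (t / 2)) ^ 2 := by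
      apply pow_le_pow_left₀ (by positivity); linarith
    nlinarith
  have g3 : 0 < t ^ 2 * gg t := by positivity
  calc t ^ 2 * (gg t * (1 + 6 * gg t)) = (t ^ 2 * gg t) * (1 + 6 * gg t) := by ring
    _ < (t ^ 2 * gg t) * (1 + 6 * gg s) := by gcongr
    _ ≤ (s ^ 2 * gg s) * (1 + 6 * gg s) := by
        have : 0 < gg s := g0.trans g1
        gcongr
    _ = _ := by ring

lemma AA_summable {k : ℕ} (hk : 3 ≤ k) (hke : Even k) {t : ℝ} (ht : 0 < t) :
    Summable (fun a : ℕ => inn k (Real.exp (-(2 * Real.pi * ((2 * a + 1) * t))))) := (Ezero_iy hk hke ht).2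

lemma AA_pos {k : ℕ} (hk : 3 ≤ k) (hke : Even k) {t : ℝ} (ht : 0 < t) : 0 < AA k t := by
  have hp : ∀ a : ℕ, 0 < inn k (Real.exp (-(2 * Real.pi * ((2 * a + 1) * t)))) := fun a =>
    inn_pos k (Real.exp_pos _) (by
      rw [Real.exp_lt_one_iff]
      have : 0 < 2 * Real.pi * ((2 * a + 1) * t) := by positivity
      linarith)
  exact (AA_summable hk hke ht).tsum_pos (fun a => (hp a).le) 0 (hp 0)

lemma AA4_anti {s t : ℝ} (hs : 0 < s) (hst : s < t) : t ^ 2 * AA 4 t < s ^ 2 * AA 4 s := by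
  have ht := hs.trans hst
  rw [AA, AA, ← tsum_mul_left, ← tsum_mul_left]
  have key : ∀ a : ℕ, t ^ 2 * inn 4 (Real.exp (-(2 * Real.pi * ((2 * a + 1) * t)))) <
      s ^ 2 * inn 4 (Real.exp (-(2 * Real.pi * ((2 * a + 1) * s)))) := by
    intro a
    have hc : 0 < 2 * Real.pi * (2 * a + 1) := by positivity
    have := sq_inn4_anti (s := 2 * Real.pi * ((2 * a + 1) * s)) (t := 2 * Real.pi * ((2 * a + 1) * t)) (by positivity)
      (by gcongr)
    have e : ∀ (x X : ℝ), (2 * Real.pi * ((2 * a + 1) * x)) ^ 2 * X = (2 * Real.pi * (2 * a + 1)) ^ 2 * (x ^ 2 * X) := fun x X => by ring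
    rw [e, e] at this
    exact lt_of_mul_lt_mul_left this (by positivity)
  exact Summable.tsum_lt_tsum (i := 0) (fun a => (key a).le) (key 0)
    ((AA_summable (by norm_num) (by decide) ht).mul_left _) ((AA_summable (by norm_num) (by decide) hs).mul_left _)

/-- real values on the imaginary axis -/
def eI (k : ℕ) (y : ℝ) : ℝ := (2 * Real.pi * (1 / (2 * y))) ^ k / (k - 1).factorial / lam k * AA k (1 / (2 * y))
def eZ (y : ℝ) : ℝ := (2 * Real.pi) ^ 4 / Nat.factorial 3 / lam 4 * AA 4 y

lemma eZ_eq {y : ℝ} (hy : 0 < y) : Ezero 4 (iy y) = (eZ y : ℂ) := by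
  rw [(Ezero_iy (by norm_num) (by decide) hy).1, eZ]
  push_cast
  congr 3
  rw [mul_pow, Complex.I_pow_four]; ring

lemma eI_eq {k : ℕ} (hk : 3 ≤ k) (hke : Even k) {y : ℝ} (hy : 0 < y) : Einf k (iy y) = (eI k y : ℂ) := by
  have ht : 0 < 1 / (2 * y) := by positivity
  have h := Einf_iy hk ht
  rw [show 1 / (2 * (1 / (2 * y))) = y by field_simp] at h
  rw [h, (Ezero_iy hk hke ht).1, eI]
  generalize 1 / (2 * y) = t
  have : ((2 * Real.pi * (t) : ℝ) : ℂ) ^ k = ((t : ℂ) * Complex.I) ^ k * (-2 * Real.pi * Complex.I) ^ k := by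
    rw [← mul_pow]
    congr 1
    push_cast
    linear_combination (2 * Real.pi * (t)) * Complex.I_sq
  rw [Complex.ofReal_mul, Complex.ofReal_div, Complex.ofReal_div, Complex.ofReal_pow, this]
  push_cast
  ring

lemma eI_pos {k : ℕ} (hk : 3 ≤ k) (hke : Even k) {y : ℝ} (hy : 0 < y) : 0 < eI k y := by
  have := lam_pos (by omega : 2 ≤ k)
  have := AA_pos hk hke (show 0 < 1 / (2 * y) by positivity)
  unfold eI; positivity

lemma eZ_pos {y : ℝ} (hy : 0 < y) : 0 < eZ y := by
  have := lam_pos (by omega : 2 ≤ 4)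
  have := AA_pos (by norm_num : 3 ≤ 4) (by decide) hy
  unfold eZ; positivity

lemma ratio_anti : StrictAntiOn (fun y => eZ y / eI 4 y) (Set.Ioi 0) := by
  intro a ha b hb hab
  have ha : 0 < a := ha
  have hb : 0 < b := hb
  have hl := lam_pos (by omega : 2 ≤ 4)
  have e : ∀ y : ℝ, 0 < y → eZ y / eI 4 y = 4 * (y ^ 2 * AA 4 y) / ((1 / (2 * y)) ^ 2 * AA 4 (1 / (2 * y))) := by
    intro y hy
    have := (AA_pos (by norm_num : 3 ≤ 4) (by decide) (show 0 < 1 / (2 * y) by positivity)).ne'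
    have hl' := hl.ne'
    unfold eZ eI
    field_simp
    ring
  simp only
  rw [e a ha, e b hb]
  have h1 := AA4_anti ha hab
  have h2 := AA4_anti (s := 1 / (2 * b)) (t := 1 / (2 * a)) (by positivity) (by gcongr)
  have := (AA_pos (by norm_num : 3 ≤ 4) (by decide) (show 0 < 1 / (2 * a) by positivity))
  have := (AA_pos (by norm_num : 3 ≤ 4) (by decide) (show 0 < 1 / (2 * b) by positivity))
  have := (AA_pos (by norm_num : 3 ≤ 4) (by decide) hb)
  have := (AA_pos (by norm_num : 3 ≤ 4) (by decide) ha)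
  apply div_lt_div₀ _ h2.le (by positivity) (by positivity)
  linarith
end EPB

namespace EPB
open UpperHalfPlane ModularForm CongruenceSubgroup Matrix.SpecialLinearGroup Filter Topology
open scoped MatrixGroups Manifold ComplexConjugate

lemma cusp_mul_pow {K g : ℤ} (F : CuspForm (Gamma0 2) K) (G : ModularForm (Gamma0 2) g) (n : ℕ) (K' : ℤ) (h : K' = K + n * g) :
    ∃ H : CuspForm (Gamma0 2) K', ∀ z, H z = F z * G z ^ n := by
  induction n generalizing K' with
  | zero => 
    have : K' = K := by simpa using h
    subst this
    exact ⟨F, fun z => by simp⟩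
  | succ n ih =>
    obtain ⟨H, hH⟩ := ih _ rfl
    obtain ⟨H', hH'⟩ := cusp_mul H G
    have : K' = K + n * g + g := by rw [h]; push_cast; ring
    subst this
    exact ⟨H', fun z => by rw [hH', hH, pow_succ, mul_assoc]⟩

lemma test_form {M d m : ℕ} (hm : m = 4 ∨ m = 6) (hM : 2 * M = 4 * d + m) {n : ℕ} (hn : n < d) :
    ∃ F : CuspForm (Gamma0 2) ((2 * M : ℕ) : ℤ), ∀ z : ℍ, F z = Ezero 4 z * Einf m z * Ezero 4 z ^ n * Einf 4 z ^ (d - 1 - n) := by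
  obtain ⟨F0, h0⟩ := prod_cusp (k := 4) (l := m) (by norm_num) (by omega)
  obtain ⟨G1, h1⟩ := Ezero_modular (k := 4) (by norm_num)
  obtain ⟨G2, h2⟩ := Einf_modular (k := 4) (by norm_num)
  obtain ⟨F1, h3⟩ := cusp_mul_pow F0 G1 n _ rfl
  obtain ⟨F2, h4⟩ := cusp_mul_pow F1 G2 (d - 1 - n) ((2 * M : ℕ) : ℤ) (by
    rw [hM]; push_cast [show 1 ≤ d by omega, show n ≤ d - 1 by omega]
    ring)
  exact ⟨F2, fun z => by rw [h4, h3, h0, h1, h2]⟩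

theorem indep {M d m : ℕ} (hd : 1 ≤ d) (hm : m = 4 ∨ m = 6) (hM : 2 * M = 4 * d + m)
    (k l : Fin d → ℕ) (hk : ∀ j, 3 ≤ k j) (hl : ∀ j, 3 ≤ l j) (hke : ∀ j, Even (k j)) (hkl : ∀ j, k j + l j = 2 * M)
    (hinj : Function.Injective l) (c : Fin d → ℂ) (h : ∀ z : ℍ, ∑ j, c j * (Ezero (k j) z * Einf (l j) z) = 0) :
    ∀ j, c j = 0 := by
  have hme : Even m := by rcases hm with rfl | rfl <;> decide
  have hm3 : 3 ≤ m := by omega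
  have hpv := period_vanish (M := M) (d := d) (by omega) (by omega) k l hk hl hke hkl c h
  set G : ℝ → ℝ := fun y => eZ y * eI m y * eI 4 y ^ (d - 1) with hG
  set r : ℝ → ℝ := fun y => eZ y / eI 4 y with hr
  have hGpos : ∀ y, 0 < y → 0 < G y := fun y hy => by
    have := eZ_pos hy
    have := eI_pos hm3 hme hy
    have := eI_pos (k := 4) (by norm_num) (by decide) hy
    simp only [hG]; positivity
  have hinj' : Function.Injective (fun j => l j - 1) := fun a b hab => hinj (by
    have := hl a; have := hl b; simp only at hab; omega)
  have key : ∀ n < d, ∃ F : CuspForm (Gamma0 2) ((2 * M : ℕ) : ℤ), ∀ y : ℝ, 0 < y → F (iy y) = ((G y * r y ^ n : ℝ) : ℂ) := by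
    intro n hn
    obtain ⟨F, hF⟩ := test_form hm hM hn
    refine ⟨F, fun y hy => ?_⟩
    rw [hF, eZ_eq hy, eI_eq hm3 hme hy, eI_eq (k := 4) (by norm_num) (by decide) hy]
    have h4 := (eI_pos (k := 4) (by norm_num) (by decide) hy).ne'
    have : G y * r y ^ n = eZ y * eI m y * eZ y ^ n * eI 4 y ^ (d - 1 - n) := by
      simp only [hG, hr]
      have : eI 4 y ^ (d - 1) = eI 4 y ^ (d - 1 - n) * eI 4 y ^ n := by rw [← pow_add]; congr 1; omega
      rw [this, div_pow]
      field_simp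
    rw [this]; push_cast; rfl
  have hI : ∀ p : ℕ, ∀ n < d, IntegrableOn (fun y : ℝ => y ^ p * (G y * r y ^ n)) (Set.Ioi 0) := by
    intro p n hn
    obtain ⟨F, hF⟩ := key n hn
    have h1 := (int_F F p).re
    refine (integrableOn_congr_fun (fun y hy => ?_) measurableSet_Ioi).1 h1
    rw [hF y hy, ← Complex.ofReal_pow, ← Complex.ofReal_mul]
    exact Complex.ofReal_re _
  have hS : ∀ n < d, ∑ j, pc (c j) (k j) (l j) * ((∫ y in Set.Ioi (0:ℝ), y ^ (l j - 1) * (G y * r y ^ n) : ℝ) : ℂ) = 0 := by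
    intro n hn
    obtain ⟨F, hF⟩ := key n hn
    rw [← hpv F]
    refine Finset.sum_congr rfl fun j _ => ?_
    congr 1
    refine (integral_ofReal (𝕜 := ℂ)).symm.trans ?_
    refine setIntegral_congr_fun measurableSet_Ioi fun y hy => ?_
    rw [hF y hy]; push_cast; rfl
  have hre := moment_zero (fun j => (pc (c j) (k j) (l j)).re) _ hinj' G r hGpos ratio_anti (fun i n hn => hI _ n hn) (by
    intro n hn
    have := congrArg Complex.re (hS n hn)
    simpa [Complex.re_sum] using this)
  have him := moment_zero (fun j => (pc (c j) (k j) (l j)).im) _ hinj' G r hGpos ratio_anti (fun i n hn => hI _ n hn) (by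
    intro n hn
    have := congrArg Complex.im (hS n hn)
    simpa [Complex.im_sum] using this)
  intro j
  have h0 : pc (c j) (k j) (l j) = 0 := Complex.ext (hre j) (him j)
  have hlam : ∀ m : ℕ, 3 ≤ m → (lam m : ℂ) ≠ 0 := fun m hm => by
    exact_mod_cast (lam_pos (by omega : 2 ≤ m)).ne'
  have h1 := hlam _ (hk j)
  have h2 := hlam _ (hl j)
  have h3 : (bet (l j - 1) (k j - 1) : ℂ) ≠ 0 := by exact_mod_cast (bet_pos _ _).ne'
  simpa [pc, h1, h2, h3] using h0

theorem family {w M d m : ℕ} (hd : 1 ≤ d) (hm : m = 4 ∨ m = 6) (hM : 2 * M = 4 * d + m) (hw : w + 2 = 2 * M)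
    (k l : Fin d → ℕ) (hk : ∀ j, 3 ≤ k j) (hl : ∀ j, 3 ≤ l j) (hke : ∀ j, Even (k j)) (hkl : ∀ j, k j + l j = 2 * M)
    (hinj : Function.Injective l) :
    (∀ j, ∃ F : CuspForm (Gamma0 2) ((w : ℤ) + 2), ∀ z : ℍ, F z = Ezero (k j) (z : ℂ) * Einf (l j) (z : ℂ)) ∧
    (∀ c : Fin d → ℂ, (∀ z : ℂ, 0 < z.im → ∑ j, c j * (Ezero (k j) z * Einf (l j) z) = 0) → ∀ j, c j = 0) ∧
    ∀ f : CuspForm (Gamma0 2) ((w : ℤ) + 2), ∃ c : Fin d → ℂ, ∀ z : ℍ,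
      f z = ∑ j, c j * (Ezero (k j) (z : ℂ) * Einf (l j) (z : ℂ)) := by
  have hwt : (w : ℤ) + 2 = ((2 * M : ℕ) : ℤ) := by rw [← hw]; push_cast; ring
  rw [hwt]
  have hF : ∀ j, ∃ F : CuspForm (Gamma0 2) ((2 * M : ℕ) : ℤ), ∀ z : ℍ, F z = Ezero (k j) (z : ℂ) * Einf (l j) (z : ℂ) := by
    intro j
    have := prod_cusp (hk j) (hl j)
    rwa [hkl j] at this
  have hind := fun c => indep hd hm hM k l hk hl hke hkl hinj c
  refine ⟨hF, fun c h => hind c fun z => h z z.im_pos, ?_⟩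
  intro f
  choose F hF using hF
  have hdim : 3 * (2 * M) < 12 * (d + 2) := by omega
  haveI := cusp_finite hdim
  have hli : LinearIndependent ℂ F := by
    rw [Fintype.linearIndependent_iff]
    intro g hg
    refine hind g fun z => ?_
    have := congrArg (fun H : CuspForm (Gamma0 2) ((2 * M : ℕ) : ℤ) => H z) hg
    simp only [coe_sum_cusp] at this
    simp_rw [hF] at this
    exact this
  have hcard : Fintype.card (Fin d) = Module.finrank ℂ (CuspForm (Gamma0 2) ((2 * M : ℕ) : ℤ)) :=
    le_antisymm hli.fintype_card_le_finrank (by simpa using cusp_finrank hdim)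
  haveI : Nonempty (Fin d) := ⟨⟨0, hd⟩⟩
  have hsp := hli.span_eq_top_of_card_eq_finrank hcard
  have hf : f ∈ Submodule.span ℂ (Set.range F) := by rw [hsp]; trivial
  obtain ⟨c, hc⟩ := (Submodule.mem_span_range_iff_exists_fun ℂ).1 hf
  refine ⟨c, fun z => ?_⟩
  rw [← hc, coe_sum_cusp]
  simp_rw [hF]
end EPB


theorem eisenstein_product_bases (w : ℕ) (hw : 6 ≤ w) (hwe : Even w) (hdw : 1 ≤ (w - 2) / 4) :
    ((∀ j : Fin ((w - 2) / 4),
        ∃ F : CuspForm (CongruenceSubgroup.Gamma0 2) ((w : ℤ) + 2),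
          ∀ z : UpperHalfPlane,
            F z = Ezero (2 * (j.1 + 1) + 2) (z : ℂ) * Einf (w - 2 * (j.1 + 1)) (z : ℂ)) ∧
      (∀ c : Fin ((w - 2) / 4) → ℂ,
        (∀ z : ℂ, 0 < z.im →
            ∑ j, c j * (Ezero (2 * (j.1 + 1) + 2) z * Einf (w - 2 * (j.1 + 1)) z) = 0) →
          ∀ j, c j = 0) ∧
      ∀ f : CuspForm (CongruenceSubgroup.Gamma0 2) ((w : ℤ) + 2),
        ∃ c : Fin ((w - 2) / 4) → ℂ,
          ∀ z : UpperHalfPlane,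
            f z = ∑ j, c j *
              (Ezero (2 * (j.1 + 1) + 2) (z : ℂ) * Einf (w - 2 * (j.1 + 1)) (z : ℂ))) ∧
    ((∀ j : Fin ((w - 2) / 4),
        ∃ F : CuspForm (CongruenceSubgroup.Gamma0 2) ((w : ℤ) + 2),
          ∀ z : UpperHalfPlane,
            F z = Ezero (w - 2 * (j.1 + 1)) (z : ℂ) * Einf (2 * (j.1 + 1) + 2) (z : ℂ)) ∧
      (∀ c : Fin ((w - 2) / 4) → ℂ,
        (∀ z : ℂ, 0 < z.im →
            ∑ j, c j * (Ezero (w - 2 * (j.1 + 1)) z * Einf (2 * (j.1 + 1) + 2) z) = 0) →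
          ∀ j, c j = 0) ∧
      ∀ f : CuspForm (CongruenceSubgroup.Gamma0 2) ((w : ℤ) + 2),
        ∃ c : Fin ((w - 2) / 4) → ℂ,
          ∀ z : UpperHalfPlane,
            f z = ∑ j, c j *
              (Ezero (w - 2 * (j.1 + 1)) (z : ℂ) * Einf (2 * (j.1 + 1) + 2) (z : ℂ))) := by
  obtain ⟨v, hv⟩ := hwe
  obtain ⟨m, hm, hM⟩ : ∃ m, (m = 4 ∨ m = 6) ∧ 2 * (v + 1) = 4 * ((w - 2) / 4) + m :=
    ⟨2 * (v + 1) - 4 * ((w - 2) / 4), by omega, by omega⟩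
  constructor
  · refine EPB.family (w := w) (M := v + 1) hdw hm hM (by omega) (fun j => 2 * (j.1 + 1) + 2)
      (fun j => w - 2 * (j.1 + 1)) ?_ ?_ ?_ ?_ ?_
    · intro j; omega
    · intro j; have := j.2; omega
    · intro j; exact ⟨j.1 + 2, by ring⟩
    · intro j; have := j.2; omega
    · intro a b hab
      have := a.2
      have := b.2
      simp only at hab
      exact Fin.ext (by omega)
  · refine EPB.family (w := w) (M := v + 1) hdw hm hM (by omega) (fun j => w - 2 * (j.1 + 1))
      (fun j => 2 * (j.1 + 1) + 2) ?_ ?_ ?_ ?_ ?_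
    · intro j; have := j.2; omega
    · intro j; omega
    · intro j; have := j.2; exact ⟨v - (j.1 + 1), by omega⟩
    · intro j; have := j.2; omega
    · intro a b hab
      simp only at hab
      exact Fin.ext (by omega)
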